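/- Any two finite groups G and H, each of order 2^4 · 3^2 · 19^2 · 31 · 37^3 · 43 and each having prime graph degrees deg(2) = 3, deg(3) = 2, deg(19) = 3, deg(31) = 1, deg(37) = 2, deg(43) = 1, are isomorphic. -/

import Mathlib

/-- The degree of the prime `p` in the prime graph (Gruenberg–Kegel graph) `GK(G)` of the
group `G`: the number of primes `q ≠ p` such that `G` contains an element of order `p * q`
(two distinct primes being adjacent in `GK(G)` iff `G` has an element of order their
product). -/
noncomputable def gkDegree (G : Type*) [Group G] (p : ℕ) : ℕ :=
  Nat.card {q : ℕ // p ≠ q ∧ p.Prime ∧ q.Prime ∧ ∃ g : G, orderOf g = p * q}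

open scoped Pointwise

section SylowIn
variable {G : Type*} [Group G] {p : ℕ} {P Q R L X : Subgroup G}

lemma relIndex_mul_card_of_le (P L : Subgroup G) (h : P ≤ L) :
    P.relIndex L * Nat.card P = Nat.card L := by
  rw [← Subgroup.index_mul_card (P.subgroupOf L),
    Nat.card_congr (Subgroup.subgroupOfEquivOfLe h).toEquiv, Subgroup.relIndex]

/-- `P` is a Sylow `p`-subgroup of the subgroup `L`. -/
def IsSyl (p : ℕ) (P L : Subgroup G) : Prop :=
  P ≤ L ∧ IsPGroup p P ∧ ¬ p ∣ P.relIndex L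

lemma IsSyl.le (h : IsSyl p P L) : P ≤ L := h.1

lemma IsSyl.isPGroup (h : IsSyl p P L) : IsPGroup p P := h.2.1

/-- The Sylow subgroup of the type `L` corresponding to a Sylow subgroup in `L`. -/
noncomputable def IsSyl.toSylow [Fact p.Prime] (h : IsSyl p P L) : Sylow p L :=
  IsPGroup.toSylow (P := P.subgroupOf L)
    (h.2.1.of_equiv (Subgroup.subgroupOfEquivOfLe h.1).symm) h.2.2

lemma IsSyl.coe_toSylow [Fact p.Prime] (h : IsSyl p P L) :
    (h.toSylow : Subgroup L) = P.subgroupOf L := rfl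

lemma IsSyl.map_toSylow [Fact p.Prime] (h : IsSyl p P L) :
    (h.toSylow : Subgroup L).map L.subtype = P := by
  rw [h.coe_toSylow, Subgroup.subgroupOf_map_subtype, inf_eq_left.2 h.1]

lemma Sylow.isSyl_map [Finite G] [Fact p.Prime] (S : Sylow p L) :
    IsSyl p ((S : Subgroup L).map L.subtype) L := by
  refine ⟨Subgroup.map_subtype_le _, S.isPGroup'.map _, ?_⟩
  have : ((S : Subgroup L).map L.subtype).relIndex L = (S : Subgroup L).index := by
    rw [Subgroup.relIndex, Subgroup.subgroupOf,
      Subgroup.comap_map_eq_self_of_injective L.subtype_injective]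
  rw [this]
  exact S.not_dvd_index

lemma exists_isSyl_ge [Finite G] [Fact p.Prime] (hR : IsPGroup p R) (hRL : R ≤ L) :
    ∃ P, R ≤ P ∧ IsSyl p P L := by
  have : IsPGroup p (R.subgroupOf L) := hR.of_equiv (Subgroup.subgroupOfEquivOfLe hRL).symm
  obtain ⟨S, hS⟩ := this.exists_le_sylow
  refine ⟨_, ?_, S.isSyl_map⟩
  have := Subgroup.map_mono (f := L.subtype) hS
  rwa [Subgroup.subgroupOf_map_subtype, inf_eq_left.2 hRL] at this

lemma exists_isSyl [Finite G] (p : ℕ) [Fact p.Prime] (L : Subgroup G) : ∃ P, IsSyl p P L := by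
  obtain ⟨P, -, h⟩ := exists_isSyl_ge (p := p) (R := ⊥) (L := L) IsPGroup.of_bot bot_le
  exact ⟨P, h⟩

lemma IsSyl.card [Finite G] [Fact p.Prime] {k : ℕ} (h : IsSyl p P L) (h1 : p ^ k ∣ Nat.card L)
    (h2 : ¬ p ^ (k + 1) ∣ Nat.card L) : Nat.card P = p ^ k := by
  obtain ⟨n, hn⟩ := IsPGroup.iff_card.1 h.isPGroup
  have hc := relIndex_mul_card_of_le P L h.le
  rw [hn] at hc ⊢
  have hcop : Nat.Coprime (p ^ k) (P.relIndex L) :=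
    Nat.Coprime.pow_left _ ((Nat.Prime.coprime_iff_not_dvd Fact.out).2 h.2.2)
  have h3 : k ≤ n := by
    rw [← Nat.pow_dvd_pow_iff_le_right (Fact.out : p.Prime).one_lt]
    exact hcop.dvd_of_dvd_mul_left (by rwa [hc])
  have h4 : n ≤ k := by
    by_contra! hlt
    exact h2 ((pow_dvd_pow p hlt).trans ⟨P.relIndex L, by rw [← hc, mul_comm]⟩)
  rw [le_antisymm h3 h4]

lemma mem_conj_iff {g x : G} {H : Subgroup G} :
    x ∈ MulAut.conj g • H ↔ g⁻¹ * x * g ∈ H := by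
  rw [Subgroup.mem_pointwise_smul_iff_inv_smul_mem]
  simp [MulAut.smul_def, ← map_inv]

lemma card_conj (g : G) (H : Subgroup G) : Nat.card ↥(MulAut.conj g • H) = Nat.card H :=
  Nat.card_congr (Subgroup.equivSMul (MulAut.conj g) H).toEquiv.symm

lemma conj_eq_iff {g : G} {H : Subgroup G} :
    MulAut.conj g • H = H ↔ g ∈ Subgroup.normalizer (H : Set G) := by
  rw [Subgroup.mem_normalizer_iff'']
  constructor
  · intro h x
    nth_rewrite 1 [← h]
    rw [mem_conj_iff]
  · intro h
    ext x
    rw [mem_conj_iff]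
    exact (h x).symm

lemma conj_normalizer (g : G) (H : Subgroup G) :
    MulAut.conj g • Subgroup.normalizer (H : Set G) =
      Subgroup.normalizer ((MulAut.conj g • H : Subgroup G) : Set G) := by
  ext x
  rw [mem_conj_iff, ← conj_eq_iff, ← conj_eq_iff]
  simp only [map_mul, mul_smul, map_inv]
  rw [inv_smul_eq_iff]

lemma IsSyl.conj [Finite G] [Fact p.Prime] (h : IsSyl p P L) {g : G}
    (hg : g ∈ Subgroup.normalizer (L : Set G)) : IsSyl p (MulAut.conj g • P) L := by
  have h1 : MulAut.conj g • P ≤ L := by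
    rw [← conj_eq_iff.2 hg]
    exact Subgroup.pointwise_smul_le_pointwise_smul_iff.2 h.le
  refine ⟨h1, h.isPGroup.of_equiv (Subgroup.equivSMul (MulAut.conj g) P), ?_⟩
  have := relIndex_mul_card_of_le _ _ h1
  rw [card_conj, ← relIndex_mul_card_of_le _ _ h.le] at this
  rw [Nat.eq_of_mul_eq_mul_right Nat.card_pos this]
  exact h.2.2

lemma IsSyl.exists_conj [Finite G] [Fact p.Prime] (h : IsSyl p P L) (h' : IsSyl p Q L) :
    ∃ g ∈ L, MulAut.conj g • P = Q := by
  obtain ⟨g, hg⟩ := MulAction.exists_smul_eq L h.toSylow h'.toSylow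
  refine ⟨g, g.2, ?_⟩
  have h1 := congrArg (fun S : Sylow p L => (S : Subgroup L).map L.subtype) hg
  simp only [h'.map_toSylow] at h1
  rw [← h1]
  ext x
  rw [mem_conj_iff, Sylow.coe_subgroup_smul]
  simp only [Subgroup.mem_map, mem_conj_iff, h.coe_toSylow, Subgroup.mem_subgroupOf]
  constructor
  · intro hx
    have hxL : x ∈ L := by
      have := L.mul_mem (L.mul_mem g.2 (h.le hx)) (L.inv_mem g.2)
      simpa [mul_assoc] using this
    exact ⟨⟨x, hxL⟩, by simpa using hx, rfl⟩
  · rintro ⟨y, hy, rfl⟩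
    simpa using hy

lemma IsSyl.card_sylow [Finite G] [Fact p.Prime] (h : IsSyl p P L) :
    (Subgroup.normalizer (P : Set G)).relIndex L = Nat.card (Sylow p L) := by
  rw [h.toSylow.card_eq_index_normalizer, Subgroup.relIndex,
    Subgroup.subgroupOf_normalizer_eq h.le]
  rfl

lemma IsSyl.relIndex_mod [Finite G] [Fact p.Prime] (h : IsSyl p P L) :
    (Subgroup.normalizer (P : Set G)).relIndex L % p = 1 := by
  rw [h.card_sylow, card_sylow_modEq_one p L]
  exact Nat.mod_eq_of_lt (Fact.out : p.Prime).one_lt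

lemma relIndex_mul_card_inf [Finite G] (N L : Subgroup G) :
    N.relIndex L * Nat.card ↥(N ⊓ L) = Nat.card L := by
  rw [← Subgroup.inf_relIndex_right, relIndex_mul_card_of_le _ _ inf_le_right]

lemma IsSyl.le_normalizer_inf (h : IsSyl p P L) :
    P ≤ Subgroup.normalizer (P : Set G) ⊓ L := le_inf Subgroup.le_normalizer h.le

/-- If a Sylow subgroup of `L` is normalized by `L`, it contains every `p`-subgroup of `L`. -/
lemma IsSyl.ge_of_le_normalizer [Finite G] [Fact p.Prime] (h : IsSyl p P L)
    (hn : L ≤ Subgroup.normalizer (P : Set G)) (hR : IsPGroup p R) (hRL : R ≤ L) : R ≤ P := by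
  obtain ⟨S, hRS, hS⟩ := exists_isSyl_ge hR hRL
  obtain ⟨g, hg, rfl⟩ := h.exists_conj hS
  rwa [conj_eq_iff.2 (hn hg)] at hRS

lemma IsSyl.normalizer_le [Finite G] [Fact p.Prime] (h : IsSyl p P L)
    (hn : L ≤ Subgroup.normalizer (P : Set G)) :
    Subgroup.normalizer (L : Set G) ≤ Subgroup.normalizer (P : Set G) := by
  intro g hg
  have h2 := h.conj hg
  obtain ⟨x, hx, hx'⟩ := h.exists_conj h2
  rw [← conj_eq_iff, ← hx', conj_eq_iff]
  exact hn hx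

lemma IsSyl.mono [Finite G] {L' : Subgroup G} (h : IsSyl p P L) (h1 : P ≤ L')
    (h2 : L' ≤ L) : IsSyl p P L' :=
  ⟨h1, h.isPGroup, fun hd => h.2.2 (hd.trans (by
    rw [← Subgroup.relIndex_mul_relIndex P L' L h1 h2]; exact dvd_mul_right _ _))⟩

end SylowIn

section Counting
variable {G : Type*} [Group G] {p : ℕ} {P Q R L X : Subgroup G}

lemma card_inf_centralizer_mod [Finite G] [Fact p.Prime] (hR : IsPGroup p R)
    (h : R ≤ Subgroup.normalizer (X : Set G)) :
    Nat.card ↥(X ⊓ Subgroup.centralizer (R : Set G)) ≡ Nat.card X [MOD p] := by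
  let : MulAction R X :=
    MulAction.compHom X ((Subgroup.normalizerMonoidHom X).comp (Subgroup.inclusion h))
  have hs : ∀ (r : R) (x : X), ((r • x : X) : G) = r * x * (r : G)⁻¹ := fun r x => rfl
  have := hR.card_modEq_card_fixedPoints X
  refine Nat.ModEq.trans (Nat.ModEq.symm ?_) this.symm
  have e : MulAction.fixedPoints R X ≃ ↥(X ⊓ Subgroup.centralizer (R : Set G)) :=
    { toFun := fun x => ⟨x.1.1, x.1.2, Subgroup.mem_centralizer_iff.2 fun r hr => by
        have := congrArg (fun y : X => (y : G)) (x.2 ⟨r, hr⟩)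
        simp only [hs] at this
        rw [mul_inv_eq_iff_eq_mul] at this
        exact this⟩
      invFun := fun x => ⟨⟨x.1, x.2.1⟩, fun r => by
        apply Subtype.ext
        rw [hs, mul_inv_eq_iff_eq_mul]
        exact Subgroup.mem_centralizer_iff.1 x.2.2 r r.2⟩
      left_inv := fun x => rfl
      right_inv := fun x => rfl }
  rw [Nat.card_congr e]

lemma dvd_card_of_dvd_orbit {H α : Type*} [Group H] [MulAction H α] [Finite α] {d : ℕ}
    (h : ∀ a : α, d ∣ Nat.card (MulAction.orbit H a)) : d ∣ Nat.card α := by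
  classical
  have := Fintype.ofFinite α
  have := Fintype.ofFinite (MulAction.orbitRel.Quotient H α)
  rw [Nat.card_congr (MulAction.selfEquivSigmaOrbits H α), Nat.card_sigma]
  exact Finset.dvd_sum fun a _ => h _

end Counting

section Graph
variable {G : Type*} [Group G]

/-- The set of neighbours of `p` in the prime graph. -/
def gkNbr (G : Type*) [Group G] (p : ℕ) : Set ℕ :=
  {q | p ≠ q ∧ p.Prime ∧ q.Prime ∧ ∃ g : G, orderOf g = p * q}

lemma ncard_gkNbr (p : ℕ) : (gkNbr G p).ncard = gkDegree G p := by
  rw [← Nat.card_coe_set_eq]; rfl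

lemma gkNbr_symm {p q : ℕ} (h : q ∈ gkNbr G p) : p ∈ gkNbr G q :=
  ⟨h.1.symm, h.2.2.1, h.2.1, by obtain ⟨g, hg⟩ := h.2.2.2; exact ⟨g, by rw [hg, mul_comm]⟩⟩

lemma exists_orderOf_mul {x y : G} {p q : ℕ} (hp : p.Prime) (hq : q.Prime) (hpq : p ≠ q)
    (hx : orderOf x = p) (hy : orderOf y = q) (hc : Commute x y) :
    orderOf (x * y) = p * q := by
  rw [hc.orderOf_mul_eq_mul_orderOf_of_coprime, hx, hy]
  rw [hx, hy]; exact (Nat.coprime_primes hp hq).2 hpq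

lemma relIndex_centralizer_dvd [Finite G] {p : ℕ} (hp : p.Prime) {P : Subgroup G}
    (hPc : Nat.card P = p) :
    (Subgroup.centralizer (P : Set G)).relIndex (Subgroup.normalizer (P : Set G)) ∣ p - 1 := by
  have := Fact.mk hp
  have hcyc : IsCyclic P := isCyclic_of_prime_card hPc
  have h1 := Subgroup.normalizerMonoidHom_ker P
  have h2 : (Subgroup.centralizer (P : Set G)).relIndex (Subgroup.normalizer (P : Set G)) =
      Nat.card (Subgroup.normalizerMonoidHom P).range := by
    rw [← Subgroup.index_ker, h1]; rfl
  rw [h2, ← Nat.totient_prime hp, ← hPc, ← IsCyclic.card_mulAut]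
  exact Subgroup.card_subgroup_dvd_card _

lemma exists_dvd_centralizer [Finite G] {p r : ℕ} (hp : p.Prime)
    (hpc : p ∣ Nat.card G) (hpc2 : ¬ p ^ 2 ∣ Nat.card G) (hr : gkNbr G p = {r}) :
    ∃ a e, e ∣ p - 1 ∧ p * r ^ a * e ∣ Nat.card G ∧ Nat.card G / p ≡ r ^ a * e [MOD p] := by
  have := Fact.mk hp
  obtain ⟨P, hP⟩ := exists_isSyl p (⊤ : Subgroup G)
  have hPc : Nat.card P = p := by
    simpa using hP.card (k := 1) (by simpa using hpc) (by simpa using hpc2)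
  set C := Subgroup.centralizer (P : Set G)
  set N := Subgroup.normalizer (P : Set G)
  have hcyc : IsCyclic P := isCyclic_of_prime_card hPc
  have hPC : P ≤ C := by
    have := hcyc.isMulCommutative
    exact Subgroup.le_centralizer P
  have hCN : C ≤ N := Subgroup.centralizer_le_normalizer _
  obtain ⟨x, hx⟩ := hcyc.exists_generator
  have hox : orderOf (x : G) = p := by
    rw [Subgroup.orderOf_coe, orderOf_eq_card_of_forall_mem_zpowers hx, hPc]
  obtain ⟨m, hm⟩ : p ∣ Nat.card C := hPc ▸ Subgroup.card_dvd_of_le hPC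
  have hm0 : m ≠ 0 := by rintro rfl; exact Nat.card_pos.ne' hm
  have hmr : ∀ {d : ℕ}, d.Prime → d ∣ m → d = r := by
    intro d hd hdm
    by_cases hdp : d = p
    · exfalso
      apply hpc2
      rw [pow_two]
      exact ((mul_dvd_mul_left p (hdp ▸ hdm)).trans (hm ▸ dvd_rfl)).trans
        (Subgroup.card_subgroup_dvd_card C)
    · have := Fact.mk hd
      obtain ⟨y, hy⟩ := exists_prime_orderOf_dvd_card' (G := C) d (hm ▸ hdm.mul_left p)
      have hd : d ∈ gkNbr G p := ⟨fun h => hdp h.symm, hp, hd, x * y,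
        exists_orderOf_mul hp hd (fun h => hdp h.symm) hox (by simpa using hy)
          (Subgroup.mem_centralizer_iff.1 y.2 x x.2)⟩
      rwa [hr] at hd
  have hma := Nat.eq_prime_pow_of_unique_prime_dvd hm0 hmr
  set a := m.primeFactorsList.length
  have he : C.relIndex N ∣ p - 1 := relIndex_centralizer_dvd hp hPc
  refine ⟨a, C.relIndex N, he, ?_, ?_⟩
  · rw [← hma, ← hm, mul_comm, relIndex_mul_card_of_le _ _ hCN]
    exact Subgroup.card_subgroup_dvd_card _
  · have h1 := relIndex_mul_card_of_le N ⊤ le_top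
    rw [← relIndex_mul_card_of_le _ _ hCN, hm, hma] at h1
    have h2 : Nat.card G = p * (N.relIndex ⊤ * (r ^ a * C.relIndex N)) := by
      rw [← Subgroup.card_top, ← h1]; ring
    rw [h2, Nat.mul_div_cancel_left _ hp.pos]
    have h3 : N.relIndex ⊤ ≡ 1 [MOD p] := by
      rw [Nat.ModEq, hP.relIndex_mod, Nat.mod_eq_of_lt hp.one_lt]
    simpa using h3.mul_right (r ^ a * C.relIndex N)

/-- The arithmetic information on a group used in the local analysis. -/
structure Arith (G : Type*) [Group G] : Prop where
  card : Nat.card G = 2^4 * 3^2 * 19^2 * 31 * 37^3 * 43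
  not31 : ∀ r ∈ ({2, 3, 19, 37} : Set ℕ), ∀ g : G, orderOf g ≠ 31 * r
  not43 : ∀ r ∈ ({2, 3, 19, 37} : Set ℕ), ∀ g : G, orderOf g ≠ 43 * r
  not111 : ∀ g : G, orderOf g ≠ 37 * 3
  exists703 : ∃ g : G, orderOf g = 19 * 37

lemma gkNbr_subset [Finite G] (hG : Nat.card G = 2^4 * 3^2 * 19^2 * 31 * 37^3 * 43) (p : ℕ) :
    gkNbr G p ⊆ {2, 3, 19, 31, 37, 43} := by
  rintro q ⟨-, -, hq, g, hg⟩
  have h : q ∣ 2^4 * 3^2 * 19^2 * 31 * 37^3 * 43 := by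
    rw [← hG]; exact ((Dvd.intro_left p rfl).trans hg.symm.dvd).trans (orderOf_dvd_natCard g)
  simp only [hq.dvd_mul] at h
  have h2 : ∀ {s k : ℕ}, s.Prime → q ∣ s ^ k → q = s := fun hs h =>
    (Nat.prime_dvd_prime_iff_eq hq hs).1 (hq.dvd_of_dvd_pow h)
  rcases h with ((((h | h) | h) | h) | h) | h
  · simp [h2 (by norm_num) h]
  · simp [h2 (by norm_num) h]
  · simp [h2 (by norm_num) h]
  · simp [(Nat.prime_dvd_prime_iff_eq hq (by norm_num)).1 h]
  · simp [h2 (by norm_num) h]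
  · simp [(Nat.prime_dvd_prime_iff_eq hq (by norm_num)).1 h]

lemma nbr_aux {n p r a e c : ℕ} (hp : p.Prime) (hr : r ∈ ({2, 3, 19, 31, 37, 43} : Set ℕ))
    (hrp : r ≠ p)
    (he : e ∣ p - 1) (hd : p * r ^ a * e ∣ n) (hn : n = p * c)
    (h : n / p ≡ r ^ a * e [MOD p]) (ha : ∀ r ∈ ({2, 3, 19, 31, 37, 43} : Set ℕ), ¬ r ^ 5 ∣ c)
    (he6 : ∀ e, e ∣ p - 1 → e ∣ c → e ∣ 6)
    (hfin : ∀ r ∈ ({2, 3, 19, 31, 37, 43} : Finset ℕ), ∀ a < 5, ∀ e ∈ ({1, 2, 3, 6} : Finset ℕ),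
      r ≠ p → (c % p) = (r ^ a * e) % p → r ^ a ∣ c → r = 37 ∨ r = 74 - p) :
    r = 37 ∨ r = 74 - p := by
  rw [hn, mul_assoc] at hd
  have hd2 : r ^ a * e ∣ c := Nat.dvd_of_mul_dvd_mul_left hp.pos hd
  rw [hn, Nat.mul_div_cancel_left _ hp.pos] at h
  have ha5 : a < 5 := by
    by_contra! hlt
    exact ha r hr ((pow_dvd_pow r hlt).trans ((dvd_mul_right _ _).trans hd2))
  refine hfin r (by simpa using hr) a ha5 e ?_ hrp h ((dvd_mul_right _ _).trans hd2)
  have := he6 e he ((dvd_mul_left _ _).trans hd2)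
  have : e ∈ Nat.divisors 6 := by simpa using this
  simpa [show Nat.divisors 6 = {1, 2, 3, 6} by decide] using this

lemma arith_of_gkDegree [Finite G]
    (hG : Nat.card G = 2^4 * 3^2 * 19^2 * 31 * 37^3 * 43)
    (h2 : gkDegree G 2 = 3) (h19 : gkDegree G 19 = 3) (h31 : gkDegree G 31 = 1)
    (h37 : gkDegree G 37 = 2) (h43 : gkDegree G 43 = 1) : Arith G := by
  have hsub := gkNbr_subset hG
  have hfin : ∀ p, (gkNbr G p).Finite := fun p => (Set.toFinite _).subset (hsub p)
  rw [← ncard_gkNbr] at h2 h19 h31 h37 h43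
  obtain ⟨r, hr⟩ := Set.ncard_eq_one.1 h31
  obtain ⟨s, hs⟩ := Set.ncard_eq_one.1 h43
  have hrm : r ∈ gkNbr G 31 := by simp [hr]
  have hsm : s ∈ gkNbr G 43 := by simp [hs]
  have hr' : r = 37 ∨ r = 43 := by
    obtain ⟨a, e, h1, h2, h3⟩ := exists_dvd_centralizer (G := G) (p := 31) (by norm_num)
      (by rw [hG]; norm_num) (by rw [hG]; norm_num) hr
    rw [hG] at h2 h3
    refine nbr_aux (n := _) (p := 31) (c := 2^4 * 3^2 * 19^2 * 37^3 * 43) (by norm_num)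
      (hsub _ hrm) hrm.1.symm h1 h2 (by norm_num) h3 ?_ ?_ ?_
    · norm_num
    · intro e he hc
      have := Nat.dvd_gcd he hc
      norm_num at this
      exact this
    · decide
  have hs' : s = 37 ∨ s = 31 := by
    obtain ⟨a, e, h1, h2, h3⟩ := exists_dvd_centralizer (G := G) (p := 43) (by norm_num)
      (by rw [hG]; norm_num) (by rw [hG]; norm_num) hs
    rw [hG] at h2 h3
    refine nbr_aux (n := _) (p := 43) (c := 2^4 * 3^2 * 19^2 * 37^3 * 31) (by norm_num)
      (hsub _ hsm) hsm.1.symm h1 h2 (by norm_num) h3 ?_ ?_ ?_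
    · norm_num
    · intro e he hc
      have := Nat.dvd_gcd he hc
      norm_num at this
      exact this
    · decide
  have hr43 : r = 43 := by
    rcases hr' with rfl | rfl
    · exfalso
      have hs37 : s = 37 := by
        rcases hs' with rfl | rfl
        · rfl
        · have := gkNbr_symm hsm
          rw [hr] at this
          simp at this
      subst hs37
      have h31' := gkNbr_symm hrm
      have h43' := gkNbr_symm hsm
      have h37' : ({31, 43} : Set ℕ) = gkNbr G 37 := by
        refine Set.eq_of_subset_of_ncard_le ?_ ?_ (hfin _)
        · rintro x (rfl | rfl) <;> assumption
        · rw [h37, Set.ncard_pair (by norm_num)]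
      have : gkNbr G 2 ⊆ {3, 19} := by
        intro x hx
        have hx1 := gkNbr_symm hx
        have := hsub _ hx
        rcases this with rfl | rfl | rfl | rfl | rfl | rfl
        · exact absurd rfl hx.1
        · simp
        · simp
        · rw [hr] at hx1; simp at hx1
        · rw [← h37'] at hx1; simp at hx1
        · rw [hs] at hx1; simp at hx1
      have := Set.ncard_le_ncard this
      rw [h2, Set.ncard_pair (by norm_num)] at this
      omega
    · rfl
  subst hr43
  have hs31 : s = 31 := by
    have := gkNbr_symm hrm
    rw [hs] at this
    exact this.symm
  subst hs31
  have n31 : ∀ p, p ≠ 43 → 31 ∉ gkNbr G p := by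
    intro p hp h
    have := gkNbr_symm h
    rw [hr] at this
    exact hp this
  have n43 : ∀ p, p ≠ 31 → 43 ∉ gkNbr G p := by
    intro p hp h
    have := gkNbr_symm h
    rw [hs] at this
    exact hp this
  have e2 : gkNbr G 2 = {3, 19, 37} := by
    refine Set.eq_of_subset_of_ncard_le ?_ ?_
    · intro x hx
      rcases hsub _ hx with rfl | rfl | rfl | rfl | rfl | rfl
      · exact absurd rfl hx.1
      · simp
      · simp
      · exact absurd hx (n31 _ (by norm_num))
      · simp
      · exact absurd hx (n43 _ (by norm_num))
    · rw [h2]; exact (Set.ncard_insert_le _ _).trans (by rw [Set.ncard_pair (by norm_num)])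
  have e19 : gkNbr G 19 = {2, 3, 37} := by
    refine Set.eq_of_subset_of_ncard_le ?_ ?_
    · intro x hx
      rcases hsub _ hx with rfl | rfl | rfl | rfl | rfl | rfl
      · simp
      · simp
      · exact absurd rfl hx.1
      · exact absurd hx (n31 _ (by norm_num))
      · simp
      · exact absurd hx (n43 _ (by norm_num))
    · rw [h19]; exact (Set.ncard_insert_le _ _).trans (by rw [Set.ncard_pair (by norm_num)])
  have e37 : ({2, 19} : Set ℕ) = gkNbr G 37 := by
    refine Set.eq_of_subset_of_ncard_le ?_ ?_ (hfin _)
    · rintro x (rfl | rfl)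
      · exact gkNbr_symm (by simp [e2])
      · exact gkNbr_symm (by simp [e19])
    · rw [h37, Set.ncard_pair (by norm_num)]
  refine ⟨hG, ?_, ?_, ?_, ?_⟩
  · intro p hp g hg
    have : p ∈ gkNbr G 31 := by
      rcases hp with rfl | rfl | rfl | rfl <;> exact ⟨by norm_num, by norm_num, by norm_num, g, hg⟩
    rw [hr] at this
    rcases hp with rfl | rfl | rfl | rfl <;> simp at this
  · intro p hp g hg
    have : p ∈ gkNbr G 43 := by
      rcases hp with rfl | rfl | rfl | rfl <;> exact ⟨by norm_num, by norm_num, by norm_num, g, hg⟩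
    rw [hs] at this
    rcases hp with rfl | rfl | rfl | rfl <;> simp at this
  · intro g hg
    have : 3 ∈ gkNbr G 37 := ⟨by norm_num, by norm_num, by norm_num, g, hg⟩
    rw [← e37] at this
    simp at this
  · have : 37 ∈ gkNbr G 19 := by simp [e19]
    exact this.2.2.2

end Graph

section Local
variable {G : Type*} [Group G]

instance fact_prime_nineteen : Fact (Nat.Prime 19) := ⟨by norm_num⟩
instance fact_prime_thirtySeven : Fact (Nat.Prime 37) := ⟨by norm_num⟩

lemma isPGroup_of_card {p n : ℕ} {P : Subgroup G} (h : Nat.card P = p ^ n) : IsPGroup p P :=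
  IsPGroup.of_card h

lemma le_of_card_inf [Finite G] {H K : Subgroup G} (h : Nat.card ↥(H ⊓ K) = Nat.card H) :
    H ≤ K := by
  rw [← inf_eq_left]
  exact Subgroup.eq_of_le_of_card_ge inf_le_left h.ge

lemma le_centralizer_comm {H K : Subgroup G} (h : H ≤ Subgroup.centralizer (K : Set G)) :
    K ≤ Subgroup.centralizer (H : Set G) := Subgroup.le_centralizer_iff.1 h

lemma normalizer_le_normalizer_centralizer (H : Subgroup G) :
    Subgroup.normalizer (H : Set G) ≤
      Subgroup.normalizer (Subgroup.centralizer (H : Set G) : Set G) := by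
  intro g hg
  rw [← conj_eq_iff] at hg ⊢
  ext x
  rw [mem_conj_iff, Subgroup.mem_centralizer_iff, Subgroup.mem_centralizer_iff]
  constructor
  · intro h y hy
    have hy' : y ∈ MulAut.conj g • H := hg.symm ▸ hy
    have := h _ (mem_conj_iff.1 hy')
    have h2 := congrArg (fun z => g * z * g⁻¹) this
    simpa [mul_assoc] using h2
  · intro h y hy
    have hy' : g * y * g⁻¹ ∈ H := by
      rw [SetLike.mem_coe, ← hg, mem_conj_iff] at hy
      rw [← hg, mem_conj_iff]
      have : g⁻¹ * (g * y * g⁻¹) * g = y := by group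
      rw [this, ← hg, mem_conj_iff]; exact hy
    have := h _ hy'
    have h2 := congrArg (fun z => g⁻¹ * z * g) this
    simpa [mul_assoc] using h2

lemma exists_order_mul_of_dvd [Finite G] {A B : Subgroup G} {p q : ℕ} (hp : p.Prime)
    (hq : q.Prime) (hpq : p ≠ q) (hA : p ∣ Nat.card A) (hB : q ∣ Nat.card B)
    (h : B ≤ Subgroup.centralizer (A : Set G)) : ∃ g : G, orderOf g = p * q := by
  have := Fact.mk hp
  have := Fact.mk hq
  obtain ⟨x, hx⟩ := exists_prime_orderOf_dvd_card' (G := A) p hA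
  obtain ⟨y, hy⟩ := exists_prime_orderOf_dvd_card' (G := B) q hB
  exact ⟨x * y, exists_orderOf_mul hp hq hpq (by simpa using hx) (by simpa using hy)
    (Subgroup.mem_centralizer_iff.1 (h y.2) x x.2)⟩

lemma card_eq_pow_of_le [Finite G] {p n : ℕ} (hp : p.Prime) {H P : Subgroup G}
    (hP : Nat.card P = p ^ n) (h : H ≤ P) : ∃ k ≤ n, Nat.card H = p ^ k :=
  (Nat.dvd_prime_pow hp).1 (hP ▸ Subgroup.card_dvd_of_le h)

lemma dvd_card_of_ne_bot [Finite G] {p : ℕ} [Fact p.Prime] {X : Subgroup G} (hX : IsPGroup p X)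
    (h1 : X ≠ ⊥) : p ∣ Nat.card X := by
  obtain ⟨n, hn⟩ := IsPGroup.iff_card.1 hX
  rcases n with _ | n
  · exact absurd (Subgroup.card_eq_one.1 (by simpa using hn)) h1
  · rw [hn, pow_succ]; exact dvd_mul_left _ _

lemma exists_isPGroup_of_dvd [Finite G] {p : ℕ} [hp : Fact p.Prime] {L : Subgroup G}
    (h : p ∣ Nat.card L) : ∃ Y ≤ L, Nat.card Y = p := by
  obtain ⟨x, hx⟩ := exists_prime_orderOf_dvd_card' (G := L) p h
  refine ⟨Subgroup.zpowers (x : G), by simp, ?_⟩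
  rw [Nat.card_zpowers]; simpa using hx

/-- The part of the group order prime to `31 * 43`. -/
abbrev N1 : ℕ := 2^4 * 3^2 * 19^2 * 37^3

lemma Arith.not_dvd_normalizer [Finite G] (hA : Arith G) {r : ℕ} (hr : r ∈ ({2, 3, 19, 37} : Set ℕ))
    {X : Subgroup G} (hX : IsPGroup r X) (h1 : X ≠ ⊥) {p : ℕ} (hp : p = 31 ∨ p = 43) :
    ¬ p ∣ Nat.card ↥(Subgroup.normalizer (X : Set G)) := by
  intro hd
  have hpp : p.Prime := by rcases hp with rfl | rfl <;> norm_num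
  have hrp : r.Prime := by rcases hr with rfl | rfl | rfl | rfl <;> norm_num
  have hne : p ≠ r := by
    rcases hp with rfl | rfl <;> rcases hr with rfl | rfl | rfl | rfl <;> norm_num
  have := Fact.mk hpp
  have := Fact.mk hrp
  obtain ⟨R, hRN, hR⟩ := exists_isPGroup_of_dvd hd
  have hRp : IsPGroup p R := isPGroup_of_card (n := 1) (by simpa using hR)
  have hmod := card_inf_centralizer_mod hRp hRN
  obtain ⟨b, hb⟩ := IsPGroup.iff_card.1 hX
  have hb0 : 1 ≤ b := by
    by_contra! h
    obtain rfl : b = 0 := by omega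
    exact h1 (Subgroup.card_eq_one.1 (by simpa using hb))
  have hdv : r ^ b ∣ 2^4 * 3^2 * 19^2 * 31 * 37^3 * 43 := by
    rw [← hA.card, ← hb]; exact Subgroup.card_subgroup_dvd_card X
  have hb5 : b < 5 := by
    by_contra! h
    have h5 := (pow_dvd_pow r h).trans hdv
    rcases hr with rfl | rfl | rfl | rfl <;> norm_num at h5
  have hne1 : X ⊓ Subgroup.centralizer (R : Set G) ≠ ⊥ := by
    intro h
    rw [h, hb, Subgroup.card_bot] at hmod
    have : ∀ p ∈ ({31, 43} : Finset ℕ), ∀ r ∈ ({2, 3, 19, 37} : Finset ℕ), ∀ b < 5, 1 ≤ b →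
      r ^ b ∣ 2^4 * 3^2 * 19^2 * 31 * 37^3 * 43 → ¬ 1 % p = r ^ b % p := by decide
    exact this p (by simpa using hp) r (by simpa using hr) b hb5 hb0 hdv hmod
  have hdr := dvd_card_of_ne_bot (hX.to_le inf_le_left) hne1
  obtain ⟨g, hg⟩ := exists_order_mul_of_dvd hpp hrp hne (A := R) hR.symm.dvd hdr inf_le_right
  rcases hp with rfl | rfl
  · exact hA.not31 r hr g hg
  · exact hA.not43 r hr g hg

lemma Arith.card_normalizer_dvd [Finite G] (hA : Arith G) {r : ℕ}
    (hr : r ∈ ({2, 3, 19, 37} : Set ℕ)) {X : Subgroup G} (hX : IsPGroup r X) (h1 : X ≠ ⊥) :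
    Nat.card ↥(Subgroup.normalizer (X : Set G)) ∣ N1 := by
  have h := Subgroup.card_subgroup_dvd_card (Subgroup.normalizer (X : Set G))
  rw [hA.card, show 2^4 * 3^2 * 19^2 * 31 * 37^3 * 43 = N1 * 31 * 43 by norm_num [N1]] at h
  have h43 := hA.not_dvd_normalizer hr hX h1 (p := 43) (by simp)
  have h31 := hA.not_dvd_normalizer hr hX h1 (p := 31) (by simp)
  have c43 := ((Nat.Prime.coprime_iff_not_dvd (by norm_num)).2 h43).symm
  have c31 := ((Nat.Prime.coprime_iff_not_dvd (by norm_num)).2 h31).symm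
  exact c31.dvd_of_dvd_mul_right (c43.dvd_of_dvd_mul_right h)

lemma exists_pow_of_dvd {p q r i j k n : ℕ} (hp : p.Prime) (hq : q.Prime) (hr : r.Prime)
    (h : n ∣ p ^ i * q ^ j * r ^ k) :
    ∃ a < i + 1, ∃ b < j + 1, ∃ c < k + 1, n = p ^ a * q ^ b * r ^ c := by
  obtain ⟨x, z, hx, hz, rfl⟩ := (Nat.dvd_mul).1 h
  obtain ⟨x, y, hx', hy, rfl⟩ := (Nat.dvd_mul).1 hx
  obtain ⟨a, ha, rfl⟩ := (Nat.dvd_prime_pow hp).1 hx'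
  obtain ⟨b, hb, rfl⟩ := (Nat.dvd_prime_pow hq).1 hy
  obtain ⟨c, hc, rfl⟩ := (Nat.dvd_prime_pow hr).1 hz
  exact ⟨a, by omega, b, by omega, c, by omega, rfl⟩

lemma IsSyl.numSyl37 [Finite G] {P L : Subgroup G} (h : IsSyl 37 P L) (hL : Nat.card L ∣ N1) :
    (Subgroup.normalizer (P : Set G)).relIndex L ∈ ({1, 38, 1444} : Finset ℕ) := by
  have hm := h.relIndex_mod
  have h1 : (Subgroup.normalizer (P : Set G)).relIndex L ∣ N1 :=
    (Subgroup.relIndex_dvd_card _ _).trans hL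
  have h2 : ¬ 37 ∣ (Subgroup.normalizer (P : Set G)).relIndex L := fun hd => by omega
  have h3 : (Subgroup.normalizer (P : Set G)).relIndex L ∣ 2^4 * 3^2 * 19^2 :=
    ((Nat.Prime.coprime_iff_not_dvd (by norm_num)).2 h2).symm.pow_right 3 |>.dvd_of_dvd_mul_right h1
  obtain ⟨a, ha, b, hb, c, hc, hn⟩ := exists_pow_of_dvd (by norm_num) (by norm_num) (by norm_num) h3
  rw [hn] at hm ⊢
  have : ∀ a < 5, ∀ b < 3, ∀ c < 3, 2 ^ a * 3 ^ b * 19 ^ c % 37 = 1 →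
    2 ^ a * 3 ^ b * 19 ^ c ∈ ({1, 38, 1444} : Finset ℕ) := by decide
  exact this a ha b hb c hc hm

lemma IsSyl.numSyl19 [Finite G] {P L : Subgroup G} (h : IsSyl 19 P L) (hL : Nat.card L ∣ N1) :
    (Subgroup.normalizer (P : Set G)).relIndex L ∈ ({1, 1369, 37 * 18, 37^3 * 18} : Finset ℕ) := by
  have hm := h.relIndex_mod
  have h1 : (Subgroup.normalizer (P : Set G)).relIndex L ∣ 2^4 * 3^2 * 37^3 * 19^2 :=
    ((Subgroup.relIndex_dvd_card _ _).trans hL).trans (by norm_num [N1])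
  have h2 : ¬ 19 ∣ (Subgroup.normalizer (P : Set G)).relIndex L := fun hd => by omega
  have h3 : (Subgroup.normalizer (P : Set G)).relIndex L ∣ 2^4 * 3^2 * 37^3 :=
    ((Nat.Prime.coprime_iff_not_dvd (by norm_num)).2 h2).symm.pow_right 2 |>.dvd_of_dvd_mul_right h1
  obtain ⟨a, ha, b, hb, c, hc, hn⟩ := exists_pow_of_dvd (by norm_num) (by norm_num) (by norm_num) h3
  rw [hn] at hm ⊢
  have : ∀ a < 5, ∀ b < 3, ∀ c < 4, 2 ^ a * 3 ^ b * 37 ^ c % 19 = 1 →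
    2 ^ a * 3 ^ b * 37 ^ c ∈ ({1, 1369, 37 * 18, 37^3 * 18} : Finset ℕ) := by decide
  exact this a ha b hb c hc hm

lemma pow_succ_dvd_card_normalizer [Finite G] {p n : ℕ} [Fact p.Prime] {R : Subgroup G}
    (h : p ^ (n + 1) ∣ Nat.card G) (hR : Nat.card R = p ^ n) :
    p ^ (n + 1) ∣ Nat.card ↥(Subgroup.normalizer (R : Set G)) := by
  have := Sylow.prime_dvd_card_quotient_normalizer h hR
  change p ∣ R.relIndex _ at this
  rw [← relIndex_mul_card_of_le R _ Subgroup.le_normalizer, hR, pow_succ, mul_comm]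
  exact mul_dvd_mul_right this _

lemma le_normalizer_of_card [Finite G] {p n : ℕ} [hp : Fact p.Prime] {R Q : Subgroup G}
    (hRQ : R ≤ Q)
    (hR : Nat.card R = p ^ n) (hQ : Nat.card Q = p ^ (n + 1)) :
    Q ≤ Subgroup.normalizer (R : Set G) := by
  have h1 : Nat.card (R.subgroupOf Q) = p ^ n := by
    rw [← hR]; exact Nat.card_congr (Subgroup.subgroupOfEquivOfLe hRQ).toEquiv
  have h2 := pow_succ_dvd_card_normalizer (G := Q) (R := R.subgroupOf Q) (n := n) hQ.symm.dvd h1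
  rw [← Subgroup.normal_subgroupOf_iff_le_normalizer hRQ, ← Subgroup.normalizer_eq_top_iff,
    ← Subgroup.card_eq_iff_eq_top]
  exact Nat.dvd_antisymm (Subgroup.card_subgroup_dvd_card _) (hQ ▸ h2)

/-- A subgroup of order a prime squared is contained in its centralizer. -/
lemma le_centralizer_of_card_sq {p : ℕ} [hp : Fact p.Prime] {R : Subgroup G}
    (hR : Nat.card R = p ^ 2) : R ≤ Subgroup.centralizer (R : Set G) := by
  have := IsPGroup.isMulCommutative_of_card_eq_prime_sq hR
  exact Subgroup.le_centralizer R

lemma le_centralizer_of_card {p : ℕ} [hp : Fact p.Prime] {R : Subgroup G}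
    (hR : Nat.card R = p) : R ≤ Subgroup.centralizer (R : Set G) := by
  have := (isCyclic_of_prime_card hR).isMulCommutative
  exact Subgroup.le_centralizer R

lemma exists_card_sq_ge [Finite G] {p : ℕ} [hp : Fact p.Prime] {X Q : Subgroup G} (hXQ : X ≤ Q)
    (hX : Nat.card X = p) (hQ : Nat.card Q = p ^ 3) :
    ∃ R, X ≤ R ∧ R ≤ Q ∧ Nat.card R = p ^ 2 ∧ R ≤ Subgroup.centralizer (X : Set G) := by
  obtain ⟨R, hR, hXR⟩ := Sylow.exists_subgroup_card_pow_succ (G := Q) (p := p) (n := 1)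
    (H := X.subgroupOf Q) (by rw [hQ]; exact pow_dvd_pow p (by norm_num))
    (by rw [pow_one, ← hX]; exact Nat.card_congr (Subgroup.subgroupOfEquivOfLe hXQ).toEquiv)
  have h1 : X ≤ R.map Q.subtype := by
    have := Subgroup.map_mono (f := Q.subtype) hXR
    rwa [Subgroup.subgroupOf_map_subtype, inf_eq_left.2 hXQ] at this
  have h2 : Nat.card (R.map Q.subtype) = p ^ 2 := by
    rw [← Nat.card_congr (R.equivMapOfInjective _ Q.subtype_injective).toEquiv, hR]
  exact ⟨_, h1, Subgroup.map_subtype_le _, h2,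
    (le_centralizer_of_card_sq h2).trans (Subgroup.centralizer_le h1)⟩

lemma le_centralizer_of_card_mod [Finite G] {p q : ℕ} [Fact p.Prime] [hq : Fact q.Prime]
    {R Y : Subgroup G} (hR : IsPGroup p R) (hY : Nat.card Y = q)
    (h : R ≤ Subgroup.normalizer (Y : Set G))
    (hm : ¬ 1 ≡ q [MOD p]) : R ≤ Subgroup.centralizer (Y : Set G) := by
  have h1 := card_inf_centralizer_mod hR h
  apply le_centralizer_comm
  apply le_of_card_inf
  rw [hY] at h1 ⊢
  rcases (Nat.dvd_prime hq.out).1 (hY ▸ Subgroup.card_dvd_of_le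
    (inf_le_left : Y ⊓ Subgroup.centralizer (R : Set G) ≤ Y)) with h2 | h2
  · rw [h2] at h1; exact absurd h1 hm
  · exact h2

lemma isSyl_of_card [Finite G] {p n : ℕ} {P : Subgroup G} (hP : Nat.card P = p ^ n)
    {L : Subgroup G} (hPL : P ≤ L) (h : ¬ p ^ (n + 1) ∣ Nat.card L) : IsSyl p P L := by
  refine ⟨hPL, isPGroup_of_card hP, fun hd => h ?_⟩
  rw [← relIndex_mul_card_of_le _ _ hPL, hP, pow_succ, mul_comm]
  exact mul_dvd_mul_right hd _

lemma dvd_card_of_dvd_orbit_of_invariant {H α : Type*} [Group H] [MulAction H α] [Finite α] {d : ℕ}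
    (S : Set α) (hS : ∀ (h : H), ∀ a ∈ S, h • a ∈ S)
    (hd : ∀ a ∈ S, d ∣ Nat.card (MulAction.orbit H a)) : d ∣ S.ncard := by
  let T : SubMulAction H α := ⟨S, fun h a ha => hS h a ha⟩
  change d ∣ (T : Set α).ncard
  rw [← Nat.card_coe_set_eq]
  refine dvd_card_of_dvd_orbit (H := H) (α := T) fun a => ?_
  have := hd a a.2
  rwa [← SubMulAction.val_image_orbit a, Nat.card_image_of_injective Subtype.val_injective] at this

lemma card_orbit_mul_card_stabilizer {H α : Type*} [Group H] [Finite H] [MulAction H α] (a : α) :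
    Nat.card (MulAction.orbit H a) * Nat.card (MulAction.stabilizer H a) = Nat.card H := by
  rw [Nat.card_coe_set_eq, ← MulAction.index_stabilizer, Subgroup.index_mul_card]

end Local

local notation "C(" X ")" => Subgroup.centralizer (SetLike.coe X)
local notation "N(" X ")" => Subgroup.normalizer (SetLike.coe X)

section Local
variable {G : Type*} [Group G] [Finite G]

lemma Arith.not_three_dvd (hA : Arith G) {X : Subgroup G} (hX : IsPGroup 37 X) (h1 : X ≠ ⊥) :
    ¬ 3 ∣ Nat.card C(X) := by
  intro hd
  obtain ⟨g, hg⟩ := exists_order_mul_of_dvd (by norm_num) (by norm_num) (by norm_num)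
    (dvd_card_of_ne_bot hX h1) hd le_rfl
  exact hA.not111 g hg

lemma Arith.card_centralizer_dvd (hA : Arith G) {r : ℕ} (hr : r ∈ ({2, 3, 19, 37} : Set ℕ))
    {X : Subgroup G} (hX : IsPGroup r X) (h1 : X ≠ ⊥) : Nat.card C(X) ∣ N1 :=
  (Subgroup.card_dvd_of_le (Subgroup.centralizer_le_normalizer _)).trans
    (hA.card_normalizer_dvd hr hX h1)

omit [Finite G] in
lemma ne_bot_of_card {X : Subgroup G} {p n : ℕ} (hp : p.Prime) (hn : n ≠ 0)
    (h : Nat.card X = p ^ n) :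
    X ≠ ⊥ := by
  rintro rfl
  rw [Subgroup.card_bot] at h
  exact (Nat.one_lt_pow hn hp.one_lt).ne h

lemma Arith.isSyl37 (hA : Arith G) {Q : Subgroup G} (hQ : Nat.card Q = 37 ^ 3) : IsSyl 37 Q ⊤ :=
  isSyl_of_card hQ le_top (by rw [Subgroup.card_top, hA.card]; norm_num)

lemma Arith.isSyl19 (hA : Arith G) {P : Subgroup G} (hP : Nat.card P = 19 ^ 2) : IsSyl 19 P ⊤ :=
  isSyl_of_card hP le_top (by rw [Subgroup.card_top, hA.card]; norm_num)

lemma Arith.card37 (hA : Arith G) {Q : Subgroup G} (h : IsSyl 37 Q ⊤) : Nat.card Q = 37 ^ 3 :=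
  h.card (by rw [Subgroup.card_top, hA.card]; norm_num) (by rw [Subgroup.card_top, hA.card]; norm_num)

lemma Arith.card19 (hA : Arith G) {Q : Subgroup G} (h : IsSyl 19 Q ⊤) : Nat.card Q = 19 ^ 2 :=
  h.card (by rw [Subgroup.card_top, hA.card]; norm_num) (by rw [Subgroup.card_top, hA.card]; norm_num)

/-- The number of Sylow `19`-subgroups of a subgroup whose order is prime to `3`. -/
lemma IsSyl.numSyl19' {P L : Subgroup G} (h : IsSyl 19 P L) (hL : Nat.card L ∣ N1)
    (h3 : ¬ 3 ∣ Nat.card L) : N(P).relIndex L ∈ ({1, 1369} : Finset ℕ) := by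
  have := h.numSyl19 hL
  have hd : N(P).relIndex L ∣ Nat.card L := Subgroup.relIndex_dvd_card _ _
  simp only [Finset.mem_insert, Finset.mem_singleton] at this ⊢
  rcases this with h | h | h | h
  · exact Or.inl h
  · exact Or.inr h
  · exact absurd ((by rw [h]; norm_num : 3 ∣ N(P).relIndex L).trans hd) h3
  · exact absurd ((by rw [h]; norm_num : 3 ∣ N(P).relIndex L).trans hd) h3

lemma Arith.card_normalizer19 (hA : Arith G) {P : Subgroup G} (hP : IsSyl 19 P ⊤) :
    Nat.card N(P) = 361 * 24 := by
  have hPc := hA.card19 hP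
  have hPb : P ≠ ⊥ := ne_bot_of_card (by norm_num) (by norm_num) hPc
  have hN := hA.card_normalizer_dvd (by simp) hP.isPGroup hPb
  obtain ⟨k, hk⟩ : 361 ∣ Nat.card N(P) := by
    have := Subgroup.card_dvd_of_le (Subgroup.le_normalizer (H := P))
    rw [hPc] at this; exact this
  have hkd : k ∣ 2^4 * 3^2 * 37^3 := by
    rw [hk, show N1 = 361 * (2^4 * 3^2 * 37^3) by norm_num [N1]] at hN
    exact Nat.dvd_of_mul_dvd_mul_left (by norm_num) hN
  obtain ⟨a, ha, b, hb, c, hc, rfl⟩ :=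
    exists_pow_of_dvd (by norm_num) (by norm_num) (by norm_num) hkd
  have hidx := relIndex_mul_card_of_le N(P) ⊤ le_top
  rw [Subgroup.card_top, hA.card, hk] at hidx
  have hmod := hP.relIndex_mod
  have key : (a = 3 ∧ b = 1) ∧ (c = 0 ∨ c = 2) := by
    have h1 : N(P).relIndex ⊤ = 1333 * (2^(4-a) * 3^(2-b) * 37^(3-c)) := by
      have e : 2^4 * 3^2 * 19^2 * 31 * 37^3 * 43 =
          1333 * (2^(4-a) * 3^(2-b) * 37^(3-c)) * (361 * (2^a * 3^b * 37^c)) := by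
        have e1 : 2^(4-a) * 2^a = 2^4 := by rw [← pow_add]; congr 1; omega
        have e2 : 3^(2-b) * 3^b = 3^2 := by rw [← pow_add]; congr 1; omega
        have e3 : 37^(3-c) * 37^c = 37^3 := by rw [← pow_add]; congr 1; omega
        calc _ = 1333 * 361 * (2^4 * 3^2 * 37^3) := by norm_num
          _ = _ := by rw [← e1, ← e2, ← e3]; ring
      rw [e] at hidx
      exact Nat.eq_of_mul_eq_mul_right (by positivity) hidx
    rw [h1] at hmod
    have : ∀ a < 5, ∀ b < 3, ∀ c < 4, (1333 * (2^(4-a) * 3^(2-b) * 37^(3-c)) : ℕ) % 19 = 1 →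
      (a = 3 ∧ b = 1) ∧ (c = 0 ∨ c = 2) := by
      set_option synthInstance.maxSize 1000 in decide
    exact this a ha b hb c hc hmod
  obtain ⟨⟨rfl, rfl⟩, rfl | rfl⟩ := key
  · rw [hk]; norm_num
  exfalso
  obtain ⟨R, hR⟩ := exists_isSyl 37 N(P)
  have hRc : Nat.card R = 37 ^ 2 := hR.card (by rw [hk]; norm_num) (by rw [hk]; norm_num)
  have hRb : R ≠ ⊥ := ne_bot_of_card (by norm_num) (by norm_num) hRc
  have hPC : P ≤ C(R) := by
    apply le_of_card_inf
    have h1 := card_inf_centralizer_mod hR.isPGroup hR.le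
    obtain ⟨j, hj, hc⟩ := card_eq_pow_of_le (by norm_num) hPc (inf_le_left : P ⊓ C(R) ≤ P)
    rw [hc, hPc] at h1 ⊢
    interval_cases j <;> revert h1 <;> decide
  have h3 := hA.not_three_dvd hR.isPGroup hRb
  have hS : IsSyl 19 P C(R) := hP.mono hPC le_top
  have hn := hS.numSyl19' (hA.card_centralizer_dvd (by simp) hR.isPGroup hRb) h3
  have hRR := le_centralizer_of_card_sq hRc
  have hm := relIndex_mul_card_inf N(P) C(R)
  have h37 : 37 ^ 2 ∣ Nat.card ↥(N(P) ⊓ C(R)) :=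
    hRc ▸ Subgroup.card_dvd_of_le (le_inf hR.le hRR)
  simp only [Finset.mem_insert, Finset.mem_singleton] at hn
  rcases hn with hn | hn
  · rw [Subgroup.relIndex_eq_one] at hn
    have h1 : N(R) ≤ N(P) := (normalizer_le_normalizer_centralizer R).trans (hS.normalizer_le hn)
    have h2 : 37 ^ 3 ∣ Nat.card N(R) :=
      pow_succ_dvd_card_normalizer (by rw [hA.card]; norm_num) hRc
    have := h2.trans (Subgroup.card_dvd_of_le h1)
    rw [hk] at this
    revert this; norm_num
  · have h1 : 37 ^ 4 ∣ Nat.card C(R) := by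
      rw [← hm, hn]
      exact mul_dvd_mul_left (37 ^ 2) h37
    have := h1.trans (Subgroup.card_subgroup_dvd_card _)
    rw [hA.card] at this
    revert this; norm_num

lemma Arith.not_361_dvd (hA : Arith G) {X : Subgroup G} (hX : IsPGroup 37 X) (h1 : X ≠ ⊥) :
    ¬ 19 ^ 2 ∣ Nat.card C(X) := by
  intro hd
  obtain ⟨P, hP⟩ := exists_isSyl 19 C(X)
  have hPc : Nat.card P = 19 ^ 2 := by
    refine hP.card hd fun h => ?_
    have := h.trans (Subgroup.card_subgroup_dvd_card _)
    rw [hA.card] at this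
    revert this; norm_num
  have hXN : X ≤ N(P) :=
    (le_centralizer_comm hP.le).trans (Subgroup.centralizer_le_normalizer _)
  have := (dvd_card_of_ne_bot hX h1).trans (Subgroup.card_dvd_of_le hXN)
  rw [hA.card_normalizer19 (hA.isSyl19 hPc)] at this
  revert this; norm_num

lemma Arith.isSyl19_centralizer (hA : Arith G) {X Y : Subgroup G} (hX : IsPGroup 37 X) (h1 : X ≠ ⊥)
    (hY : Nat.card Y = 19) (hYX : Y ≤ C(X)) : IsSyl 19 Y C(X) :=
  isSyl_of_card (n := 1) (by simpa using hY) hYX (hA.not_361_dvd hX h1)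

/-- An abelian `37`-subgroup of index at most `37` in a Sylow subgroup of its centralizer
normalizes the Sylow `19`-subgroups of its centralizer. -/
lemma Arith.normalizer_le19 (hA : Arith G) {X Y : Subgroup G} {i : ℕ} (hX : Nat.card X = 37 ^ i)
    (hi : i ≠ 0) (hab : X ≤ C(X)) (hc : ¬ 37 ^ (i + 2) ∣ Nat.card C(X)) (hY : Nat.card Y = 19)
    (hYX : Y ≤ C(X)) : C(X) ≤ N(Y) ∧ N(X) ≤ N(Y) := by
  have hXp : IsPGroup 37 X := isPGroup_of_card hX
  have hXb : X ≠ ⊥ := ne_bot_of_card (by norm_num) hi hX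
  have hS := hA.isSyl19_centralizer hXp hXb hY hYX
  have hn := hS.numSyl19' (hA.card_centralizer_dvd (by simp) hXp hXb) (hA.not_three_dvd hXp hXb)
  have hXY : X ≤ N(Y) ⊓ C(X) :=
    le_inf ((le_centralizer_comm hYX).trans (Subgroup.centralizer_le_normalizer _)) hab
  have hm := relIndex_mul_card_inf N(Y) C(X)
  simp only [Finset.mem_insert, Finset.mem_singleton] at hn
  rcases hn with hn | hn
  · rw [Subgroup.relIndex_eq_one] at hn
    exact ⟨hn, (normalizer_le_normalizer_centralizer X).trans (hS.normalizer_le hn)⟩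
  · exfalso
    apply hc
    rw [← hm, hn, pow_add, mul_comm]
    exact mul_dvd_mul_left (37 ^ 2) (hX ▸ Subgroup.card_dvd_of_le hXY)

lemma le_centralizer37 {R Y : Subgroup G} (hR : IsPGroup 37 R) (hY : Nat.card Y = 19)
    (h : R ≤ N(Y)) : R ≤ C(Y) :=
  le_centralizer_of_card_mod hR hY h (by decide)

lemma Arith.card_normalizer37 (hA : Arith G) {Q : Subgroup G} (hQ : IsSyl 37 Q ⊤) :
    Nat.card N(Q) = 37 ^ 3 * 1368 ∨ Nat.card N(Q) = 37 ^ 3 * 36 := by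
  have hQc := hA.card37 hQ
  have hN := hA.card_normalizer_dvd (by simp) hQ.isPGroup
    (ne_bot_of_card (by norm_num) (by norm_num) hQc)
  obtain ⟨k, hk⟩ : 37 ^ 3 ∣ Nat.card N(Q) := hQc ▸ Subgroup.card_dvd_of_le Subgroup.le_normalizer
  have hkd : k ∣ 2^4 * 3^2 * 19^2 := by
    rw [hk, show N1 = 37 ^ 3 * (2^4 * 3^2 * 19^2) by norm_num [N1]] at hN
    exact Nat.dvd_of_mul_dvd_mul_left (by norm_num) hN
  obtain ⟨j, hj⟩ := hkd
  have hk0 : k ≠ 0 := by rintro rfl; norm_num at hj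
  have hidx := relIndex_mul_card_of_le N(Q) ⊤ le_top
  rw [Subgroup.card_top, hA.card, hk] at hidx
  have hmod := hQ.relIndex_mod
  have hr : N(Q).relIndex ⊤ = 1333 * j := by
    have : N(Q).relIndex ⊤ * (37 ^ 3 * k) = 1333 * j * (37 ^ 3 * k) := by
      rw [hidx]
      calc _ = 1333 * 37 ^ 3 * (2^4 * 3^2 * 19^2) := by norm_num
        _ = _ := by rw [hj]; ring
    exact Nat.eq_of_mul_eq_mul_right (by positivity) this
  rw [hr] at hmod
  obtain ⟨a, ha, b, hb, c, hc, hjj⟩ := exists_pow_of_dvd (p := 2) (q := 3) (r := 19) (by norm_num)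
    (by norm_num) (by norm_num) (Dvd.intro_left k hj.symm)
  have hj3 : j = 1 ∨ j = 38 ∨ j = 1444 := by
    rw [hjj] at hmod ⊢
    have : ∀ a < 5, ∀ b < 3, ∀ c < 3, 1333 * (2 ^ a * 3 ^ b * 19 ^ c) % 37 = 1 →
      2 ^ a * 3 ^ b * 19 ^ c = 1 ∨ 2 ^ a * 3 ^ b * 19 ^ c = 38 ∨
        2 ^ a * 3 ^ b * 19 ^ c = 1444 := by decide
    exact this a ha b hb c hc hmod
  rcases hj3 with rfl | rfl | rfl
  · exfalso
    have hcop : Nat.Coprime (Nat.card (Q.subgroupOf N(Q))) (Q.subgroupOf N(Q)).index := by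
      rw [Nat.card_congr (Subgroup.subgroupOfEquivOfLe Subgroup.le_normalizer).toEquiv, hQc]
      apply Nat.Coprime.pow_left
      exact (Nat.Prime.coprime_iff_not_dvd (by norm_num)).2
        (hQ.mono Subgroup.le_normalizer le_top).2.2
    have : (Q.subgroupOf N(Q)).Normal := Subgroup.normal_in_normalizer
    obtain ⟨K, hK⟩ := Subgroup.exists_right_complement'_of_coprime hcop
    have hKc := hK.card_mul_card
    rw [hk, Nat.card_congr (Subgroup.subgroupOfEquivOfLe Subgroup.le_normalizer).toEquiv,
        hQc] at hKc
    have hKc : Nat.card K = k := Nat.eq_of_mul_eq_mul_left (by norm_num) hKc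
    set K' := K.map N(Q).subtype with hK'
    have hK'c : Nat.card K' = 2^4 * 3^2 * 19^2 := by
      rw [hK', ← Nat.card_congr (K.equivMapOfInjective _ N(Q).subtype_injective).toEquiv, hKc]
      omega
    obtain ⟨P, hP⟩ := exists_isSyl 19 K'
    have hPc : Nat.card P = 19 ^ 2 := hP.card (by rw [hK'c]; norm_num) (by rw [hK'c]; norm_num)
    have hn := hP.numSyl19 (by rw [hK'c]; norm_num [N1])
    have hd : N(P).relIndex K' ∣ 2^4 * 3^2 * 19^2 := hK'c ▸ Subgroup.relIndex_dvd_card _ _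
    have h1 : N(P).relIndex K' = 1 := by
      simp only [Finset.mem_insert, Finset.mem_singleton] at hn
      rcases hn with h | h | h | h
      · exact h
      all_goals rw [h] at hd; revert hd; norm_num
    rw [Subgroup.relIndex_eq_one] at h1
    have := Subgroup.card_dvd_of_le h1
    rw [hK'c, hA.card_normalizer19 (hA.isSyl19 hPc)] at this
    revert this; norm_num
  · left; rw [hk]; omega
  · right; rw [hk]; omega

lemma eq_of_le_conj {H : Subgroup G} {g : G} (h : MulAut.conj g • H ≤ H) : g ∈ N(H) := by
  rw [← conj_eq_iff]
  exact Subgroup.eq_of_le_of_card_ge h (card_conj g H).ge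

end Local

section Conj
variable {G : Type*} [Group G] [Finite G]

lemma dvd_ncard_of_conj {d : ℕ} (H : Subgroup G) (S : Set (Subgroup G))
    (hS : ∀ h ∈ H, ∀ A ∈ S, MulAut.conj h • A ∈ S) (hd : ∀ A ∈ S, d ∣ N(A).relIndex H) :
    d ∣ S.ncard := by
  let _ : MulAction H (Subgroup G) := MulAction.compHom _ (MulAut.conj.comp H.subtype)
  have hsm : ∀ (h : H) (A : Subgroup G), h • A = MulAut.conj (h : G) • A := fun _ _ => rfl
  refine dvd_card_of_dvd_orbit_of_invariant (H := H) S (fun h A hA => hS h h.2 A hA) fun A hA => ?_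
  rw [Nat.card_coe_set_eq, ← MulAction.index_stabilizer]
  convert hd A hA
  rw [Subgroup.relIndex]
  congr 1
  ext h
  rw [MulAction.mem_stabilizer_iff, hsm, conj_eq_iff]
  rfl

lemma ncard_isSyl {p : ℕ} [Fact p.Prime] {P L : Subgroup G} (h : IsSyl p P L) :
    {Q | IsSyl p Q L}.ncard = N(P).relIndex L := by
  rw [h.card_sylow, ← Nat.card_coe_set_eq]
  refine Nat.card_congr (Equiv.ofBijective (fun S => S.2.toSylow) ⟨?_, ?_⟩)
  · rintro ⟨S, hS⟩ ⟨T, hT⟩ h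
    apply Subtype.ext
    change S = T
    rw [← hS.map_toSylow, ← hT.map_toSylow]
    exact congrArg (fun S : Sylow p L => (S : Subgroup L).map L.subtype) h
  · intro S
    refine ⟨⟨_, S.isSyl_map⟩, ?_⟩
    apply Sylow.ext
    rw [IsSyl.coe_toSylow]
    exact Subgroup.comap_map_eq_self_of_injective L.subtype_injective _

lemma IsSyl.inf_normalizer {p : ℕ} [Fact p.Prime] {P Q L : Subgroup G} (h : IsSyl p P L)
    (hQ : IsPGroup p Q) (hQL : Q ≤ L) : N(P) ⊓ Q = P ⊓ Q := by
  apply le_antisymm _ (inf_le_inf_right _ Subgroup.le_normalizer)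
  refine le_inf ?_ inf_le_right
  have h1 : IsSyl p P (N(P) ⊓ L) := h.mono h.le_normalizer_inf inf_le_right
  exact h1.ge_of_le_normalizer inf_le_left (hQ.to_le inf_le_right) (inf_le_inf_left _ hQL)

lemma exists_le_card_pow {p n : ℕ} [Fact p.Prime] {S : Subgroup G} (h : p ^ n ∣ Nat.card S) :
    ∃ R ≤ S, Nat.card R = p ^ n := by
  obtain ⟨R, hR⟩ := Sylow.exists_subgroup_card_pow_prime p h
  refine ⟨R.map S.subtype, Subgroup.map_subtype_le _, ?_⟩
  rw [← Nat.card_congr (R.equivMapOfInjective _ S.subtype_injective).toEquiv, hR]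

lemma sq_dvd_of_mul_eq_cube {p a b : ℕ} (hp : p.Prime) (h : a * b = p ^ 3) (ha : ¬ p ^ 2 ∣ a) :
    p ^ 2 ∣ b := by
  obtain ⟨i, hi, rfl⟩ := (Nat.dvd_prime_pow hp).1 (Dvd.intro b h)
  have hi2 : i < 2 := by
    by_contra! h2
    exact ha (pow_dvd_pow p h2)
  have : p ^ i * b = p ^ i * p ^ (3 - i) := by rw [h, ← pow_add]; congr 1; omega
  rw [Nat.eq_of_mul_eq_mul_left (pow_pos hp.pos i) this]
  exact pow_dvd_pow p (by omega)

lemma sq_dvd_relIndex_or {p : ℕ} (hp : p.Prime) {Q : Subgroup G} (hQ : Nat.card Q = p ^ 3)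
    (N : Subgroup G) (h : ¬ p ^ 2 ∣ N.relIndex Q) : p ^ 2 ∣ Nat.card ↥(N ⊓ Q) := by
  exact sq_dvd_of_mul_eq_cube hp (hQ ▸ relIndex_mul_card_inf N Q) h

end Conj

section Local
variable {G : Type*} [Group G] [Finite G]

lemma card_of_sq_dvd {S Q : Subgroup G} {p : ℕ} [hp : Fact p.Prime] (hQ : Nat.card Q = p ^ 3)
    (hS : S ≤ Q)
    (hne : ¬ Q ≤ S) (h : p ^ 2 ∣ Nat.card S) : Nat.card S = p ^ 2 := by
  obtain ⟨k, hk, hc⟩ := card_eq_pow_of_le hp.out hQ hS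
  rw [hc] at h ⊢
  have h2 := (Nat.pow_dvd_pow_iff_le_right hp.out.one_lt).1 h
  have h3 : k ≠ 3 := by
    rintro rfl
    exact hne (Subgroup.eq_of_le_of_card_ge hS (by rw [hc, hQ])).ge
  obtain rfl : k = 2 := by omega
  rfl

omit [Finite G] in
lemma Arith.not_37_pow_four (hA : Arith G) (L : Subgroup G) : ¬ 37 ^ 4 ∣ Nat.card L := by
  intro h
  have := h.trans (Subgroup.card_subgroup_dvd_card _)
  rw [hA.card] at this
  revert this; norm_num

lemma Arith.not_19_dvd_centralizer_sylow (hA : Arith G) {Q : Subgroup G} (hQ : IsSyl 37 Q ⊤) :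
    ¬ 19 ∣ Nat.card C(Q) := by
  intro hd
  have hQc := hA.card37 hQ
  have hQb := ne_bot_of_card (by norm_num) (by norm_num) hQc
  obtain ⟨Y, hYC, hY⟩ := exists_isPGroup_of_dvd hd
  have hYS := hA.isSyl19_centralizer hQ.isPGroup hQb hY hYC
  have hYp : IsPGroup 19 Y := hYS.isPGroup
  have hYb : Y ≠ ⊥ := ne_bot_of_card (p := 19) (n := 1) (by norm_num) (by norm_num)
      (by simpa using hY)
  have hQY : Q ≤ C(Y) := le_centralizer_comm hYC
  have hQN : IsSyl 37 Q N(Q) := hQ.mono Subgroup.le_normalizer le_top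
  have hCY : C(Q) ≤ N(Y) := by
    obtain ⟨S, hS⟩ := exists_isSyl 37 C(Q)
    have hSQ : S ≤ Q := hQN.ge_of_le_normalizer le_rfl hS.isPGroup
      (hS.le.trans (Subgroup.centralizer_le_normalizer _))
    have hSY : S ≤ N(Y) := (hSQ.trans hQY).trans (Subgroup.centralizer_le_normalizer _)
    have hn := hYS.numSyl19' (hA.card_centralizer_dvd (by simp) hQ.isPGroup hQb)
      (hA.not_three_dvd hQ.isPGroup hQb)
    have h37 : ¬ 37 ∣ N(Y).relIndex C(Q) := fun h =>
      hS.2.2 (h.trans (Subgroup.relIndex_dvd_of_le_left _ hSY))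
    simp only [Finset.mem_insert, Finset.mem_singleton] at hn
    rcases hn with hn | hn
    · rwa [Subgroup.relIndex_eq_one] at hn
    · exact absurd (by rw [hn]; norm_num) h37
  have hNM : N(Q) ≤ N(Y) := (normalizer_le_normalizer_centralizer Q).trans (hYS.normalizer_le hCY)
  have hNQ : 37 ^ 3 * 1368 ∣ Nat.card N(Y) := by
    rcases hA.card_normalizer37 hQ with h | h
    · rw [← h]; exact Subgroup.card_dvd_of_le hNM
    · exfalso
      have := hd.trans (Subgroup.card_dvd_of_le (Subgroup.centralizer_le_normalizer (Q : Set G)))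
      rw [h] at this
      revert this; norm_num
  have h361 : 361 ∣ Nat.card N(Y) := by
    obtain ⟨P, hYP, hP⟩ := exists_isSyl_ge hYp (le_top : Y ≤ ⊤)
    have hPc := hA.card19 hP
    have : P ≤ N(Y) := ((le_centralizer_of_card_sq hPc).trans (Subgroup.centralizer_le hYP)).trans
      (Subgroup.centralizer_le_normalizer _)
    have := Subgroup.card_dvd_of_le this
    rwa [hPc] at this
  have hM : Nat.card N(Y) ∣ N1 := hA.card_normalizer_dvd (by simp) hYp hYb
  have hidx : N(Y).index = 1333 ∨ N(Y).index = 2666 := by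
    have hl : 37 ^ 3 * 25992 ∣ Nat.card N(Y) := by
      have := Nat.lcm_dvd hNQ h361
      norm_num [Nat.lcm] at this
      norm_num; exact this
    obtain ⟨k, hk⟩ := hl
    have hk2 : k ∣ 2 := by
      rw [hk, show N1 = 37 ^ 3 * 25992 * 2 by norm_num [N1]] at hM
      exact Nat.dvd_of_mul_dvd_mul_left (by norm_num) hM
    have := N(Y).index_mul_card
    rw [hA.card, hk] at this
    rcases (Nat.dvd_prime Nat.prime_two).1 hk2 with rfl | rfl <;> omega
  have hdvd : 37 ^ 2 ∣ ({((1 : G) : G ⧸ N(Y))}ᶜ : Set (G ⧸ N(Y))).ncard := by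
    refine dvd_card_of_dvd_orbit_of_invariant (H := Q) _ ?_ ?_
    · rintro ⟨q, hq⟩ a ha h
      apply ha
      simp only [Set.mem_singleton_iff] at h ⊢
      rw [← inv_smul_eq_iff.2 h.symm]
      change (((q⁻¹ * 1 : G) : G ⧸ N(Y))) = _
      rw [QuotientGroup.eq]
      simpa using hQY.trans (Subgroup.centralizer_le_normalizer _) hq
    · intro a ha
      induction a using QuotientGroup.induction_on with | H g => ?_
      by_contra hnd
      have h2 := sq_dvd_of_mul_eq_cube (by norm_num)
        ((card_orbit_mul_card_stabilizer (H := Q) (g : G ⧸ N(Y))).trans hQc) hnd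
      have hst : MulAction.stabilizer Q (g : G ⧸ N(Y)) =
          (N(MulAut.conj g • Y) ⊓ Q).subgroupOf Q := by
        ext q
        rw [MulAction.mem_stabilizer_iff, Subgroup.mem_subgroupOf, Subgroup.mem_inf,
          ← conj_normalizer, mem_conj_iff]
        change (((q * g : G) : G ⧸ N(Y))) = _ ↔ _
        rw [eq_comm, QuotientGroup.eq, ← mul_assoc]
        simp
      rw [hst, Nat.card_congr (Subgroup.subgroupOfEquivOfLe inf_le_right).toEquiv] at h2
      obtain ⟨S, hS, hSc⟩ := exists_le_card_pow h2
      have hSp : IsPGroup 37 S := isPGroup_of_card hSc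
      have hYS : Y ≤ C(S) := hYC.trans (Subgroup.centralizer_le (hS.trans inf_le_right))
      have hYgc : Nat.card ↥(MulAut.conj g • Y) = 19 := by rw [card_conj, hY]
      have hSY := le_centralizer37 hSp hYgc (hS.trans inf_le_left)
      obtain ⟨h3, -⟩ := hA.normalizer_le19 hSc (by norm_num) (le_centralizer_of_card_sq hSc)
        (hA.not_37_pow_four _) hY hYS
      have h4 := hA.isSyl19_centralizer hSp (ne_bot_of_card (by norm_num) (by norm_num) hSc) hY hYS
      have h5 : MulAut.conj g • Y ≤ Y := h4.ge_of_le_normalizer h3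
        (isPGroup_of_card (n := 1) (by simpa using hYgc)) (le_centralizer_comm hSY)
      apply ha
      rw [Set.mem_singleton_iff, eq_comm, QuotientGroup.eq]
      simpa using eq_of_le_conj h5
  have h1 := Set.ncard_add_ncard_compl ({((1 : G) : G ⧸ N(Y))} : Set (G ⧸ N(Y)))
  rw [Set.ncard_singleton, ← Subgroup.index] at h1
  omega

lemma Arith.not_19_dvd_centralizer (hA : Arith G) {R : Subgroup G} (hR : Nat.card R = 37 ^ 2) :
    ¬ 19 ∣ Nat.card C(R) := by
  intro hd
  obtain ⟨Y, hYC, hY⟩ := exists_isPGroup_of_dvd hd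
  obtain ⟨-, h1⟩ := hA.normalizer_le19 hR (by norm_num) (le_centralizer_of_card_sq hR)
    (hA.not_37_pow_four _) hY hYC
  obtain ⟨Q, hQ⟩ := exists_isSyl 37 N(R)
  have h3 : 37 ^ 3 ∣ Nat.card N(R) := pow_succ_dvd_card_normalizer (by rw [hA.card]; norm_num) hR
  have hQc : Nat.card Q = 37 ^ 3 := hQ.card h3 (hA.not_37_pow_four _)
  have hQY := le_centralizer37 hQ.isPGroup hY (hQ.le.trans h1)
  exact hA.not_19_dvd_centralizer_sylow (hA.isSyl37 hQc)
    (hY ▸ Subgroup.card_dvd_of_le (le_centralizer_comm hQY))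

lemma Arith.inf_centralizer19 (hA : Arith G) {R Y : Subgroup G} (hR : Nat.card R = 37 ^ 2)
    (hY : Nat.card Y = 19) (hYR : Y ≤ N(R)) : R ⊓ C(Y) = ⊥ := by
  have h1 := card_inf_centralizer_mod (isPGroup_of_card (p := 19) (n := 1) (by simpa using hY)) hYR
  obtain ⟨k, hk, hc⟩ := card_eq_pow_of_le (by norm_num) hR (inf_le_left : R ⊓ C(Y) ≤ R)
  rw [hR, hc] at h1
  have hk0 : k ≠ 2 := by
    rintro rfl
    have : R ≤ C(Y) := le_of_card_inf (by rw [hc, hR])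
    exact hA.not_19_dvd_centralizer hR (hY ▸ Subgroup.card_dvd_of_le (le_centralizer_comm this))
  rw [← Subgroup.card_eq_one, hc]
  interval_cases k
  · rfl
  · revert h1; decide
  · exact absurd rfl hk0

lemma Arith.not_361_dvd_normalizer (hA : Arith G) {R : Subgroup G} (hR : Nat.card R = 37 ^ 2) :
    ¬ 19 ^ 2 ∣ Nat.card N(R) := by
  intro hd
  obtain ⟨P, hPN, hP⟩ := exists_le_card_pow hd
  let _ : MulAction P R :=
    MulAction.compHom R ((Subgroup.normalizerMonoidHom R).comp (Subgroup.inclusion hPN))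
  have hs : ∀ (r : P) (x : R), ((r • x : R) : G) = r * x * (r : G)⁻¹ := fun r x => rfl
  have : 19 ^ 2 ∣ ({1}ᶜ : Set R).ncard := by
    refine dvd_card_of_dvd_orbit_of_invariant (H := P) _ ?_ ?_
    · intro h a ha h1
      apply ha
      rw [Set.mem_singleton_iff] at h1 ⊢
      have h2 := congrArg (fun y : R => (y : G)) h1
      simp only [hs, Subgroup.coe_one] at h2
      apply Subtype.ext
      rw [mul_inv_eq_iff_eq_mul, one_mul, mul_eq_left] at h2
      exact h2
    · intro a ha
      have h1 := card_orbit_mul_card_stabilizer (H := P) a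
      have h2 : MulAction.stabilizer P a = ⊥ := by
        by_contra hne
        obtain ⟨Y, hY1, hY⟩ := exists_isPGroup_of_dvd (dvd_card_of_ne_bot
          ((isPGroup_of_card hP).to_subgroup (MulAction.stabilizer P a)) hne)
        have hYc : Nat.card (Y.map P.subtype) = 19 := by
          rw [← Nat.card_congr (Y.equivMapOfInjective _ P.subtype_injective).toEquiv, hY]
        have h3 := hA.inf_centralizer19 hR hYc ((Subgroup.map_subtype_le Y).trans hPN)
        have h4 : (a : G) ∈ R ⊓ C(Y.map P.subtype) := by
          refine ⟨a.2, ?_⟩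
          change (a : G) ∈ C(Y.map P.subtype)
          rw [Subgroup.mem_centralizer_iff]
          rintro _ ⟨y, hy, rfl⟩
          have h5 := congrArg (fun y : R => (y : G)) (hY1 hy)
          simp only [hs] at h5
          rwa [mul_inv_eq_iff_eq_mul] at h5
        rw [h3, Subgroup.mem_bot] at h4
        exact ha (Subtype.ext h4)
      rw [h2, Subgroup.card_bot, mul_one, hP] at h1
      rw [h1]
  have h1 := Set.ncard_add_ncard_compl ({1} : Set R)
  rw [Set.ncard_singleton, hR] at h1
  omega

end Local

section Local
variable {G : Type*} [Group G] [Finite G]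

lemma eq_of_le_of_card_cube {Q Q' : Subgroup G} {n : ℕ} (h : Nat.card Q = n) (h' : Nat.card Q' = n)
    (hle : Q ≤ Q') : Q = Q' :=
  Subgroup.eq_of_le_of_card_ge hle (by rw [h, h'])

lemma Arith.isSyl37_of_le (hA : Arith G) {Q L : Subgroup G} (hQ : Nat.card Q = 37 ^ 3) (h : Q ≤ L) :
    IsSyl 37 Q L := (hA.isSyl37 hQ).mono h le_top

lemma Arith.eq_of_le_normalizer (hA : Arith G) {Q Q' L : Subgroup G} (hQ : Nat.card Q = 37 ^ 3)
    (hQ' : Nat.card Q' = 37 ^ 3) (hQL : Q ≤ L) (hQL' : Q' ≤ L) (h : L ≤ N(Q)) : Q' = Q :=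
  eq_of_le_of_card_cube hQ' hQ
    ((hA.isSyl37_of_le hQ hQL).ge_of_le_normalizer h (isPGroup_of_card hQ') hQL')

lemma Arith.centralizer_le_normalizer37 (hA : Arith G) {X Q : Subgroup G} (hX : Nat.card X = 37)
    (hXQ : X ≤ Q) (hQX : Q ≤ C(X)) (hQ : Nat.card Q = 37 ^ 3) : C(X) ≤ N(Q) := by
  have hXp : IsPGroup 37 X := isPGroup_of_card (n := 1) (by simpa using hX)
  have hXb : X ≠ ⊥ := ne_bot_of_card (p := 37) (n := 1) (by norm_num) (by norm_num)
      (by simpa using hX)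
  have hC := hA.card_centralizer_dvd (by simp) hXp hXb
  have hS := hA.isSyl37_of_le hQ hQX
  have hn := hS.numSyl37 hC
  simp only [Finset.mem_insert, Finset.mem_singleton] at hn
  rcases hn with hn | hn | hn
  · rwa [Subgroup.relIndex_eq_one] at hn
  · exfalso
    obtain ⟨Q', ⟨hQ', hne⟩, hnd⟩ : ∃ Q' ∈ {Q' | IsSyl 37 Q' C(X)} \ {Q},
        ¬ 37 ^ 2 ∣ N(Q').relIndex Q := by
      by_contra! hall
      have h1 := dvd_ncard_of_conj Q ({Q' | IsSyl 37 Q' C(X)} \ {Q}) ?_ hall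
      · rw [Set.ncard_sdiff_singleton_of_mem (show Q ∈ {Q' | IsSyl 37 Q' C(X)} from hS),
          ncard_isSyl hS, hn] at h1
        revert h1; norm_num
      · rintro q hq A ⟨hA1, hA2⟩
        refine ⟨hA1.conj (Subgroup.le_normalizer (hQX hq)), fun h => hA2 ?_⟩
        rw [Set.mem_singleton_iff] at h ⊢
        rw [← inv_smul_eq_iff.2 h.symm, ← map_inv]
        exact (conj_eq_iff.2 (Subgroup.le_normalizer (Q.inv_mem hq)))
    have hQ'c : Nat.card Q' = 37 ^ 3 := by
      obtain ⟨g, -, rfl⟩ := hS.exists_conj hQ'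
      rw [card_conj, hQ]
    have hXQ' : X ≤ Q' := by
      obtain ⟨g, hg, rfl⟩ := hS.exists_conj hQ'
      intro x hx
      rw [mem_conj_iff, mul_assoc, Subgroup.mem_centralizer_iff.1 hg x hx]
      simpa using hXQ hx
    have h2 := sq_dvd_relIndex_or (by norm_num) hQ _ hnd
    rw [hQ'.inf_normalizer (isPGroup_of_card hQ) hQX] at h2
    have hR := card_of_sq_dvd hQ inf_le_right
      (fun h => hne (eq_of_le_of_card_cube hQ hQ'c (h.trans inf_le_left)).symm) h2
    set R := Q' ⊓ Q
    have hQL : Q ≤ N(R) ⊓ C(X) := le_inf (le_normalizer_of_card inf_le_right hR hQ) hQX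
    have hQL' : Q' ≤ N(R) ⊓ C(X) := le_inf (le_normalizer_of_card inf_le_left hR hQ'c) hQ'.le
    have hn' := (hA.isSyl37_of_le hQ hQL).numSyl37
      ((Subgroup.card_dvd_of_le inf_le_right).trans hC)
    have h19 : 19 ∣ N(Q).relIndex (N(R) ⊓ C(X)) := by
      simp only [Finset.mem_insert, Finset.mem_singleton] at hn'
      rcases hn' with hn' | hn' | hn'
      · rw [Subgroup.relIndex_eq_one] at hn'
        exact absurd (hA.eq_of_le_normalizer hQ hQ'c hQL hQL' hn') hne
      · rw [hn']; norm_num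
      · rw [hn']; norm_num
    obtain ⟨Y, hYL, hY⟩ := exists_isPGroup_of_dvd (h19.trans (Subgroup.relIndex_dvd_card _ _))
    have h3 := hA.inf_centralizer19 hR hY (hYL.trans inf_le_left)
    have h4 : X ≤ R ⊓ C(Y) :=
      le_inf (le_inf hXQ' hXQ) (le_centralizer_comm (hYL.trans inf_le_right))
    rw [h3] at h4
    exact hXb (le_bot_iff.1 h4)
  · exfalso
    have : 19 ^ 2 ∣ N(Q).relIndex C(X) := by rw [hn]; norm_num
    exact hA.not_361_dvd hXp hXb (this.trans (Subgroup.relIndex_dvd_card _ _))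

lemma Arith.relIndex_eq_38 (hA : Arith G) {R Q : Subgroup G} (hR : Nat.card R = 37 ^ 2)
    (hRQ : R ≤ Q) (hQ : Nat.card Q = 37 ^ 3) (hbad : ¬ N(R) ≤ N(Q)) :
    N(Q).relIndex N(R) = 38 := by
  have hQN := le_normalizer_of_card hRQ hR hQ
  have hn := (hA.isSyl37_of_le hQ hQN).numSyl37 (hA.card_normalizer_dvd (by simp)
    (isPGroup_of_card hR) (ne_bot_of_card (by norm_num) (by norm_num) hR))
  simp only [Finset.mem_insert, Finset.mem_singleton] at hn
  rcases hn with hn | hn | hn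
  · rw [Subgroup.relIndex_eq_one] at hn
    exact absurd hn hbad
  · exact hn
  · exfalso
    have : 19 ^ 2 ∣ N(Q).relIndex N(R) := by rw [hn]; norm_num
    exact hA.not_361_dvd_normalizer hR (this.trans (Subgroup.relIndex_dvd_card _ _))

lemma Arith.le_of_not_normalizer_le (hA : Arith G) {R Q X : Subgroup G} (hR : Nat.card R = 37 ^ 2)
    (hRQ : R ≤ Q) (hQ : Nat.card Q = 37 ^ 3) (hbad : ¬ N(R) ≤ N(Q)) (hXQ : X ≤ Q) (hQX : Q ≤ C(X)) :
    X ≤ R := by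
  by_contra hXR
  apply hbad
  have h1 : R ⊔ X = Q := by
    have hle : R ⊔ X ≤ Q := sup_le hRQ hXQ
    by_contra hne
    have := card_of_sq_dvd hQ hle (fun h => hne (le_antisymm hle h))
      (hR ▸ Subgroup.card_dvd_of_le le_sup_left)
    have h2 : R = R ⊔ X := Subgroup.eq_of_le_of_card_ge le_sup_left (by rw [this, hR])
    exact hXR (h2.symm ▸ le_sup_right)
  have hQR : Q ≤ C(R) := by
    nth_rewrite 1 [← h1]
    exact sup_le (le_centralizer_of_card_sq hR)
      (le_centralizer_comm (hRQ.trans hQX))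
  have hS := hA.isSyl37_of_le hQ hQR
  have hn := hS.numSyl37 (hA.card_centralizer_dvd (by simp)
    (isPGroup_of_card hR) (ne_bot_of_card (by norm_num) (by norm_num) hR))
  have h19 : ¬ 19 ∣ N(Q).relIndex C(R) := fun h =>
    hA.not_19_dvd_centralizer hR (h.trans (Subgroup.relIndex_dvd_card _ _))
  simp only [Finset.mem_insert, Finset.mem_singleton] at hn
  rcases hn with hn | hn | hn
  · rw [Subgroup.relIndex_eq_one] at hn
    exact (normalizer_le_normalizer_centralizer R).trans (hS.normalizer_le hn)
  · exact absurd (by rw [hn]; norm_num) h19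
  · exact absurd (by rw [hn]; norm_num) h19

/-- A Sylow `37`-subgroup together with a central subgroup `X` of order `37` and a subgroup `Y` of
order `19` normalizing `Q` and centralizing `X`. -/
structure Config (Q X Y : Subgroup G) : Prop where
  cardQ : Nat.card Q = 37 ^ 3
  cardX : Nat.card X = 37
  cardY : Nat.card Y = 19
  XQ : X ≤ Q
  QX : Q ≤ C(X)
  YQ : Y ≤ N(Q)
  YX : Y ≤ C(X)

lemma Arith.exists_config (hA : Arith G) : ∃ Q X Y : Subgroup G, Config Q X Y := by
  obtain ⟨g, hg⟩ := hA.exists703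
  have hX : Nat.card (Subgroup.zpowers (g ^ 19)) = 37 := by
    rw [Nat.card_zpowers, orderOf_pow' _ (by norm_num), hg]; rfl
  have hY : Nat.card (Subgroup.zpowers (g ^ 37)) = 19 := by
    rw [Nat.card_zpowers, orderOf_pow' _ (by norm_num), hg]; rfl
  have hYX : Subgroup.zpowers (g ^ 37) ≤ C(Subgroup.zpowers (g ^ 19)) := by
    rw [Subgroup.zpowers_le, Subgroup.mem_centralizer_iff]
    rintro _ ⟨k, rfl⟩
    exact (((Commute.refl g).pow_pow 19 37).zpow_left k)
  generalize Subgroup.zpowers (g ^ 19) = X at *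
  generalize Subgroup.zpowers (g ^ 37) = Y at *
  have hXp : IsPGroup 37 X := isPGroup_of_card (n := 1) (by simpa using hX)
  have hXb : X ≠ ⊥ := ne_bot_of_card (p := 37) (n := 1) (by norm_num) (by norm_num)
      (by simpa using hX)
  obtain ⟨Q, hXQ, hQ⟩ := exists_isSyl_ge hXp (le_centralizer_of_card hX)
  obtain ⟨Q0, hXQ0, hQ0⟩ := exists_isSyl_ge hXp (le_top : X ≤ ⊤)
  obtain ⟨R, hXR, -, hR, hRX⟩ := exists_card_sq_ge hXQ0 hX (hA.card37 hQ0)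
  have h2 : 37 ^ 2 ∣ Nat.card C(X) := hR ▸ Subgroup.card_dvd_of_le hRX
  by_cases h3 : 37 ^ 3 ∣ Nat.card C(X)
  · have hQc : Nat.card Q = 37 ^ 3 := hQ.card h3 (hA.not_37_pow_four _)
    exact ⟨Q, X, Y, hQc, hX, hY, hXQ, hQ.le,
      hYX.trans (hA.centralizer_le_normalizer37 hX hXQ hQ.le hQc), hYX⟩
  · exfalso
    have hQc : Nat.card Q = 37 ^ 2 := hQ.card h2 h3
    obtain ⟨h4, -⟩ := hA.normalizer_le19 (i := 1) (by simpa using hX) (by norm_num)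
      (le_centralizer_of_card hX) h3 hY hYX
    have h5 := le_centralizer37 hQ.isPGroup hY (hQ.le.trans h4)
    exact hA.not_19_dvd_centralizer hQc (hY ▸ Subgroup.card_dvd_of_le (le_centralizer_comm h5))

end Local

section Local
variable {G : Type*} [Group G] [Finite G]

lemma Config.card_normalizer (hA : Arith G) {Q X Y : Subgroup G} (h : Config Q X Y) :
    Nat.card N(Q) = 37 ^ 3 * 1368 := by
  have h1 : 19 ∣ Nat.card N(Q) := h.cardY ▸ Subgroup.card_dvd_of_le h.YQ
  rcases hA.card_normalizer37 (hA.isSyl37 h.cardQ) with h2 | h2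
  · exact h2
  · rw [h2] at h1; revert h1; norm_num

lemma Config.ncard_isSyl (hA : Arith G) {Q X Y : Subgroup G} (h : Config Q X Y) :
    {Q' | IsSyl 37 Q' (⊤ : Subgroup G)}.ncard = 37 ^ 3 + 1 := by
  rw [_root_.ncard_isSyl (hA.isSyl37 h.cardQ), Subgroup.relIndex_top_right]
  have := N(Q).index_mul_card
  rw [h.card_normalizer hA, hA.card] at this
  omega

/-- The subgroups of order `37 ^ 2` in `Q` whose normalizer does not normalize `Q`. -/
def badSet (Q : Subgroup G) : Set (Subgroup G) :=
  {R | R ≤ Q ∧ Nat.card R = 37 ^ 2 ∧ ¬ N(R) ≤ N(Q)}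

lemma Config.dvd_ncard_badSet (hA : Arith G) {Q X Y : Subgroup G} (h : Config Q X Y) :
    19 ∣ (badSet Q).ncard := by
  refine dvd_ncard_of_conj Y (badSet Q) ?_ ?_
  · rintro y hy R ⟨hRQ, hR, hb⟩
    have hQ : MulAut.conj y • Q = Q := conj_eq_iff.2 (h.YQ hy)
    refine ⟨?_, by rw [card_conj, hR], fun hle => hb ?_⟩
    · rw [← hQ]; exact Subgroup.pointwise_smul_le_pointwise_smul_iff.2 hRQ
    · rw [← hQ, ← conj_normalizer, ← conj_normalizer] at hle
      exact Subgroup.pointwise_smul_le_pointwise_smul_iff.1 hle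
  · rintro R ⟨hRQ, hR, hb⟩
    have h1 : N(R).relIndex Y ∣ 19 := h.cardY ▸ Subgroup.relIndex_dvd_card _ _
    rcases (Nat.dvd_prime (by norm_num)).1 h1 with h2 | h2
    · rw [Subgroup.relIndex_eq_one] at h2
      have h3 := hA.inf_centralizer19 hR h.cardY h2
      have h4 : X ≤ R ⊓ C(Y) := le_inf (hA.le_of_not_normalizer_le hR hRQ h.cardQ hb h.XQ h.QX)
        (le_centralizer_comm h.YX)
      rw [h3, le_bot_iff] at h4
      exact absurd h4 (ne_bot_of_card (p := 37) (n := 1) (by norm_num) (by norm_num)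
        (by simpa using h.cardX))
    · rw [h2]

lemma Config.ncard_badSet_mul_le (hA : Arith G) {Q X Y : Subgroup G} (h : Config Q X Y) :
    (badSet Q).ncard * (37 ^ 2 - 37) ≤ 37 ^ 3 := by
  classical
  have _ := Fintype.ofFinite (Subgroup G)
  have _ := Fintype.ofFinite G
  have hX : ∀ R ∈ badSet Q, X ≤ R := fun R hR =>
    hA.le_of_not_normalizer_le hR.2.1 hR.1 h.cardQ hR.2.2 h.XQ h.QX
  have hdis : ((badSet Q).toFinset : Set (Subgroup G)).PairwiseDisjoint
      (fun R => (R : Set G).toFinset \ (X : Set G).toFinset) := by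
    intro R hR R' hR' hne
    rw [Set.coe_toFinset] at hR hR'
    rw [Function.onFun, Finset.disjoint_left]
    intro g hg hg'
    simp only [Finset.mem_sdiff, Set.mem_toFinset, SetLike.mem_coe] at hg hg'
    obtain ⟨k, hk, hc⟩ := card_eq_pow_of_le (by norm_num) hR.2.1 (inf_le_left : R ⊓ R' ≤ R)
    have hk2 : k ≠ 2 := by
      rintro rfl
      apply hne
      have h1 : R ⊓ R' = R := Subgroup.eq_of_le_of_card_ge inf_le_left (by rw [hc, hR.2.1])
      have h2 : R ⊓ R' = R' := Subgroup.eq_of_le_of_card_ge inf_le_right (by rw [hc, hR'.2.1])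
      exact h1.symm.trans h2
    have hk1 : Nat.card ↥(R ⊓ R') ≤ 37 := by
      rw [hc]
      calc 37 ^ k ≤ 37 ^ 1 := Nat.pow_le_pow_right (by norm_num) (by omega)
        _ = 37 := by norm_num
    have h3 : X = R ⊓ R' :=
      Subgroup.eq_of_le_of_card_ge (le_inf (hX R hR) (hX R' hR')) (by rw [h.cardX]; exact hk1)
    exact hg.2 (h3 ▸ ⟨hg.1, hg'.1⟩)
  have hcard : ∀ S : Subgroup G, (S : Set G).toFinset.card = Nat.card S := fun S => by
    rw [← Set.ncard_eq_toFinset_card', ← Nat.card_coe_set_eq]; rfl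
  calc (badSet Q).ncard * (37 ^ 2 - 37)
      = ∑ R ∈ (badSet Q).toFinset, ((R : Set G).toFinset \ (X : Set G).toFinset).card := by
        rw [Set.ncard_eq_toFinset_card', Finset.sum_const_nat]
        intro R hR
        rw [Set.mem_toFinset] at hR
        rw [Finset.card_sdiff_of_subset (Set.toFinset_mono (hX R hR)), hcard, hcard, hR.2.1,
            h.cardX]
    _ = ((badSet Q).toFinset.biUnion
          (fun R => (R : Set G).toFinset \ (X : Set G).toFinset)).card :=
        (Finset.card_biUnion hdis).symm
    _ ≤ (Q : Set G).toFinset.card := by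
        refine Finset.card_le_card (Finset.biUnion_subset.2 fun R hR => ?_)
        rw [Set.mem_toFinset] at hR
        exact Finset.sdiff_subset.trans (Set.toFinset_mono hR.1)
    _ = 37 ^ 3 := by rw [hcard, h.cardQ]

lemma Config.badSet_eq_empty (hA : Arith G) {Q X Y : Subgroup G} (h : Config Q X Y) :
    badSet Q = ∅ := by
  classical
  have _ := Fintype.ofFinite (Subgroup G)
  have hQ := hA.isSyl37 h.cardQ
  set A : Set (Subgroup G) := {Q' | IsSyl 37 Q' (⊤ : Subgroup G)} \ {Q}
  set E : Set (Subgroup G) := {Q' | Q' ∈ A ∧ Q' ⊓ Q ∈ badSet Q}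
  have hAc : A.ncard = 37 ^ 3 := by
    rw [Set.ncard_sdiff_singleton_of_mem (show Q ∈ {Q' | IsSyl 37 Q' (⊤ : Subgroup G)} from hQ),
      h.ncard_isSyl hA]
    rfl
  have hconjA : ∀ q ∈ Q, ∀ Q' ∈ A, MulAut.conj q • Q' ∈ A := by
    rintro q hq B ⟨hB1, hB2⟩
    refine ⟨hB1.conj (Subgroup.le_normalizer (Subgroup.mem_top q)), fun h => hB2 ?_⟩
    rw [Set.mem_singleton_iff] at h ⊢
    rw [← inv_smul_eq_iff.2 h.symm, ← map_inv]
    exact (conj_eq_iff.2 (Subgroup.le_normalizer (Q.inv_mem hq)))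
  have hconjI : ∀ q ∈ Q, ∀ Q' : Subgroup G, (MulAut.conj q • Q') ⊓ Q ∈ badSet Q →
      Q' ⊓ Q ∈ badSet Q := by
    rintro q hq Q' ⟨h1, h2, h3⟩
    have hQQ : MulAut.conj q • Q = Q := conj_eq_iff.2 (Subgroup.le_normalizer hq)
    have h4 : (MulAut.conj q • Q') ⊓ Q = MulAut.conj q • (Q' ⊓ Q) := by
      rw [Subgroup.smul_inf, hQQ]
    rw [h4] at h2 h3
    refine ⟨inf_le_right, by rwa [card_conj] at h2, fun hle => h3 ?_⟩
    have h5 : N(Q) = MulAut.conj q • N(Q) := by rw [conj_normalizer, hQQ]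
    rw [h5, ← conj_normalizer]
    exact Subgroup.pointwise_smul_le_pointwise_smul_iff.2 hle
  have h1 : 37 ^ 2 ∣ (A \ E).ncard := by
    refine dvd_ncard_of_conj Q _ ?_ ?_
    · rintro q hq Q' ⟨hQ', hE⟩
      exact ⟨hconjA q hq Q' hQ', fun hE' => hE ⟨hQ', hconjI q hq Q' hE'.2⟩⟩
    · rintro Q' ⟨hQ', hE⟩
      by_contra hnd
      have h2 := sq_dvd_relIndex_or (by norm_num) h.cardQ _ hnd
      have hQ'c := hA.card37 hQ'.1
      rw [hQ'.1.inf_normalizer hQ.isPGroup le_top] at h2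
      have hR := card_of_sq_dvd h.cardQ inf_le_right
        (fun h' => hQ'.2 (eq_of_le_of_card_cube h.cardQ hQ'c (h'.trans inf_le_left)).symm) h2
      refine hE ⟨hQ', inf_le_right, hR, fun hle => hQ'.2 ?_⟩
      exact hA.eq_of_le_normalizer h.cardQ hQ'c (le_normalizer_of_card inf_le_right hR h.cardQ)
        (le_normalizer_of_card inf_le_left hR hQ'c) hle
  have h2 : (A \ E).ncard + E.ncard = 37 ^ 3 := by
    rw [← hAc]
    exact Set.ncard_sdiff_add_ncard_of_subset (fun _ h => h.1)
  have h3 : E.ncard = (badSet Q).ncard * 37 := by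
    rw [Set.ncard_eq_toFinset_card', Set.ncard_eq_toFinset_card',
      Finset.card_eq_sum_card_fiberwise (f := fun Q' => Q' ⊓ Q) (t := (badSet Q).toFinset),
      Finset.sum_const_nat]
    · intro R hR
      rw [Set.mem_toFinset] at hR
      have hQN := le_normalizer_of_card hR.1 hR.2.1 h.cardQ
      have hS := hA.isSyl37_of_le h.cardQ hQN
      have h4 : ({Q' ∈ E.toFinset | Q' ⊓ Q = R} : Finset (Subgroup G)) =
          ({Q' | IsSyl 37 Q' N(R)} \ {Q}).toFinset := by
        ext Q'
        simp only [Finset.mem_filter, Set.mem_toFinset, Set.mem_sdiff, Set.mem_singleton_iff]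
        constructor
        · rintro ⟨⟨⟨hS', hne⟩, -⟩, rfl⟩
          exact ⟨hA.isSyl37_of_le (hA.card37 hS')
            (le_normalizer_of_card inf_le_left hR.2.1 (hA.card37 hS')), hne⟩
        · rintro ⟨hS', hne⟩
          obtain ⟨g, hg, rfl⟩ := hS.exists_conj hS'
          have hc : Nat.card ↥(MulAut.conj g • Q) = 37 ^ 3 := by rw [card_conj, h.cardQ]
          have hRQ' : R ≤ MulAut.conj g • Q := by
            nth_rewrite 1 [← conj_eq_iff.2 hg]
            exact Subgroup.pointwise_smul_le_pointwise_smul_iff.2 hR.1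
          have hRI : R ≤ (MulAut.conj g • Q) ⊓ Q := le_inf hRQ' hR.1
          have hI := card_of_sq_dvd h.cardQ inf_le_right
            (fun h' => hne (eq_of_le_of_card_cube h.cardQ hc (h'.trans inf_le_left)).symm)
            (hR.2.1 ▸ Subgroup.card_dvd_of_le hRI)
          have hRE : (MulAut.conj g • Q) ⊓ Q = R :=
            (Subgroup.eq_of_le_of_card_ge hRI (by rw [hI, hR.2.1])).symm
          exact ⟨⟨⟨hA.isSyl37 hc, hne⟩, hRE ▸ hR⟩, hRE⟩
      rw [h4, ← Set.ncard_eq_toFinset_card', Set.ncard_sdiff_singleton_of_mem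
        (show Q ∈ {Q' | IsSyl 37 Q' N(R)} from hS), _root_.ncard_isSyl hS,
        hA.relIndex_eq_38 hR.2.1 hR.1 h.cardQ hR.2.2]
    · intro Q' hQ'
      simpa using (show Q' ∈ E by simpa using hQ').2
  have h5 : 37 ∣ (badSet Q).ncard := by omega
  have h6 := h.dvd_ncard_badSet hA
  have h7 := h.ncard_badSet_mul_le hA
  rw [← Set.ncard_eq_zero]
  omega
omit [Finite G] in
lemma conj_centralizer (g : G) (H : Subgroup G) : MulAut.conj g • C(H) = C(MulAut.conj g • H) := by
  ext x
  simp only [mem_conj_iff, Subgroup.mem_centralizer_iff, SetLike.mem_coe]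
  constructor
  · intro h y hy
    have := h _ hy
    calc y * x = g * (g⁻¹ * y * g * (g⁻¹ * x * g)) * g⁻¹ := by group
      _ = x * y := by rw [this]; group
  · intro h y hy
    have := h (g * y * g⁻¹) (by simpa [mul_assoc] using hy)
    calc y * (g⁻¹ * x * g) = g⁻¹ * (g * y * g⁻¹ * x) * g := by group
      _ = g⁻¹ * x * g * y := by rw [this]; group

omit [Finite G] in
lemma Config.conj {Q X Y : Subgroup G} (h : Config Q X Y) (g : G) :
    Config (MulAut.conj g • Q) (MulAut.conj g • X) (MulAut.conj g • Y) where
  cardQ := by rw [card_conj, h.cardQ]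
  cardX := by rw [card_conj, h.cardX]
  cardY := by rw [card_conj, h.cardY]
  XQ := Subgroup.pointwise_smul_le_pointwise_smul_iff.2 h.XQ
  QX := conj_centralizer (G := G) g X ▸ Subgroup.pointwise_smul_le_pointwise_smul_iff.2 h.QX
  YQ := conj_normalizer (G := G) g Q ▸ Subgroup.pointwise_smul_le_pointwise_smul_iff.2 h.YQ
  YX := conj_centralizer (G := G) g X ▸ Subgroup.pointwise_smul_le_pointwise_smul_iff.2 h.YX

/-- Every Sylow `37`-subgroup is part of a configuration. -/
lemma Arith.config (hA : Arith G) {Q : Subgroup G} (hQ : Nat.card Q = 37 ^ 3) :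
    ∃ X Y : Subgroup G, Config Q X Y := by
  obtain ⟨Q0, X0, Y0, h0⟩ := hA.exists_config
  obtain ⟨g, -, rfl⟩ := (hA.isSyl37 h0.cardQ).exists_conj (hA.isSyl37 hQ)
  exact ⟨_, _, h0.conj g⟩

lemma Arith.not_sq_dvd_inf (hA : Arith G) {Q Q' : Subgroup G} (hQ : Nat.card Q = 37 ^ 3)
    (hQ' : Nat.card Q' = 37 ^ 3) (hne : Q' ≠ Q) : ¬ 37 ^ 2 ∣ Nat.card ↥(Q' ⊓ Q) := by
  intro h2
  obtain ⟨X, Y, h⟩ := hA.config hQ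
  have hR := card_of_sq_dvd hQ inf_le_right
    (fun h' => hne (eq_of_le_of_card_cube hQ hQ' (h'.trans inf_le_left)).symm) h2
  have hb : Q' ⊓ Q ∈ badSet Q := ⟨inf_le_right, hR, fun hle => hne
    (hA.eq_of_le_normalizer hQ hQ' (le_normalizer_of_card inf_le_right hR hQ)
      (le_normalizer_of_card inf_le_left hR hQ') hle)⟩
  rw [h.badSet_eq_empty hA] at hb
  exact hb

lemma Arith.eq_of_central (hA : Arith G) {Q Q' X : Subgroup G} (hX : Nat.card X = 37)
    (hQ : Nat.card Q = 37 ^ 3) (hQ' : Nat.card Q' = 37 ^ 3) (hXQ : X ≤ Q) (hQX : Q ≤ C(X))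
    (hXQ' : X ≤ Q') : Q' = Q := by
  by_contra hne
  obtain ⟨R, hXR, hRQ', hR, hRX⟩ := exists_card_sq_ge hXQ' hX hQ'
  have h1 := hA.centralizer_le_normalizer37 hX hXQ hQX hQ
  have h2 : R ≤ Q := (hA.isSyl37_of_le hQ hQX).ge_of_le_normalizer h1 (isPGroup_of_card hR) hRX
  exact hA.not_sq_dvd_inf hQ hQ' hne (hR ▸ Subgroup.card_dvd_of_le (le_inf hRQ' h2))

/-- Distinct Sylow `37`-subgroups intersect trivially. -/
lemma Arith.inf_eq_bot (hA : Arith G) {Q Q' : Subgroup G} (hQ : Nat.card Q = 37 ^ 3)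
    (hQ' : Nat.card Q' = 37 ^ 3) (hne : Q' ≠ Q) : Q' ⊓ Q = ⊥ := by
  by_contra hb
  have h2 := hA.not_sq_dvd_inf hQ hQ' hne
  obtain ⟨k, hk, hc⟩ := card_eq_pow_of_le (by norm_num) hQ (inf_le_right : Q' ⊓ Q ≤ Q)
  have hk1 : k = 1 := by
    have : k ≠ 0 := by
      rintro rfl
      exact hb (Subgroup.card_eq_one.1 hc)
    have : ¬ 2 ≤ k := fun h => h2 (hc ▸ pow_dvd_pow 37 h)
    omega
  rw [hk1, pow_one] at hc
  set X := Q' ⊓ Q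
  have hXp : IsPGroup 37 X := isPGroup_of_card (n := 1) (by simpa using hc)
  have hXb : X ≠ ⊥ := hb
  obtain ⟨R, hXR, hRQ, hR, hRX⟩ := exists_card_sq_ge (inf_le_right : X ≤ Q) hc hQ
  obtain ⟨R', hXR', hRQ', hR', hRX'⟩ := exists_card_sq_ge (inf_le_left : X ≤ Q') hc hQ'
  have hn3 : ¬ 37 ^ 3 ∣ Nat.card C(X) := by
    intro h3
    obtain ⟨Q'', hXQ'', hQ''⟩ := exists_isSyl_ge hXp (le_centralizer_of_card hc)
    have hQ''c : Nat.card Q'' = 37 ^ 3 := hQ''.card h3 (hA.not_37_pow_four _)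
    have e1 := hA.eq_of_central hc hQ''c hQ hXQ'' hQ''.le inf_le_right
    have e2 := hA.eq_of_central hc hQ''c hQ' hXQ'' hQ''.le inf_le_left
    exact hne (e2.trans e1.symm)
  have hS : IsSyl 37 R C(X) := isSyl_of_card hR hRX hn3
  have hS' : IsSyl 37 R' C(X) := isSyl_of_card hR' hRX' hn3
  have hn := hS.numSyl37 (hA.card_centralizer_dvd (by simp) hXp hXb)
  have h19 : 19 ∣ Nat.card C(X) := by
    refine Dvd.dvd.trans ?_ (Subgroup.relIndex_dvd_card N(R) C(X))
    simp only [Finset.mem_insert, Finset.mem_singleton] at hn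
    rcases hn with hn | hn | hn
    · exfalso
      rw [Subgroup.relIndex_eq_one] at hn
      have := hS.ge_of_le_normalizer hn hS'.isPGroup hRX'
      have h3 : R' ≤ X := le_inf hRQ' (this.trans hRQ)
      have := Subgroup.card_le_of_le h3
      rw [hR', hc] at this
      norm_num at this
    · rw [hn]; norm_num
    · rw [hn]; norm_num
  obtain ⟨Y, hYX, hY⟩ := exists_isPGroup_of_dvd h19
  obtain ⟨h4, -⟩ := hA.normalizer_le19 (i := 1) (by simpa using hc) (by norm_num)
    (le_centralizer_of_card hc) hn3 hY hYX
  have h5 := le_centralizer37 hS.isPGroup hY (hRX.trans h4)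
  exact hA.not_19_dvd_centralizer hR (hY ▸ Subgroup.card_dvd_of_le (le_centralizer_comm h5))

end Local

section Action
variable {G : Type*} [Group G] [Finite G]

lemma Arith.card_sylow37 (hA : Arith G) (p : Sylow 37 G) : Nat.card p = 37 ^ 3 := by
  have := p.card_eq_multiplicity
  rw [hA.card] at this
  rw [this]
  congr 1
  rw [show 2 ^ 4 * 3 ^ 2 * 19 ^ 2 * 31 * 37 ^ 3 * 43 = 37 ^ 3 *
      (2 ^ 4 * 3 ^ 2 * 19 ^ 2 * 31 * 43) by norm_num,
    Nat.factorization_mul (by norm_num) (by norm_num), Nat.Prime.factorization_pow (by norm_num)]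
  simp [Nat.factorization_eq_zero_of_not_dvd]

omit [Finite G] in
lemma mem_normalizer_iff_smul {p : Sylow 37 G} {g : G} : g ∈ N((p : Subgroup G)) ↔ g • p = p :=
  Sylow.smul_eq_iff_mem_normalizer.symm

omit [Finite G] in
lemma smul_self_of_mem {p : Sylow 37 G} {g : G} (hg : g ∈ p) : g • p = p :=
  mem_normalizer_iff_smul.1 (Subgroup.le_normalizer hg)

omit [Finite G] in
lemma mem_smul_sylow {p : Sylow 37 G} {g u : G} : u ∈ g • p ↔ g⁻¹ * u * g ∈ p :=
  mem_conj_iff (H := (p : Subgroup G))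

lemma Arith.eq_one_of_smul_eq (hA : Arith G) {p q : Sylow 37 G} (hqp : q ≠ p) {u : G} (hu : u ∈ p)
    (h : u • q = q) : u = 1 := by
  have h1 : u ∈ N((q : Subgroup G)) ⊓ (p : Subgroup G) := ⟨mem_normalizer_iff_smul.2 h, hu⟩
  have hq := hA.isSyl37 (hA.card_sylow37 q)
  rw [hq.inf_normalizer p.isPGroup' le_top,
    hA.inf_eq_bot (hA.card_sylow37 p) (hA.card_sylow37 q) (fun h => hqp (Sylow.ext h))] at h1
  exact h1

lemma Arith.card_normalizer (hA : Arith G) (p : Sylow 37 G) :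
    Nat.card N((p : Subgroup G)) = 37 ^ 3 * 1368 := by
  obtain ⟨X, Y, h⟩ := hA.config (hA.card_sylow37 p)
  exact h.card_normalizer hA

lemma Arith.card_sylow (hA : Arith G) : Nat.card (Sylow 37 G) = 37 ^ 3 + 1 := by
  have p : Sylow 37 G := default
  have h1 := N((p : Subgroup G)).index_mul_card
  have h2 : Nat.card (Sylow 37 G) = N((p : Subgroup G)).index := p.card_eq_index_normalizer
  rw [← h2, hA.card_normalizer p, hA.card] at h1
  omega

lemma Arith.exists_smul_eq (hA : Arith G) {p q r : Sylow 37 G} (hq : q ≠ p) (hr : r ≠ p) :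
    ∃ u ∈ p, u • q = r := by
  have hf : ∀ u : p, (u : G) • q ≠ p := fun u h => hq
    (smul_left_cancel (u : G) (h.trans (smul_self_of_mem u.2).symm))
  let f : p → {r : Sylow 37 G // r ≠ p} := fun u => ⟨(u : G) • q, hf u⟩
  have hinj : Function.Injective f := by
    intro u v h
    have h1 : (u : G) • q = (v : G) • q := congrArg Subtype.val h
    have h2 := hA.eq_one_of_smul_eq hq (p.mul_mem (p.inv_mem v.2) u.2)
      (by rw [mul_smul, h1, inv_smul_smul])
    exact Subtype.ext (inv_mul_eq_one.1 h2).symm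
  have hcard : Nat.card {r : Sylow 37 G // r ≠ p} ≤ Nat.card p := by
    classical
    have _ := Fintype.ofFinite (Sylow 37 G)
    have h1 := hA.card_sylow
    rw [Nat.card_eq_fintype_card] at h1
    rw [Nat.card_eq_fintype_card, Fintype.card_subtype_compl, Fintype.card_subtype_eq,
      h1, hA.card_sylow37 p]
    simp
  obtain ⟨u, hu⟩ := (Function.Injective.bijective_of_nat_card_le hinj hcard).2 ⟨r, hr⟩
  exact ⟨u, u.2, congrArg Subtype.val hu⟩

lemma Arith.exists_commute (hA : Arith G) {p q r : Sylow 37 G} (hq : q ≠ p) (hr : r ≠ p)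
    {S : Set G} (hpS : ∀ g ∈ S, g • p = p) (hqS : ∀ g ∈ S, g • q = q) (hrS : ∀ g ∈ S, g • r = r) :
    ∃ u ∈ (p : Subgroup G) ⊓ Subgroup.centralizer S, u • q = r := by
  obtain ⟨u, hu, huq⟩ := hA.exists_smul_eq hq hr
  refine ⟨u, ⟨hu, ?_⟩, huq⟩
  refine Subgroup.mem_centralizer_iff.2 fun g hg => ?_
  have h1 : g⁻¹ * u * g ∈ p := by
    rw [← mem_smul_sylow, hpS g hg]; exact hu
  have h2 : u⁻¹ * (g⁻¹ * u * g) = 1 := by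
    refine hA.eq_one_of_smul_eq hq (p.mul_mem (p.inv_mem hu) h1) ?_
    simp only [mul_smul]
    rw [hqS g hg, huq, inv_smul_eq_iff.2 (hrS g hg).symm, ← huq, inv_smul_smul]
  have h3 : g⁻¹ * u * g = u := (inv_mul_eq_one.1 h2).symm
  calc g * u = g * (g⁻¹ * u * g) := by rw [h3]
    _ = u * g := by group

/-- A nontrivial normal subgroup has order divisible by `31`. -/
lemma Arith.dvd_card_of_normal (hA : Arith G) (R : Subgroup G) [R.Normal] (hR : R ≠ ⊥) :
    31 ∣ Nat.card R ∨ 43 ∣ Nat.card R := by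
  have h1 : Nat.card R ≠ 1 := fun h => hR (Subgroup.card_eq_one.1 h)
  obtain ⟨r, hr, hrR⟩ := Nat.exists_prime_and_dvd h1
  have := Fact.mk hr
  by_contra! hcon
  have hr' : r ∈ ({2, 3, 19, 37} : Set ℕ) := by
    have h2 := hrR.trans (Subgroup.card_subgroup_dvd_card R)
    rw [hA.card] at h2
    have h31 : r ≠ 31 := by rintro rfl; exact hcon.1 hrR
    have h43 : r ≠ 43 := by rintro rfl; exact hcon.2 hrR
    simp only [hr.dvd_mul] at h2
    have key : ∀ {q n : ℕ}, q.Prime → r ∣ q ^ n → r = q := fun hq h =>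
      (Nat.prime_dvd_prime_iff_eq hr hq).1 (hr.dvd_of_dvd_pow h)
    simp only [Set.mem_insert_iff, Set.mem_singleton_iff]
    rcases h2 with ((((h2 | h2) | h2) | h2) | h2) | h2
    · exact Or.inl (key (by norm_num) h2)
    · exact Or.inr (Or.inl (key (by norm_num) h2))
    · exact Or.inr (Or.inr (Or.inl (key (by norm_num) h2)))
    · exact absurd ((Nat.prime_dvd_prime_iff_eq hr (by norm_num)).1 h2) h31
    · exact Or.inr (Or.inr (Or.inr (key (by norm_num) h2)))
    · exact absurd ((Nat.prime_dvd_prime_iff_eq hr (by norm_num)).1 h2) h43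
  let P : Sylow r R := default
  set P' : Subgroup G := (P : Subgroup R).map R.subtype
  have hsup : N(P') ⊔ R = ⊤ := Sylow.normalizer_sup_eq_top P
  have hP'p : IsPGroup r P' := P.isPGroup'.map _
  have hP'b : P' ≠ ⊥ := by
    intro h
    have h2 := P.dvd_card_of_dvd_card hrR
    rw [(Subgroup.map_eq_bot_iff_of_injective _ R.subtype_injective).1 h, Subgroup.card_bot] at h2
    exact hr.one_lt.ne' (Nat.dvd_one.1 h2)
  have h2 := hA.not_dvd_normalizer hr' hP'p hP'b (Or.inl rfl : (31 = 31 ∨ 31 = 43))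
  have h3 : Nat.card G ∣ Nat.card N(P') * Nat.card R := by
    have h4 := relIndex_mul_card_of_le R ⊤ le_top
    rw [← hsup, Subgroup.relIndex_sup_right, hsup, Subgroup.card_top] at h4
    rw [← h4]
    exact Nat.mul_dvd_mul_right (Subgroup.relIndex_dvd_card _ _) _
  have h31 : 31 ∣ Nat.card N(P') * Nat.card R :=
    Dvd.dvd.trans (by rw [hA.card]; norm_num) h3
  rcases (Nat.Prime.dvd_mul (by norm_num)).1 h31 with h | h
  · exact h2 h
  · exact hcon.1 h

lemma Arith.eq_one_of_forall_smul (hA : Arith G) {g : G} (h : ∀ p : Sylow 37 G, g • p = p) :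
    g = 1 := by
  set R := (MulAction.toPermHom G (Sylow 37 G)).ker
  have hg : g ∈ R := by
    rw [MonoidHom.mem_ker]
    ext1 p
    exact h p
  by_contra hne
  have hR : R ≠ ⊥ := fun hb => hne (by rwa [hb, Subgroup.mem_bot] at hg)
  let p : Sylow 37 G := default
  have hle : R ≤ N((p : Subgroup G)) := by
    intro x hx
    rw [mem_normalizer_iff_smul]
    exact congrArg (fun σ : Equiv.Perm (Sylow 37 G) => σ p) (MonoidHom.mem_ker.1 hx)
  have h2 := Subgroup.card_dvd_of_le hle
  rw [hA.card_normalizer] at h2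
  rcases hA.dvd_card_of_normal R hR with h3 | h3
  · have := h3.trans h2; revert this; norm_num
  · have := h3.trans h2; revert this; norm_num

end Action

section TwoPoint
variable {G : Type*} [Group G]

/-- The stabilizer of two Sylow `37`-subgroups. -/
def twoPt (p o : Sylow 37 G) : Subgroup G := N((p : Subgroup G)) ⊓ N((o : Subgroup G))

lemma mem_twoPt {p o : Sylow 37 G} {g : G} : g ∈ twoPt p o ↔ g • p = p ∧ g • o = o := by
  rw [twoPt, Subgroup.mem_inf, mem_normalizer_iff_smul, mem_normalizer_iff_smul]

variable [Finite G]

lemma Arith.exists_mul_twoPt (hA : Arith G) {p o : Sylow 37 G} (h : o ≠ p) {g : G}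
    (hg : g • p = p) :
    ∃ u ∈ p, ∃ k ∈ twoPt p o, g = u * k := by
  have h1 : g • o ≠ p := fun h2 => h (smul_left_cancel g (h2.trans hg.symm))
  obtain ⟨u, hu, huo⟩ := hA.exists_smul_eq h h1
  refine ⟨u, hu, u⁻¹ * g, mem_twoPt.2 ⟨?_, ?_⟩, by group⟩
  · rw [mul_smul, hg, smul_self_of_mem (p.inv_mem hu)]
  · rw [mul_smul, ← huo, inv_smul_smul]

lemma Arith.disjoint_twoPt (hA : Arith G) {p o : Sylow 37 G} (h : o ≠ p) {u : G} (hu : u ∈ p)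
    (hk : u ∈ twoPt p o) : u = 1 :=
  hA.eq_one_of_smul_eq h hu (mem_twoPt.1 hk).2

lemma Arith.card_twoPt (hA : Arith G) {p o : Sylow 37 G} (h : o ≠ p) :
    Nat.card (twoPt p o) = 1368 := by
  let f : p × twoPt p o → N((p : Subgroup G)) := fun x => ⟨x.1 * x.2,
    Subgroup.mul_mem _ (Subgroup.le_normalizer x.1.2) x.2.2.1⟩
  have hf : Function.Bijective f := by
    constructor
    · rintro ⟨u, k⟩ ⟨v, l⟩ hfe
      have h1 : (u : G) * k = v * l := congrArg Subtype.val hfe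
      have h2 : (v : G)⁻¹ * u = l * (k : G)⁻¹ := by
        rw [eq_mul_inv_iff_mul_eq, mul_assoc, h1]; group
      have h3 : (v : G)⁻¹ * u = 1 := hA.disjoint_twoPt h (p.mul_mem (p.inv_mem v.2) u.2)
        (h2 ▸ Subgroup.mul_mem _ l.2 (Subgroup.inv_mem _ k.2))
      have h4 : (l : G) * (k : G)⁻¹ = 1 := h2.symm.trans h3
      rw [Prod.mk.injEq]
      exact ⟨Subtype.ext (inv_mul_eq_one.1 h3).symm, Subtype.ext (mul_inv_eq_one.1 h4).symm⟩
    · rintro ⟨g, hg⟩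
      obtain ⟨u, hu, k, hk, rfl⟩ := hA.exists_mul_twoPt h (mem_normalizer_iff_smul.1 hg)
      exact ⟨⟨⟨u, hu⟩, ⟨k, hk⟩⟩, rfl⟩
  have h1 := Nat.card_congr (Equiv.ofBijective f hf)
  rw [Nat.card_prod, hA.card_sylow37, hA.card_normalizer] at h1
  exact Nat.eq_of_mul_eq_mul_left (by norm_num) h1

lemma Arith.eq_one_of_forall_commute (hA : Arith G) {p o : Sylow 37 G} (h : o ≠ p) {k : G}
    (hk : k ∈ twoPt p o) (hc : ∀ u ∈ p, k * u = u * k) : k = 1 := by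
  rw [mem_twoPt] at hk
  refine hA.eq_one_of_forall_smul fun q => ?_
  by_cases hq : q = p
  · rw [hq, hk.1]
  · obtain ⟨u, hu, rfl⟩ := hA.exists_smul_eq h hq
    rw [← mul_smul, hc u hu, mul_smul, hk.2]

lemma Arith.card_centralizer_ne (hA : Arith G) {p o : Sylow 37 G} (h : o ≠ p) {k : G}
    (hk : k ∈ twoPt p o) :
    Nat.card ↥((p : Subgroup G) ⊓ Subgroup.centralizer {k}) ≠ 37 ^ 2 := by
  intro hcard
  rw [mem_twoPt] at hk
  set D := (p : Subgroup G) ⊓ Subgroup.centralizer {k}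
  set C := Subgroup.centralizer {k}
  have hC : ∀ c : C, (c : G) * k = k * c := fun c => (Subgroup.mem_centralizer_iff.1 c.2 k rfl).symm
  have hCq : ∀ {q : Sylow 37 G}, k • q = q → ∀ {g}, g ∈ ({k} : Set G) → g • q = q := by
    rintro q hq g rfl; exact hq
  have hDinj : Set.InjOn (fun u : G => u • o) (D : Set G) := by
    intro u hu v hv huv
    refine (inv_mul_eq_one.1 (hA.eq_one_of_smul_eq h (p.mul_mem (p.inv_mem hv.1) hu.1) ?_)).symm
    rw [mul_smul, inv_smul_eq_iff]
    exact huv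
  have hDp : ∀ u ∈ D, u • o ≠ p := fun u hu h' =>
    h (smul_left_cancel u (h'.trans (smul_self_of_mem hu.1).symm))
  have hDk : ∀ u ∈ D, k • u • o = u • o := by
    intro u hu
    rw [← mul_smul, ← hC ⟨u, hu.2⟩, mul_smul, hk.2]
  have horb : MulAction.orbit C o = insert p ((fun u : G => u • o) '' (D : Set G)) := by
    ext q
    constructor
    · rintro ⟨c, rfl⟩
      by_cases hq : (c : G) • o = p
      · exact Or.inl hq
      · obtain ⟨u, hu, huo⟩ := hA.exists_commute h hq (S := {k}) (fun _ => hCq hk.1)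
          (fun _ => hCq hk.2) (fun _ => hCq (by rw [← mul_smul, ← hC, mul_smul, hk.2]))
        exact Or.inr ⟨u, hu, huo⟩
    · rintro (rfl | ⟨u, hu, rfl⟩)
      · have : 1 < Nat.card D := by rw [hcard]; norm_num
        rw [Finite.one_lt_card_iff_nontrivial] at this
        obtain ⟨⟨u, hu⟩, hu1⟩ := exists_ne (1 : D)
        have hu1 : u ≠ 1 := fun h => hu1 (Subtype.ext h)
        have hne : o ≠ u • o := fun h' => hu1 (hA.eq_one_of_smul_eq h hu.1 h'.symm)
        obtain ⟨c, hc, hco⟩ := hA.exists_commute hne (hDp u hu).symm (S := {k})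
          (fun _ => hCq (hDk u hu)) (fun _ => hCq hk.2) (fun _ => hCq hk.1)
        exact ⟨⟨c, hc.2⟩, hco⟩
      · exact ⟨⟨u, hu.2⟩, rfl⟩
  have hn : (MulAction.orbit C o).ncard = 1370 := by
    rw [horb, Set.ncard_insert_of_notMem, hDinj.ncard_image, ← Nat.card_coe_set_eq]
    · exact congrArg (· + 1) hcard
    · rintro ⟨u, hu, huo⟩
      exact hDp u hu huo
  have h2 := card_orbit_mul_card_stabilizer (H := C) o
  rw [Nat.card_coe_set_eq, hn] at h2
  have h3 := (Dvd.intro _ h2).trans (Subgroup.card_subgroup_dvd_card C)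
  rw [hA.card] at h3
  revert h3; norm_num

/-- A configuration together with a second Sylow subgroup fixed by `Y`. -/
structure Frame (p o : Sylow 37 G) (X Y : Subgroup G) : Prop where
  cfg : Config (p : Subgroup G) X Y
  ne : o ≠ p
  Yo : Y ≤ N((o : Subgroup G))

lemma Arith.exists_frame (hA : Arith G) : ∃ (p o : Sylow 37 G) (X Y : Subgroup G), Frame p o X Y := by
  let p : Sylow 37 G := default
  obtain ⟨X, Y, hc⟩ := hA.config (hA.card_sylow37 p)
  by_contra! hcon
  have h1 : 19 ∣ ({q | IsSyl 37 q (⊤ : Subgroup G)} \ {(p : Subgroup G)}).ncard := by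
    refine dvd_ncard_of_conj Y _ ?_ ?_
    · rintro y hy q ⟨hq1, hq2⟩
      refine ⟨hq1.conj (Subgroup.le_normalizer (Subgroup.mem_top y)), fun h => hq2 ?_⟩
      rw [Set.mem_singleton_iff] at h ⊢
      rw [← inv_smul_eq_iff.2 h.symm, ← map_inv]
      exact conj_eq_iff.2 (hc.YQ (Y.inv_mem hy))
    · rintro q ⟨hq1, hq2⟩
      have hd : N(q).relIndex Y ∣ 19 := hc.cardY ▸ Subgroup.relIndex_dvd_card _ _
      rcases (Nat.dvd_prime (by norm_num)).1 hd with h2 | h2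
      · exfalso
        rw [Subgroup.relIndex_eq_one] at h2
        obtain ⟨g, -, rfl⟩ := (hA.isSyl37 hc.cardQ).exists_conj hq1
        exact hcon p (g • p) X Y ⟨hc, fun h => hq2 (congrArg
            (fun s : Sylow 37 G => (s : Subgroup G)) h), h2⟩
      · rw [h2]
  rw [Set.ncard_sdiff_singleton_of_mem (show (p : Subgroup G) ∈ {q | IsSyl 37 q
      (⊤ : Subgroup G)} from
    hA.isSyl37 hc.cardQ), hc.ncard_isSyl hA] at h1
  revert h1; norm_num

end TwoPoint

section Frame
variable {G : Type*} [Group G] {p o : Sylow 37 G} {X Y : Subgroup G}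

lemma Frame.commute (h : Frame p o X Y) {u x : G} (hu : u ∈ p) (hx : x ∈ X) : x * u = u * x :=
  Subgroup.mem_centralizer_iff.1 (h.cfg.QX hu) x hx

lemma Frame.Y_le (h : Frame p o X Y) : Y ≤ twoPt p o := le_inf h.cfg.YQ h.Yo

lemma conj_mem_of_mem_twoPt {k u : G} (hk : k ∈ twoPt p o) (hu : u ∈ p) : k * u * k⁻¹ ∈ p := by
  rw [← (mem_twoPt.1 hk).1, mem_smul_sylow]
  simpa [mul_assoc] using hu

variable [Finite G]

lemma Frame.inf_centralizer (hA : Arith G) (h : Frame p o X Y) : (p : Subgroup G) ⊓ C(Y) = X := by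
  symm
  refine Subgroup.eq_of_le_of_card_ge (le_inf h.cfg.XQ (le_centralizer_comm h.cfg.YX)) ?_
  have h1 := card_inf_centralizer_mod (isPGroup_of_card (p := 19) (n := 1)
      (by simpa using h.cfg.cardY))
    h.cfg.YQ
  obtain ⟨k, hk, hc⟩ := card_eq_pow_of_le (by norm_num) h.cfg.cardQ
    (inf_le_left : (p : Subgroup G) ⊓ C(Y) ≤ p)
  rw [h.cfg.cardQ, hc] at h1
  rw [hc, h.cfg.cardX]
  interval_cases k
  · norm_num
  · norm_num
  · revert h1; decide
  · exfalso
    have h2 : (p : Subgroup G) ≤ C(Y) := le_of_card_inf (by rw [hc, h.cfg.cardQ])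
    exact hA.not_19_dvd_centralizer_sylow (hA.isSyl37 h.cfg.cardQ)
      (h.cfg.cardY ▸ Subgroup.card_dvd_of_le (le_centralizer_comm h2))

lemma Frame.twoPt_le_normalizer (hA : Arith G) (h : Frame p o X Y) : twoPt p o ≤ N(Y) := by
  have hK := hA.card_twoPt h.ne
  have hS : IsSyl 19 Y (twoPt p o) := isSyl_of_card (n := 1) (by simpa using h.cfg.cardY) h.Y_le
    (by rw [hK]; norm_num)
  have h1 := hS.numSyl19 (by rw [hK]; norm_num [N1])
  have h2 : N(Y).relIndex (twoPt p o) ∣ 1368 := hK ▸ Subgroup.relIndex_dvd_card _ _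
  simp only [Finset.mem_insert, Finset.mem_singleton] at h1
  rcases h1 with h1 | h1 | h1 | h1
  · rwa [Subgroup.relIndex_eq_one] at h1
  all_goals rw [h1] at h2; revert h2; norm_num

lemma Frame.twoPt_le_normalizer_X (hA : Arith G) (h : Frame p o X Y) : twoPt p o ≤ N(X) := by
  intro k hk
  have h1 := conj_eq_iff.2 (h.twoPt_le_normalizer hA hk)
  rw [← conj_eq_iff, ← h.inf_centralizer hA, Subgroup.smul_inf, conj_centralizer, h1,
    conj_eq_iff.2 hk.1]

lemma Frame.card_centralizer_le (hA : Arith G) (h : Frame p o X Y) {k : G} (hk : k ∈ twoPt p o)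
    (hk1 : k ≠ 1) : Nat.card ↥((p : Subgroup G) ⊓ Subgroup.centralizer {k}) ≤ 37 := by
  obtain ⟨n, hn, hc⟩ := card_eq_pow_of_le (by norm_num) h.cfg.cardQ
    (inf_le_left : (p : Subgroup G) ⊓ Subgroup.centralizer {k} ≤ p)
  have h2 := hA.card_centralizer_ne h.ne hk
  rw [hc] at h2 ⊢
  interval_cases n
  · norm_num
  · norm_num
  · exact absurd rfl h2
  · exfalso
    have h3 : (p : Subgroup G) ≤ Subgroup.centralizer {k} :=
      le_of_card_inf (by rw [hc, h.cfg.cardQ])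
    exact hk1 (hA.eq_one_of_forall_commute h.ne hk fun u hu =>
      Subgroup.mem_centralizer_iff.1 (h3 hu) k rfl)

lemma Frame.inf_centralizer_singleton (hA : Arith G) (h : Frame p o X Y) {k : G}
    (hk : k ∈ twoPt p o) (hkX : k ∈ C(X)) (hk1 : k ≠ 1) :
    (p : Subgroup G) ⊓ Subgroup.centralizer {k} = X := by
  symm
  refine Subgroup.eq_of_le_of_card_ge (le_inf h.cfg.XQ fun x hx => ?_)
    (by rw [h.cfg.cardX]; exact h.card_centralizer_le hA hk hk1)
  rw [Subgroup.mem_centralizer_iff]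
  rintro _ rfl
  exact (Subgroup.mem_centralizer_iff.1 hkX x hx).symm

omit [Finite G] in
lemma Frame.eq_one_of_mem_X_of_pow (h : Frame p o X Y) {x : G} (hx : x ∈ X) {n : ℕ}
    (hn : ¬ 37 ∣ n) (hxn : x ^ n = 1) : x = 1 := by
  rw [← orderOf_eq_one_iff]
  have h1 : orderOf x ∣ 37 := h.cfg.cardX ▸ Subgroup.orderOf_dvd_natCard X hx
  rcases (Nat.dvd_prime (by norm_num)).1 h1 with h2 | h2
  · exact h2
  · exact absurd (h2 ▸ orderOf_dvd_of_pow_eq_one hxn) hn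

lemma Frame.eq_one_of_forall_mem (hA : Arith G) (h : Frame p o X Y) {k : G}
    (hk : k ∈ twoPt p o) (hkX : k ∈ C(X)) (hkp : ∀ u ∈ p, u⁻¹ * (k * u * k⁻¹) ∈ X) : k = 1 := by
  refine hA.eq_one_of_forall_commute h.ne hk fun u hu => ?_
  set z := u⁻¹ * (k * u * k⁻¹) with hz
  have hkz : k * z = z * k := (Subgroup.mem_centralizer_iff.1 hkX z (hkp u hu)).symm
  have h1 : k * u = u * z * k := by rw [hz]; group
  have h2 : ∀ n : ℕ, k ^ n * u = u * z ^ n * k ^ n := by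
    intro n
    induction n with
    | zero => simp
    | succ n ih =>
      have h3 : Commute (k ^ n) z := Commute.pow_left hkz n
      calc k ^ (n + 1) * u = k ^ n * (k * u) := by rw [pow_succ]; group
        _ = (k ^ n * u) * z * k := by rw [h1]; group
        _ = u * z ^ n * (k ^ n * z) * k := by rw [ih]; group
        _ = u * z ^ n * (z * k ^ n) * k := by rw [h3.eq]
        _ = u * z ^ (n + 1) * k ^ (n + 1) := by rw [pow_succ, pow_succ]; group
  have h3 := h2 (orderOf k)
  rw [pow_orderOf_eq_one, one_mul, mul_one, left_eq_mul] at h3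
  have hd : orderOf k ∣ 1368 := hA.card_twoPt h.ne ▸ Subgroup.orderOf_dvd_natCard _ hk
  have hz1 : z = 1 := h.eq_one_of_mem_X_of_pow (hkp u hu)
    (fun h37 => by have := h37.trans hd; revert this; norm_num) h3
  rw [h1, hz1, mul_one]

/-- An involution of the two-point stabilizer centralizing `X`. -/
structure Frame.Invo (p o : Sylow 37 G) (X : Subgroup G) (t : G) : Prop where
  mem : t ∈ twoPt p o
  tX : t ∈ C(X)
  ne : t ≠ 1
  sq : t * t = 1

lemma Frame.exists_invo (hA : Arith G) (h : Frame p o X Y) : ∃ t, Frame.Invo p o X t := by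
  have h1 := relIndex_mul_card_inf C(X) (twoPt p o)
  rw [hA.card_twoPt h.ne] at h1
  have h2 : C(X).relIndex (twoPt p o) ∣ 36 := by
    rw [← Subgroup.relIndex_subgroupOf (h.twoPt_le_normalizer_X hA)]
    exact (Subgroup.relIndex_dvd_index_of_normal _ _).trans
      (relIndex_centralizer_dvd (by norm_num) h.cfg.cardX)
  have h3 : 2 ∣ Nat.card ↥(C(X) ⊓ twoPt p o) := by
    obtain ⟨c, hc⟩ := h2
    have : C(X).relIndex (twoPt p o) * Nat.card ↥(C(X) ⊓ twoPt p o) =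
      C(X).relIndex (twoPt p o) * (c * 38) := by
      rw [h1, ← mul_assoc, ← hc]; norm_num
    have h4 : 0 < C(X).relIndex (twoPt p o) := by
      by_contra! h0
      rw [Nat.le_zero.1 h0] at hc; omega
    rw [Nat.eq_of_mul_eq_mul_left h4 this]
    exact Dvd.intro_left (c * 19) (by ring)
  obtain ⟨t, ht⟩ := exists_prime_orderOf_dvd_card' 2 h3
  refine ⟨t, t.2.2, t.2.1, ?_, ?_⟩
  · intro h1
    rw [OneMemClass.coe_eq_one.1 h1, orderOf_one] at ht
    norm_num at ht
  · have := pow_orderOf_eq_one t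
    rw [ht, pow_two] at this
    exact congrArg Subtype.val this

omit [Finite G] in
lemma Frame.Invo.inv {t : G} (ht : Frame.Invo p o X t) : t⁻¹ = t := inv_eq_of_mul_eq_one_right ht.sq

lemma Frame.Invo.inf_centralizer {t : G} (hA : Arith G) (h : Frame p o X Y)
    (ht : Frame.Invo p o X t) :
    (p : Subgroup G) ⊓ Subgroup.centralizer {t} = X :=
  h.inf_centralizer_singleton hA ht.mem ht.tX ht.ne

omit [Finite G] in
lemma Frame.Invo.conj_conj {t : G} (ht : Frame.Invo p o X t) (u : G) : t * (t * u * t) * t = u := by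
  calc t * (t * u * t) * t = (t * t) * u * (t * t) := by group
    _ = u := by rw [ht.sq]; group

omit [Finite G] in
lemma Frame.Invo.conj_mem {t : G} (ht : Frame.Invo p o X t) {u : G} (hu : u ∈ p) : t * u * t ∈ p := by
  have := conj_mem_of_mem_twoPt ht.mem hu
  rwa [ht.inv] at this

omit [Finite G] in
lemma Frame.Invo.conj_X {t : G} (ht : Frame.Invo p o X t) {x : G} (hx : x ∈ X) : t * x * t = x := by
  rw [← Subgroup.mem_centralizer_iff.1 ht.tX x hx, mul_assoc, ht.sq, mul_one]

lemma Frame.Invo.exists_mul {t : G} (hA : Arith G) (h : Frame p o X Y) (ht : Frame.Invo p o X t)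
    {u : G} (hu : u ∈ p) : ∃ i ∈ p, t * i * t = i⁻¹ ∧ ∃ x ∈ X, u = i * x := by
  let X' := X.subgroupOf (p : Subgroup G)
  let d : p → G := fun u => u * (t * u * t)⁻¹
  have hdp : ∀ u, d u ∈ p := fun u => p.mul_mem u.2 (p.inv_mem (ht.conj_mem u.2))
  have hdi : ∀ u, t * d u * t = (d u)⁻¹ := fun u => by
    have e1 : t * d u * t = (t * u * t) * (t * (t * u * t) * t)⁻¹ := by
      simp only [d, mul_inv_rev, ht.inv]
      calc _ = t * u * 1 * (t * (u : G)⁻¹ * t) * t := by group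
        _ = _ := by rw [← ht.sq]; group
    rw [e1, ht.conj_conj]; simp [d]
  let g : (p ⧸ X') × X → p := fun c => ⟨d c.1.out * c.2, p.mul_mem (hdp _) (h.cfg.XQ c.2.2)⟩
  have hg : Function.Injective g := by
    rintro ⟨c, x⟩ ⟨c', y⟩ hcc
    have h1 : d c.out * x = d c'.out * y := congrArg Subtype.val hcc
    have h2 : d c.out = d c'.out * (y * (x : G)⁻¹) := by rw [← mul_assoc, ← h1]; group
    set z : G := y * (x : G)⁻¹ with hz
    have hzX : z ∈ X := X.mul_mem y.2 (X.inv_mem x.2)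
    have h3 : z ^ 2 = 1 := by
      have h4 : (d c.out)⁻¹ = (d c'.out)⁻¹ * z := by
        rw [← hdi, ← hdi, h2]
        calc _ = t * d c'.out * 1 * (z * t) := by group
          _ = t * d c'.out * t * (t * z * t) := by rw [← ht.sq]; group
          _ = _ := by rw [ht.conj_X hzX]
      rw [h2, mul_inv_rev, h.commute (p.inv_mem (hdp _)) (X.inv_mem hzX)] at h4
      rw [pow_two]
      exact mul_eq_one_iff_inv_eq.2 (mul_left_cancel h4)
    have h4 : z = 1 := h.eq_one_of_mem_X_of_pow hzX (by norm_num) h3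
    rw [h4, mul_one] at h2
    have h5 : (c'.out : G)⁻¹ * c.out ∈ X := by
      rw [← ht.inf_centralizer hA h]
      refine ⟨p.mul_mem (p.inv_mem c'.out.2) c.out.2, ?_⟩
      refine Subgroup.mem_centralizer_iff.2 ?_
      intro s hs
      rw [Set.mem_singleton_iff.1 hs]
      simp only [d] at h2
      have h6 : (c'.out : G)⁻¹ * c.out = (t * c'.out * t)⁻¹ * (t * c.out * t) := by
        rw [inv_mul_eq_iff_eq_mul, ← mul_assoc, ← h2]; group
      have h7 : (t * (c'.out : G) * t)⁻¹ * (t * c.out * t) = t * ((c'.out : G)⁻¹ * c.out) * t := by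
        simp only [mul_inv_rev, ht.inv]
        calc _ = t * (c'.out : G)⁻¹ * (t * t) * c.out * t := by group
          _ = _ := by rw [ht.sq]; group
      rw [h7] at h6
      nth_rw 1 [h6]
      rw [← mul_assoc, ← mul_assoc, ht.sq, one_mul]
    have h6 : c = c' := by
      rw [← c.out_eq', ← c'.out_eq', eq_comm]
      exact QuotientGroup.eq.2 h5
    subst h6
    rw [Prod.mk.injEq]
    exact ⟨rfl, Subtype.ext (mul_inv_eq_one.1 h4).symm⟩
  have hcard : Nat.card p ≤ Nat.card ((p ⧸ X') × X) := by
    rw [Nat.card_prod]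
    have := X'.card_eq_card_quotient_mul_card_subgroup
    rw [Nat.card_congr (Subgroup.subgroupOfEquivOfLe h.cfg.XQ).toEquiv] at this
    exact this.le
  obtain ⟨⟨c, x⟩, hc⟩ := (Function.Injective.bijective_of_nat_card_le hg hcard).2 ⟨u, hu⟩
  exact ⟨d c.out, hdp _, hdi _, x, x.2, (congrArg Subtype.val hc).symm⟩

end Frame

section Central
variable {G : Type*} [Group G]

lemma four_dvd_card_of_commute [Finite G] {H : Subgroup G} {a b : G} (ha : a ∈ H) (hb : b ∈ H)
    (ha1 : a ≠ 1) (ha2 : a * a = 1) (hb1 : b ≠ 1) (hb2 : b * b = 1) (hab : a ≠ b)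
    (hc : a * b = b * a) : 4 ∣ Nat.card H := by
  by_contra h4
  have ho : ∀ x : G, x ≠ 1 → x * x = 1 → Nat.card (Subgroup.zpowers x) = 2 ^ 1 := fun x h1 h2 => by
    rw [Nat.card_zpowers, pow_one]
    exact orderOf_eq_prime (by rw [pow_two, h2]) h1
  have hL : ∀ x ∈ H, a * x = x * a → Subgroup.zpowers x ≤ H ⊓ Subgroup.centralizer {a} :=
    fun x hx hax => by
      rw [Subgroup.zpowers_le]
      exact ⟨hx, Subgroup.mem_centralizer_iff.2 fun y hy => by rw [Set.mem_singleton_iff.1 hy, hax]⟩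
  have hS : IsSyl 2 (Subgroup.zpowers a) (H ⊓ Subgroup.centralizer {a}) :=
    isSyl_of_card (n := 1) (ho a ha1 ha2) (hL a ha rfl)
      fun h => h4 (h.trans (Subgroup.card_dvd_of_le inf_le_left))
  have hN : H ⊓ Subgroup.centralizer {a} ≤ N(Subgroup.zpowers a) := by
    refine inf_le_right.trans ((le_centralizer_comm ?_).trans
        (Subgroup.centralizer_le_normalizer _))
    rw [Subgroup.zpowers_le, Subgroup.mem_centralizer_iff]
    exact fun y hy => (Subgroup.mem_centralizer_iff.1 hy a rfl).symm
  have h1 := hS.ge_of_le_normalizer hN (isPGroup_of_card (ho b hb1 hb2)) (hL b hb hc)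
  rw [Subgroup.zpowers_le, Subgroup.mem_zpowers_iff] at h1
  obtain ⟨k, rfl⟩ := h1
  obtain ⟨m, rfl | rfl⟩ := Int.even_or_odd' k
  · exact hb1 (by rw [zpow_mul, zpow_ofNat, pow_two, ha2, one_zpow])
  · exact hab (by rw [zpow_add, zpow_mul, zpow_ofNat, pow_two, ha2, one_zpow, one_mul, zpow_one])

/-- Burnside's normal complement theorem, relative to a subgroup. -/
lemma IsSyl.exists_complement [Finite G] {p : ℕ} [Fact p.Prime] {P L : Subgroup G} (h : IsSyl p P L)
    (hN : N(P) ⊓ L ≤ C(P)) : ∃ N ≤ L, L ≤ N(N) ∧ Nat.card N * Nat.card P = Nat.card L ∧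
      ∀ H ≤ L, (Nat.card H).Coprime (Nat.card P) → H ≤ N := by
  have hT : Subgroup.normalizer ((h.toSylow : Subgroup L) : Set L) ≤
      Subgroup.centralizer ((h.toSylow : Subgroup L) : Set L) := by
    intro g hg
    rw [h.coe_toSylow] at hg ⊢
    have hg' : (g : G) ∈ N(P) := by
      rw [Subgroup.mem_normalizer_iff] at hg ⊢
      intro x
      constructor
      · intro hx
        exact (hg ⟨x, h.le hx⟩).1 hx
      · intro hx
        have hxL : x ∈ L := by
          have := L.mul_mem (L.mul_mem (L.inv_mem g.2) (h.le hx)) g.2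
          simpa [mul_assoc] using this
        exact (hg ⟨x, hxL⟩).2 hx
    have h1 := hN ⟨hg', g.2⟩
    rw [Subgroup.mem_centralizer_iff] at h1 ⊢
    exact fun x hx => Subtype.ext (h1 x hx)
  have hcard : Nat.card h.toSylow = Nat.card P :=
    Nat.card_congr (Subgroup.subgroupOfEquivOfLe h.le).toEquiv
  have hc := (MonoidHom.ker_transferSylow_isComplement' h.toSylow hT).card_mul_card
  generalize MonoidHom.transferSylow h.toSylow hT = f at hc
  refine ⟨f.ker.map L.subtype, Subgroup.map_subtype_le _, ?_, ?_, ?_⟩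
  · intro g hg
    rw [Subgroup.mem_normalizer_iff]
    have key : ∀ g ∈ L, ∀ x ∈ f.ker.map L.subtype, g * x * g⁻¹ ∈ f.ker.map L.subtype := by
      rintro g hg _ ⟨x, hx, rfl⟩
      exact ⟨_, f.normal_ker.conj_mem x hx ⟨g, hg⟩, rfl⟩
    refine fun x => ⟨key g hg x, fun hx => ?_⟩
    have := key g⁻¹ (L.inv_mem hg) _ hx
    simpa [mul_assoc] using this
  · rw [Subgroup.card_map_of_injective L.subtype_injective, ← hcard]
    exact hc
  · intro H hH hco x hx
    refine ⟨⟨x, hH hx⟩, ?_, rfl⟩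
    rw [SetLike.mem_coe, MonoidHom.mem_ker, ← orderOf_eq_one_iff]
    refine Nat.eq_one_of_dvd_coprimes hco ((orderOf_map_dvd _ _).trans ?_)
      (hcard ▸ orderOf_dvd_natCard _)
    rw [Subgroup.orderOf_mk]
    exact Subgroup.orderOf_dvd_natCard H hx

variable [Finite G] {p o : Sylow 37 G} {X Y : Subgroup G}

lemma Frame.Invo.mul_conj_mem {t : G} (hA : Arith G) (h : Frame p o X Y) (ht : Frame.Invo p o X t)
    {u : G} (hu : u ∈ p) : u * (t * u * t) ∈ X := by
  obtain ⟨i, hi, hti, x, hx, rfl⟩ := ht.exists_mul hA h hu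
  have h1 : t * (i * x) * t = i⁻¹ * x := by
    calc _ = t * i * 1 * x * t := by group
      _ = (t * i * t) * (t * x * t) := by rw [← ht.sq]; group
      _ = _ := by rw [hti, ht.conj_X hx]
  rw [h1, h.commute (p.inv_mem hi) hx |>.symm]
  have : i * x * (x * i⁻¹) = x * x := by
    rw [← h.commute hi hx]
    calc _ = x * (i * x) * i⁻¹ := by group
      _ = _ := by rw [← h.commute hi hx]; group
  rw [this]
  exact X.mul_mem hx hx

/-- The involution inverts `p` modulo `X`. -/
lemma Frame.Invo.exists_conj_eq {t : G} (hA : Arith G) (h : Frame p o X Y) (ht : Frame.Invo p o X t)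
    {u : G} (hu : u ∈ p) : ∃ z ∈ X, t * u * t = u⁻¹ * z :=
  ⟨_, ht.mul_conj_mem hA h hu, by group⟩

lemma Frame.commutator_mem (hA : Arith G) (h : Frame p o X Y) {u v : G} (hu : u ∈ p) (hv : v ∈ p) :
    u * v * u⁻¹ * v⁻¹ ∈ X := by
  obtain ⟨t, ht⟩ := h.exists_invo hA
  obtain ⟨z, hz, hzu⟩ := ht.exists_conj_eq hA h hu
  obtain ⟨y, hy, hyv⟩ := ht.exists_conj_eq hA h hv
  have h1 := ht.mul_conj_mem hA h (p.mul_mem hu hv)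
  have h2 : u * v * (t * (u * v) * t) = u * v * u⁻¹ * v⁻¹ * (z * y) := by
    calc _ = u * v * (t * u * 1 * v * t) := by group
      _ = u * v * ((t * u * t) * (t * v * t)) := by rw [← ht.sq]; group
      _ = u * v * u⁻¹ * (z * v⁻¹) * y := by rw [hzu, hyv]; group
      _ = _ := by rw [h.commute (p.inv_mem hv) hz]; group
  rw [h2] at h1
  exact (X.mul_mem_cancel_right (X.mul_mem hz hy)).1 h1

lemma Frame.Invo.eq {t t' : G} (hA : Arith G) (h : Frame p o X Y) (ht : Frame.Invo p o X t)
    (ht' : Frame.Invo p o X t') : t = t' := by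
  have h1 : t * t' = 1 := by
    refine h.eq_one_of_forall_mem hA (Subgroup.mul_mem _ ht.mem ht'.mem)
      (Subgroup.mul_mem _ ht.tX ht'.tX) fun u hu => ?_
    obtain ⟨z, hz, hzu⟩ := ht.exists_conj_eq hA h hu
    obtain ⟨y, hy, hyu⟩ := ht'.exists_conj_eq hA h hu
    have e1 : t * (u⁻¹ * y) * t = (t * u * t)⁻¹ * y := by
      calc _ = t * u⁻¹ * 1 * y * t := by group
        _ = (t * u⁻¹ * t) * (t * y * t) := by rw [← ht.sq]; group
        _ = _ := by
          rw [ht.conj_X hy]; congr 1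
          simp only [mul_inv_rev, ht.inv, mul_assoc]
    have e2 : u⁻¹ * (t * t' * u * (t * t')⁻¹) = z⁻¹ * y := by
      calc _ = u⁻¹ * (t * (t' * u * t') * t) := by rw [mul_inv_rev, ht.inv, ht'.inv]; group
        _ = u⁻¹ * z⁻¹ * u * y := by rw [hyu, e1, hzu]; group
        _ = _ := by
          rw [← h.commute (p.inv_mem hu) (X.inv_mem hz)]; group
    rw [e2]
    exact X.mul_mem (X.inv_mem hz) hy
  rw [← ht'.inv, eq_inv_of_mul_eq_one_left h1]

lemma Frame.Invo.conj_eq {t k : G} (hA : Arith G) (h : Frame p o X Y) (ht : Frame.Invo p o X t)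
    (hk : k ∈ twoPt p o) : k * t * k⁻¹ = t := by
  refine Frame.Invo.eq hA h ⟨Subgroup.mul_mem _ (Subgroup.mul_mem _ hk ht.mem)
      (Subgroup.inv_mem _ hk),
    ?_, ?_, ?_⟩ ht
  · have h1 : MulAut.conj k • C(X) = C(X) := by
      rw [conj_centralizer, conj_eq_iff.2 (h.twoPt_le_normalizer_X hA hk)]
    rw [← h1, mem_conj_iff]
    simpa [mul_assoc] using ht.tX
  · rw [Ne, conj_eq_one_iff]
    exact ht.ne
  · calc _ = k * (t * t) * k⁻¹ := by group
      _ = 1 := by rw [ht.sq]; group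

lemma Frame.Invo.commute {t k : G} (hA : Arith G) (h : Frame p o X Y) (ht : Frame.Invo p o X t)
    (hk : k ∈ twoPt p o) : k * t = t * k :=
  mul_inv_eq_iff_eq_mul.1 (ht.conj_eq hA h hk)

/-- The centralizer of a set of permutations with three fixed points is doubly transitive on the
fixed points. -/
lemma Arith.exists_commute_pair (hA : Arith G) {S : Set G} {p o e q r : Sylow 37 G}
    (hp : ∀ g ∈ S, g • p = p) (ho : ∀ g ∈ S, g • o = o) (he : ∀ g ∈ S, g • e = e) (hop : o ≠ p)
    (hep : e ≠ p) (heo : e ≠ o) (hq : ∀ g ∈ S, g • q = q) (hr : ∀ g ∈ S, g • r = r) (hqr : r ≠ q) :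
    ∃ c ∈ Subgroup.centralizer S, c • p = q ∧ c • o = r := by
  have h1 : ∃ c ∈ Subgroup.centralizer S, c • p = q := by
    by_cases h1 : q = p
    · exact ⟨1, Subgroup.one_mem _, by rw [one_smul, h1]⟩
    by_cases h2 : q = o
    · obtain ⟨c, hc, hcq⟩ := hA.exists_commute (p := e) (q := p) (r := o) hep.symm heo.symm he hp ho
      exact ⟨c, hc.2, by rw [hcq, h2]⟩
    · obtain ⟨c, hc, hcq⟩ := hA.exists_commute (p := o) (q := p) (r := q) hop.symm h2 ho hp hq
      exact ⟨c, hc.2, hcq⟩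
  obtain ⟨c, hc, hcp⟩ := h1
  have h2 : ∀ g ∈ S, g • (c • o) = c • o := fun g hg => by
    rw [← mul_smul, Subgroup.mem_centralizer_iff.1 hc g hg, mul_smul, ho g hg]
  obtain ⟨d, hd, hdo⟩ := hA.exists_commute (p := q) (q := c • o) (r := r)
    (fun h => hop (smul_left_cancel c (h.trans hcp.symm))) hqr hq h2 hr
  exact ⟨d * c, Subgroup.mul_mem _ hd.2 hc, by rw [mul_smul, hcp, smul_self_of_mem hd.1],
    by rw [mul_smul, hdo]⟩

end Central

section Torus
variable {G : Type*} [Group G] [Finite G] {p o : Sylow 37 G} {X Y : Subgroup G}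

omit [Finite G] in
lemma smul_smul_of_commute {α : Type*} [MulAction G α] {u g : G} (hc : g * u = u * g) {a : α}
    (h : g • a = a) : g • u • a = u • a := by
  rw [← mul_smul, hc, mul_smul, h]

omit [Finite G] in
lemma Frame.exists_ne_one (h : Frame p o X Y) : ∃ x ∈ X, x ≠ 1 := by
  by_contra! h1
  have h2 : X = ⊥ := (Subgroup.eq_bot_iff_forall X).2 h1
  exact ne_bot_of_card (p := 37) (n := 1) (by norm_num) (by norm_num)
      (by simpa using h.cfg.cardX) h2

/-- A set of elements of the two-point stabilizer centralizing `X` has a doubly transitive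
centralizer on its fixed points. -/
lemma Frame.exists_commute_pair (hA : Arith G) (h : Frame p o X Y) {S : Set G}
    (hS : S ⊆ twoPt p o) (hSX : S ⊆ C(X)) {q r : Sylow 37 G}
    (hq : ∀ g ∈ S, g • q = q) (hr : ∀ g ∈ S, g • r = r) (hqr : r ≠ q) :
    ∃ c ∈ Subgroup.centralizer S, c • p = q ∧ c • o = r := by
  obtain ⟨x, hx, hx1⟩ := h.exists_ne_one
  have hxp := h.cfg.XQ hx
  refine hA.exists_commute_pair (e := x • o) (fun g hg => (mem_twoPt.1 (hS hg)).1)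
    (fun g hg => (mem_twoPt.1 (hS hg)).2)
    (fun g hg => smul_smul_of_commute (Subgroup.mem_centralizer_iff.1 (hSX hg) x hx).symm
      (mem_twoPt.1 (hS hg)).2) h.ne ?_ ?_ hq hr hqr
  · exact fun hxo => h.ne (smul_left_cancel x (hxo.trans (smul_self_of_mem hxp).symm))
  · exact fun hxo => hx1 (hA.eq_one_of_smul_eq h.ne hxp hxo)

/-- If a set `S` in the two-point stabilizer has centralizer `X` in `p`, its fixed points are `p`
and the orbit of `o` under `X`. -/
lemma Frame.fixed_iff (hA : Arith G) (h : Frame p o X Y) {S : Set G}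
    (hS : S ⊆ twoPt p o) (hSX : (p : Subgroup G) ⊓ Subgroup.centralizer S = X) (q : Sylow 37 G) :
    (∀ g ∈ S, g • q = q) ↔ q = p ∨ ∃ x ∈ X, x • o = q := by
  constructor
  · intro hq
    by_cases hqp : q = p
    · exact Or.inl hqp
    · obtain ⟨u, hu, huq⟩ := hA.exists_commute h.ne hqp (fun g hg => (mem_twoPt.1 (hS hg)).1)
        (fun g hg => (mem_twoPt.1 (hS hg)).2) hq
      exact Or.inr ⟨u, hSX ▸ hu, huq⟩
  · rintro (rfl | ⟨x, hx, rfl⟩) g hg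
    · exact (mem_twoPt.1 (hS hg)).1
    · rw [← hSX] at hx
      exact smul_smul_of_commute (Subgroup.mem_centralizer_iff.1 hx.2 g hg) (mem_twoPt.1 (hS hg)).2

omit [Finite G] in
lemma Frame.Invo.singleton_subset {t : G} (ht : Frame.Invo p o X t) : ({t} : Set G) ⊆ twoPt p o :=
  Set.singleton_subset_iff.2 ht.mem

lemma Frame.Invo.normalizer_eq {t : G} (hA : Arith G) (h : Frame p o X Y)
    (ht : Frame.Invo p o X t) :
    N(Y) = Subgroup.centralizer {t} := by
  have hfix : ∀ q : Sylow 37 G, (∀ g ∈ Y, g • q = q) ↔ t • q = q := fun q => by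
    have h2 := h.fixed_iff hA ht.singleton_subset (ht.inf_centralizer hA h) q
    simp only [Set.mem_singleton_iff, forall_eq] at h2
    exact (h.fixed_iff hA (S := (Y : Set G)) h.Y_le (h.inf_centralizer hA) q).trans h2.symm
  have hYp : ∀ g ∈ Y, g • p = p := fun g hg => (mem_twoPt.1 (h.Y_le hg)).1
  have hYo : ∀ g ∈ Y, g • o = o := fun g hg => (mem_twoPt.1 (h.Y_le hg)).2
  have htp := (mem_twoPt.1 ht.mem).1
  have hto := (mem_twoPt.1 ht.mem).2
  have hCt : ∀ c : G, c ∈ Subgroup.centralizer {t} ↔ t * c = c * t := fun c => by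
    rw [Subgroup.mem_centralizer_singleton_iff, eq_comm]
  have hne : ∀ g : G, g • o ≠ g • p := fun g hg => h.ne (smul_left_cancel g hg)
  apply le_antisymm
  · intro g hg
    have hgf : ∀ q : Sylow 37 G, t • q = q → t • g • q = g • q := by
      intro q hq
      rw [← hfix] at hq ⊢
      intro y hy
      have := hq (g⁻¹ * y * g) (by
        simpa using (Subgroup.mem_normalizer_iff.1 (Subgroup.inv_mem _ hg) y).1 hy)
      rwa [mul_smul, mul_smul, inv_smul_eq_iff] at this
    obtain ⟨c, hc, hcp, hco⟩ := h.exists_commute_pair hA ht.singleton_subset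
      (Set.singleton_subset_iff.2 ht.tX) (q := g • p) (r := g • o)
      (by simpa using hgf p htp) (by simpa using hgf o hto) (hne g)
    have hk : c⁻¹ * g ∈ twoPt p o := mem_twoPt.2
      ⟨by rw [mul_smul, ← hcp, inv_smul_smul], by rw [mul_smul, ← hco, inv_smul_smul]⟩
    have := Subgroup.mul_mem _ hc ((hCt _).2 (ht.commute hA h hk).symm)
    rwa [mul_inv_cancel_left] at this
  · intro g hg
    have hgf : ∀ q : Sylow 37 G, t • q = q → ∀ y ∈ Y, y • g • q = g • q := fun q hq =>
      (hfix _).2 (smul_smul_of_commute ((hCt g).1 hg) hq)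
    obtain ⟨c, hc, hcp, hco⟩ := h.exists_commute_pair hA (S := (Y : Set G)) h.Y_le h.cfg.YX
      (hgf p htp) (hgf o hto) (hne g)
    have hk : c⁻¹ * g ∈ twoPt p o := mem_twoPt.2
      ⟨by rw [mul_smul, ← hcp, inv_smul_smul], by rw [mul_smul, ← hco, inv_smul_smul]⟩
    have := Subgroup.mul_mem _ (Subgroup.centralizer_le_normalizer _ hc)
        (h.twoPt_le_normalizer hA hk)
    rwa [mul_inv_cancel_left] at this

lemma Frame.not_dvd_normalizer (hA : Arith G) (h : Frame p o X Y) : ¬ 37 ^ 2 ∣ Nat.card N(Y) := by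
  obtain ⟨t, ht⟩ := h.exists_invo hA
  intro hd
  have hXp : IsPGroup 37 X := isPGroup_of_card (n := 1) (by simpa using h.cfg.cardX)
  have hXN : X ≤ N(Y) := (le_centralizer_comm h.cfg.YX).trans (Subgroup.centralizer_le_normalizer _)
  obtain ⟨S, hXS, hS⟩ := exists_isSyl_ge hXp hXN
  obtain ⟨q, hq⟩ := hS.isPGroup.exists_le_sylow
  have hqp : (q : Subgroup G) = p := by
    by_contra hne
    obtain ⟨x, hx, hx1⟩ := h.exists_ne_one
    have := (hA.inf_eq_bot (hA.card_sylow37 p) (hA.card_sylow37 q) hne).le ⟨hq (hXS hx),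
        h.cfg.XQ hx⟩
    exact hx1 (Subgroup.mem_bot.1 this)
  have h1 : S ≤ X := by
    rw [← ht.inf_centralizer hA h, ← ht.normalizer_eq hA h]
    exact le_inf (hqp ▸ hq) hS.le
  have h2 := relIndex_mul_card_of_le S N(Y) hS.le
  rw [le_antisymm h1 hXS, h.cfg.cardX] at h2
  rw [← h2, pow_two] at hd
  have h3 := hS.2.2
  rw [le_antisymm h1 hXS] at h3
  exact h3 (Nat.dvd_of_mul_dvd_mul_right (by norm_num) hd)

/-- The number of Sylow `19`-subgroups of a subgroup between `⟨P, X⟩` and the normalizer of `Y`. -/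
lemma Frame.numSyl19 (hA : Arith G) (h : Frame p o X Y) {P L : Subgroup G} (hP : IsSyl 19 P ⊤)
    (hPL : P ≤ L) (hXL : X ≤ L) (hL : L ≤ N(Y)) : 666 * Nat.card ↥(N(P) ⊓ L) = Nat.card L := by
  have hYb : Y ≠ ⊥ := ne_bot_of_card (p := 19) (n := 1) (by norm_num) (by norm_num)
    (by simpa using h.cfg.cardY)
  have hYp : IsPGroup 19 Y := isPGroup_of_card (n := 1) (by simpa using h.cfg.cardY)
  have hL1 : Nat.card L ∣ N1 :=
    (Subgroup.card_dvd_of_le hL).trans (hA.card_normalizer_dvd (by simp) hYp hYb)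
  have hn := relIndex_mul_card_inf N(P) L
  have h37' : ¬ 37 ∣ Nat.card ↥(N(P) ⊓ L) := fun h1 => by
    have := h1.trans (Subgroup.card_dvd_of_le inf_le_left)
    rw [hA.card_normalizer19 hP] at this
    revert this; norm_num
  have h37 : 37 ∣ Nat.card L := h.cfg.cardX ▸ Subgroup.card_dvd_of_le hXL
  have hsq : ¬ 37 ^ 2 ∣ Nat.card L := fun h1 =>
    h.not_dvd_normalizer hA (h1.trans (Subgroup.card_dvd_of_le hL))
  have h1 := (hP.mono hPL le_top).numSyl19 hL1
  simp only [Finset.mem_insert, Finset.mem_singleton] at h1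
  rcases h1 with h1 | h1 | h1 | h1
  · rw [h1, one_mul] at hn
    exact absurd (hn ▸ h37) h37'
  · rw [h1] at hn
    exact absurd (hn ▸ dvd_mul_right _ _) hsq
  · rw [← hn, h1]
  · rw [h1] at hn
    exact absurd (hn ▸ Dvd.dvd.mul_right (by norm_num) _) hsq

lemma Frame.le_centralizer_of_card_normalizer (hA : Arith G) (h : Frame p o X Y)
    {P : Subgroup G} (hP : IsSyl 19 P ⊤) (hYP : Y ≤ P) {c : ℕ}
    (hM : Nat.card N(Y) = 666 * (1444 * c)) (hc : c ∣ 2) (hCP : 1444 ∣ Nat.card C(P)) :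
    N(Y) ≤ C(Y) := by
  have hPc := hA.card19 hP
  have hPC : P ≤ C(Y) := (le_centralizer_of_card_sq hPc).trans (Subgroup.centralizer_le hYP)
  have hCM : C(Y) ≤ N(Y) := Subgroup.centralizer_le_normalizer _
  have hSC : IsSyl 19 P C(Y) := hP.mono hPC le_top
  have hn := h.numSyl19 hA hP hPC (le_centralizer_comm h.cfg.YX) hCM
  have hCPle : C(P) ≤ N(P) ⊓ C(Y) :=
    le_inf (Subgroup.centralizer_le_normalizer _) (Subgroup.centralizer_le hYP)
  have h4 : 1444 ∣ Nat.card ↥(N(P) ⊓ C(Y)) := hCP.trans (Subgroup.card_dvd_of_le hCPle)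
  obtain ⟨d, hd4⟩ := h4
  have hdc : d ∣ c := by
    have h5 : Nat.card C(Y) ∣ Nat.card N(Y) := Subgroup.card_dvd_of_le hCM
    rw [← hn, hM, hd4] at h5
    exact Nat.dvd_of_mul_dvd_mul_left (by norm_num)
      (Nat.dvd_of_mul_dvd_mul_left (by norm_num) h5)
  by_cases hdc' : d = c
  · exact (Subgroup.eq_of_le_of_card_ge hCM (by rw [hM, ← hn, hd4, hdc'])).ge
  exfalso
  have hd1 : d = 1 := by
    rcases (Nat.dvd_prime Nat.prime_two).1 hc with rfl | rfl
    · exact absurd (Nat.dvd_one.1 hdc) hdc'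
    · exact ((Nat.dvd_prime Nat.prime_two).1 hdc).resolve_right hdc'
  rw [hd1, mul_one] at hd4
  have hle : N(P) ⊓ C(Y) ≤ C(P) :=
    (Subgroup.eq_of_le_of_card_ge hCPle
      (by rw [hd4]; exact Nat.le_of_dvd Nat.card_pos hCP)).ge
  obtain ⟨N, hNC, hCN, hNcard, hNmem⟩ := hSC.exists_complement hle
  rw [hPc, ← hn, hd4] at hNcard
  have hN : Nat.card N = 2664 := by omega
  have hXN : X ≤ N := hNmem X (le_centralizer_comm h.cfg.YX) (by
    rw [h.cfg.cardX, hPc]; norm_num)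
  have hXS : IsSyl 37 X N := isSyl_of_card (n := 1) (by simpa using h.cfg.cardX) hXN
    (by rw [hN]; norm_num)
  have h1 : N(X).relIndex N = 1 := by
    have h1 := hXS.numSyl37 (by rw [hN]; norm_num [N1])
    have h2 : N(X).relIndex N ∣ 2664 := hN ▸ Subgroup.relIndex_dvd_card _ _
    simp only [Finset.mem_insert, Finset.mem_singleton] at h1
    rcases h1 with h1 | h1 | h1
    · exact h1
    all_goals rw [h1] at h2; revert h2; norm_num
  rw [Subgroup.relIndex_eq_one] at h1
  have hCX : C(Y) ≤ N(X) := hCN.trans (hXS.normalizer_le h1)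
  obtain ⟨w, hw, hwp, -⟩ := h.exists_commute_pair hA (S := (Y : Set G)) h.Y_le h.cfg.YX
    (q := o) (r := p) (fun g hg => (mem_twoPt.1 (h.Y_le hg)).2)
    (fun g hg => (mem_twoPt.1 (h.Y_le hg)).1) h.ne.symm
  obtain ⟨x, hx, hx1⟩ := h.exists_ne_one
  have hxo : x ∈ o := by
    rw [← hwp, mem_smul_sylow]
    refine h.cfg.XQ ?_
    simpa using (Subgroup.mem_normalizer_iff.1 (Subgroup.inv_mem _ (hCX hw)) x).1 hx
  exact hx1 (hA.eq_one_of_smul_eq h.ne (h.cfg.XQ hx) (smul_self_of_mem hxo))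

lemma Frame.normalizer_le_centralizer (hA : Arith G) (h : Frame p o X Y) : N(Y) ≤ C(Y) := by
  obtain ⟨t, ht⟩ := h.exists_invo hA
  have hYp : IsPGroup 19 Y := isPGroup_of_card (n := 1) (by simpa using h.cfg.cardY)
  have hYb : Y ≠ ⊥ := ne_bot_of_card (p := 19) (n := 1) (by norm_num) (by norm_num)
    (by simpa using h.cfg.cardY)
  obtain ⟨P, hYP, hP⟩ := exists_isSyl_ge hYp (le_top : Y ≤ ⊤)
  have hPc := hA.card19 hP
  have hPab := le_centralizer_of_card_sq hPc
  have hPC : P ≤ C(Y) := hPab.trans (Subgroup.centralizer_le hYP)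
  have hPM : P ≤ N(Y) := hPC.trans (Subgroup.centralizer_le_normalizer _)
  have hNP := hA.card_normalizer19 hP
  have hn := h.numSyl19 hA hP hPM
    ((le_centralizer_comm h.cfg.YX).trans (Subgroup.centralizer_le_normalizer _)) le_rfl
  have hM1 : Nat.card N(Y) ∣ N1 := hA.card_normalizer_dvd (by simp) hYp hYb
  have h37' : ¬ 37 ∣ Nat.card ↥(N(P) ⊓ N(Y)) := fun h1 => by
    have := h1.trans (Subgroup.card_dvd_of_le inf_le_left)
    rw [hNP] at this
    revert this; norm_num
  have hle8 : Nat.card ↥(N(P) ⊓ N(Y)) ∣ 361 * 8 := by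
    have h1 : 666 * Nat.card ↥(N(P) ⊓ N(Y)) ∣ 666 * (361 * 8 * 37 ^ 2) :=
      hn ▸ hM1.trans (by norm_num [N1])
    have h2 := Nat.dvd_of_mul_dvd_mul_left (by norm_num) h1
    exact (Nat.Coprime.pow_right 2 ((Nat.Prime.coprime_iff_not_dvd
        (by norm_num)).2 h37').symm).dvd_of_dvd_mul_right h2
  have hlt : ¬ N(P) ≤ N(Y) := fun h1 => by
    rw [inf_eq_left.2 h1, hNP] at hle8
    revert hle8; norm_num
  obtain ⟨n, hnP, hnY⟩ := SetLike.not_le_iff_exists.1 hlt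
  have htP : t ∈ C(P) := by
    rw [ht.normalizer_eq hA h] at hPM
    exact Subgroup.mem_centralizer_iff.2 fun x hx =>
      (Subgroup.mem_centralizer_iff.1 (hPM hx) t rfl).symm
  have ht'P : n * t * n⁻¹ ∈ C(P) := by
    rw [← conj_eq_iff.2 hnP, ← conj_centralizer, mem_conj_iff]
    simpa [mul_assoc] using htP
  have hne : t ≠ n * t * n⁻¹ := fun he => hnY (by
    rw [ht.normalizer_eq hA h, Subgroup.mem_centralizer_singleton_iff]
    exact (eq_mul_inv_iff_mul_eq.1 he).symm)
  have hcomm : t * (n * t * n⁻¹) = n * t * n⁻¹ * t := by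
    have h1 : n * t * n⁻¹ ∈ N(Y) :=
      Subgroup.centralizer_le_normalizer _ (Subgroup.centralizer_le hYP ht'P)
    rw [ht.normalizer_eq hA h] at h1
    exact Subgroup.mem_centralizer_iff.1 h1 t rfl
  have h4 : 4 ∣ Nat.card C(P) := four_dvd_card_of_commute htP ht'P ht.ne ht.sq
    (by rw [Ne, conj_eq_one_iff]; exact ht.ne)
    (by
      calc _ = n * (t * t) * n⁻¹ := by group
        _ = 1 := by rw [ht.sq]; group) hne hcomm
  have hCP : 1444 ∣ Nat.card C(P) :=
    Nat.Coprime.mul_dvd_of_dvd_of_dvd (m := 4) (n := 19 ^ 2) (by norm_num) h4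
      (hPc ▸ Subgroup.card_dvd_of_le hPab)
  have hCPle : C(P) ≤ N(P) ⊓ N(Y) := le_inf (Subgroup.centralizer_le_normalizer _)
    ((Subgroup.centralizer_le hYP).trans (Subgroup.centralizer_le_normalizer _))
  obtain ⟨c, hc⟩ := hCP.trans (Subgroup.card_dvd_of_le hCPle)
  refine h.le_centralizer_of_card_normalizer hA hP hYP (c := c) (by rw [← hn, hc]) ?_ hCP
  rw [hc] at hle8
  exact Nat.dvd_of_mul_dvd_mul_left (k := 1444) (by norm_num) hle8

lemma Frame.twoPt_le_centralizer (hA : Arith G) (h : Frame p o X Y) : twoPt p o ≤ C(Y) :=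
  (h.twoPt_le_normalizer hA).trans (h.normalizer_le_centralizer hA)

lemma Frame.Invo.exists_swap {t : G} (hA : Arith G) (h : Frame p o X Y) (ht : Frame.Invo p o X t) :
    ∃ w, w • p = o ∧ w • o = p ∧ w ∈ C(Y) ∧ t * w = w * t := by
  obtain ⟨w, hw, hwp, hwo⟩ := h.exists_commute_pair hA (S := (Y : Set G)) h.Y_le h.cfg.YX
    (q := o) (r := p) (fun g hg => (mem_twoPt.1 (h.Y_le hg)).2)
    (fun g hg => (mem_twoPt.1 (h.Y_le hg)).1) h.ne.symm
  have h1 := Subgroup.centralizer_le_normalizer _ hw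
  rw [ht.normalizer_eq hA h] at h1
  exact ⟨w, hwp, hwo, hw, Subgroup.mem_centralizer_iff.1 h1 t rfl⟩

end Torus

section Irreducible
variable {G : Type*} [Group G] [Finite G] {p o : Sylow 37 G} {X Y : Subgroup G}

lemma Frame.eq_or_eq (hA : Arith G) (h : Frame p o X Y) {W : Subgroup G} (hXW : X ≤ W)
    (hWp : W ≤ (p : Subgroup G)) (hYW : Y ≤ N(W)) : W = X ∨ W = p := by
  have h1 := card_inf_centralizer_mod (isPGroup_of_card (p := 19) (n := 1)
      (by simpa using h.cfg.cardY))
    hYW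
  have h2 : W ⊓ C(Y) = X := le_antisymm
    ((inf_le_inf_right _ hWp).trans (h.inf_centralizer hA).le)
    (le_inf hXW (le_centralizer_comm h.cfg.YX))
  obtain ⟨k, hk, hc⟩ := card_eq_pow_of_le (by norm_num) h.cfg.cardQ hWp
  rw [h2, h.cfg.cardX, hc] at h1
  interval_cases k
  · exact absurd h1 (by decide)
  · exact Or.inl (Subgroup.eq_of_le_of_card_ge hXW (by rw [hc, h.cfg.cardX]; norm_num)).symm
  · exact absurd h1 (by decide)
  · exact Or.inr (Subgroup.eq_of_le_of_card_ge hWp (by rw [hc, h.cfg.cardQ]))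

lemma Frame.conj_mem_X (hA : Arith G) (h : Frame p o X Y) {k x : G} (hk : k ∈ twoPt p o)
    (hx : x ∈ X) : k * x * k⁻¹ ∈ X :=
  (Subgroup.mem_normalizer_iff.1 (h.twoPt_le_normalizer_X hA hk) x).1 hx

/-- The two-point stabilizer acts freely on the nontrivial elements of `p / X`. -/
lemma Frame.eq_one_of_conj (hA : Arith G) (h : Frame p o X Y) {k u : G} (hk : k ∈ twoPt p o)
    (hu : u ∈ p) (huX : u ∉ X) (hku : u⁻¹ * (k * u * k⁻¹) ∈ X) : k = 1 := by
  obtain ⟨t, ht⟩ := h.exists_invo hA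
  let W : Subgroup G :=
    { carrier := {u | u ∈ p ∧ u⁻¹ * (k * u * k⁻¹) ∈ X}
      one_mem' := ⟨p.one_mem, by simp⟩
      mul_mem' := by
        rintro a b ⟨ha, ha'⟩ ⟨hb, hb'⟩
        refine ⟨p.mul_mem ha hb, ?_⟩
        have e : (a * b)⁻¹ * (k * (a * b) * k⁻¹) =
            a⁻¹ * (k * a * k⁻¹) * (b⁻¹ * (k * b * k⁻¹)) := by
          calc _ = b⁻¹ * (a⁻¹ * (k * a * k⁻¹)) * (k * b * k⁻¹) := by group
            _ = _ := by rw [← h.commute (p.inv_mem hb) ha']; group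
        rw [e]
        exact X.mul_mem ha' hb'
      inv_mem' := by
        rintro a ⟨ha, ha'⟩
        refine ⟨p.inv_mem ha, ?_⟩
        have e : a⁻¹⁻¹ * (k * a⁻¹ * k⁻¹) = (a⁻¹ * (k * a * k⁻¹))⁻¹ := by
          have h1 := h.commute ha (X.inv_mem ha')
          calc _ = a * (a⁻¹ * (k * a * k⁻¹))⁻¹ * a⁻¹ := by group
            _ = _ := by rw [← h1]; group
        rw [e]
        exact X.inv_mem ha' }
  have hXW : X ≤ W := fun x hx => ⟨h.cfg.XQ hx, X.mul_mem (X.inv_mem hx) (h.conj_mem_X hA hk hx)⟩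
  have hkY := Subgroup.mem_centralizer_iff.1 (h.twoPt_le_centralizer hA hk)
  have hYW : Y ≤ N(W) := by
    have key : ∀ y ∈ Y, ∀ u ∈ W, y * u * y⁻¹ ∈ W := by
      rintro y hy u ⟨hu, hu'⟩
      refine ⟨conj_mem_of_mem_twoPt (h.Y_le hy) hu, ?_⟩
      have e : (y * u * y⁻¹)⁻¹ * (k * (y * u * y⁻¹) * k⁻¹) = y * (u⁻¹ * (k * u * k⁻¹)) * y⁻¹ := by
        calc _ = y * u⁻¹ * y⁻¹ * (k * y) * u * (k * y)⁻¹ := by group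
          _ = _ := by rw [← hkY y hy]; group
      rw [e]
      exact h.conj_mem_X hA (h.Y_le hy) hu'
    refine fun y hy => Subgroup.mem_normalizer_iff.2 fun u => ⟨key y hy u, fun hu => ?_⟩
    have := key y⁻¹ (Y.inv_mem hy) _ hu
    simpa [mul_assoc] using this
  rcases h.eq_or_eq hA hXW (fun u hu => hu.1) hYW with hW | hW
  · exact absurd (hW ▸ ⟨hu, hku⟩ : u ∈ X) huX
  · by_contra hk1
    have hI : ∀ i ∈ p, t * i * t = i⁻¹ → k * i = i * k := by
      intro i hi hti
      have hiW : i ∈ W := hW ▸ hi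
      obtain ⟨-, hx⟩ := hiW
      set x := i⁻¹ * (k * i * k⁻¹) with hxd
      have e1 : k * i * k⁻¹ = i * x := by rw [hxd]; group
      have e2 : t * (i * x) * t = (i * x)⁻¹ := by
        rw [← e1]
        have hc := ht.commute hA h hk
        have hc' := ht.commute hA h (Subgroup.inv_mem _ hk)
        calc t * (k * i * k⁻¹) * t = t * k * i * (k⁻¹ * t) := by group
          _ = k * (t * i * t) * k⁻¹ := by rw [← hc, hc']; group
          _ = _ := by rw [hti]; group
      have e3 : t * (i * x) * t = i⁻¹ * x := by
        calc _ = t * i * 1 * x * t := by group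
          _ = (t * i * t) * (t * x * t) := by rw [← ht.sq]; group
          _ = _ := by rw [hti, ht.conj_X hx]
      have e4 : x ^ 2 = 1 := by
        rw [e3, mul_inv_rev, h.commute (p.inv_mem hi) (X.inv_mem hx)] at e2
        rw [pow_two]
        exact mul_eq_one_iff_inv_eq.2 (mul_left_cancel e2).symm
      rw [h.eq_one_of_mem_X_of_pow hx (by norm_num) e4, mul_one] at e1
      exact mul_inv_eq_iff_eq_mul.1 e1
    let f : ↥((p : Subgroup G) ⊓ Subgroup.centralizer {k}) × X → p :=
      fun c => ⟨c.1 * c.2, p.mul_mem c.1.2.1 (h.cfg.XQ c.2.2)⟩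
    have hf : Function.Surjective f := by
      rintro ⟨u, hu⟩
      obtain ⟨i, hi, hti, x, hx, rfl⟩ := ht.exists_mul hA h hu
      exact ⟨⟨⟨i, hi, Subgroup.mem_centralizer_singleton_iff.2 (hI i hi hti).symm⟩, ⟨x, hx⟩⟩, rfl⟩
    have h1 := Nat.card_le_card_of_surjective f hf
    rw [Nat.card_prod, h.cfg.cardX] at h1
    have h2 := h.card_centralizer_le hA hk hk1
    have h3 : 37 ^ 3 ≤ _ := h.cfg.cardQ.symm.trans_le h1
    omega

end Irreducible

section Field

/-- The field with `37 ^ 2` elements. -/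
abbrev F := GaloisField 37 2

lemma card_F : Nat.card F = 37 ^ 2 := GaloisField.card 37 2 (by norm_num)

instance : Finite F := Nat.finite_of_card_ne_zero (by rw [card_F]; norm_num)

/-- A group acting regularly on the nonzero elements of an abelian group of order `37 ^ 2` and
having a central element acting irreducibly is the multiplicative group of a field. -/
lemma exists_field_coord {V Γ : Type*} [AddCommGroup V] [Finite V] [Group Γ] [Finite Γ]
    (hV : Nat.card V = 37 ^ 2) (hΓ : Nat.card Γ = 1368) (a : Γ →* AddMonoid.End V) {y : Γ}
    (hy : ∀ k, k * y = y * k)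
    (hirr : ∀ W : AddSubgroup V, (∀ v ∈ W, a y v ∈ W) → W = ⊥ ∨ W = ⊤)
    (hfree : ∀ k v, v ≠ 0 → a k v = v → k = 1) {α : V} (hα : α ≠ 0) :
    ∃ (φ : V ≃+ F) (e : Γ ≃* Fˣ), φ α = 1 ∧ ∀ k v, φ (a k v) = e k * φ v := by
  have hfin : Finite (AddMonoid.End V) := DFunLike.finite _
  let D : Subring (AddMonoid.End V) := Subring.centralizer {a y}
  have hD : ∀ d : D, ∀ v, a y ((d : AddMonoid.End V) v) = (d : AddMonoid.End V) (a y v) :=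
    fun d v => DFunLike.congr_fun (Subring.mem_centralizer_iff.1 d.2 (a y) rfl) v
  have hinj : ∀ d : D, d ≠ 0 → ∀ v, (d : AddMonoid.End V) v = 0 → v = 0 := by
    intro d hd v hv
    rcases hirr (AddMonoidHom.ker (d : AddMonoid.End V)) (fun v hv => by
      have hv' : (d : AddMonoid.End V) v = 0 := hv
      change (d : AddMonoid.End V) (a y v) = 0
      rw [← hD, hv', map_zero]) with h1 | h1
    · have : v ∈ AddMonoidHom.ker (d : AddMonoid.End V) := hv
      rwa [h1, AddSubgroup.mem_bot] at this
    · refine absurd (Subtype.ext (AddMonoidHom.ext fun v => ?_)) hd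
      have : v ∈ AddMonoidHom.ker (d : AddMonoid.End V) := h1 ▸ AddSubgroup.mem_top v
      exact this
  have hne : Nontrivial D := ⟨0, 1, fun h01 => hα
    (DFunLike.congr_fun (congrArg Subtype.val h01) α).symm⟩
  have hnzd : NoZeroDivisors D := ⟨fun {b c} hbc => by
    by_contra! h0
    refine h0.2 (Subtype.ext (AddMonoidHom.ext fun v => ?_))
    exact hinj b h0.1 _ (DFunLike.congr_fun (congrArg Subtype.val hbc) v)⟩
  have hdom : IsDomain D := NoZeroDivisors.to_isDomain D
  let r : Γ →* D :=
    { toFun := fun k => ⟨a k, Subring.mem_centralizer_iff.2 fun g hg => by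
        rw [Set.mem_singleton_iff.1 hg, ← map_mul, ← map_mul, hy]⟩
      map_one' := Subtype.ext (map_one a)
      map_mul' := fun k l => Subtype.ext (map_mul a k l) }
  have hinv : ∀ k v, a k⁻¹ (a k v) = v := fun k v => by
    have : (a k⁻¹ * a k) v = v := by rw [← map_mul, inv_mul_cancel, map_one]; rfl
    exact this
  have hr0 : ∀ k, a k α ≠ 0 := fun k hk => hα (by rw [← hinv k α, hk, map_zero])
  let ev : D →+ V :=
    { toFun := fun d => (d : AddMonoid.End V) α
      map_zero' := rfl
      map_add' := fun _ _ => rfl }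
  have hev : Function.Injective ev := by
    rw [injective_iff_map_eq_zero]
    intro d hd
    by_contra h0
    exact hα (hinj d h0 α hd)
  let g : Γ → {v : V // v ≠ 0} := fun k => ⟨a k α, hr0 k⟩
  have hginj : Function.Injective g := by
    intro k l hkl
    have h1 : a k α = a l α := congrArg Subtype.val hkl
    have h2 : a (l⁻¹ * k) α = α := by
      rw [map_mul]
      exact (congrArg (a l⁻¹) h1).trans (hinv l α)
    exact (inv_mul_eq_one.1 (hfree _ α hα h2)).symm
  have hcardV : Nat.card {v : V // v ≠ 0} = 1368 := by
    have := Fintype.ofFinite V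
    classical
    rw [Nat.card_eq_fintype_card, Fintype.card_subtype_compl, Fintype.card_subtype_eq,
      ← Nat.card_eq_fintype_card, hV]
    norm_num
  have hg : Function.Bijective g :=
    Function.Injective.bijective_of_nat_card_le hginj (by rw [hcardV, hΓ])
  have hevs : Function.Surjective ev := by
    intro v
    by_cases hv : v = 0
    · exact ⟨0, by rw [hv, map_zero]⟩
    · obtain ⟨k, hk⟩ := hg.2 ⟨v, hv⟩
      exact ⟨r k, congrArg Subtype.val hk⟩
  let E : D ≃+ V := AddEquiv.ofBijective ev ⟨hev, hevs⟩
  have hcardD : Nat.card D = Nat.card F := by rw [Nat.card_congr E.toEquiv, hV, card_F]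
  let : Field D := (Finite.isDomain_to_isField D).toField
  have := Fintype.ofFinite D
  have := Fintype.ofFinite F
  rw [Nat.card_eq_fintype_card, Nat.card_eq_fintype_card] at hcardD
  let ψ : D ≃+* F := FiniteField.ringEquivOfCardEq hcardD
  let e : Γ →* Fˣ := MonoidHom.toHomUnits ((ψ : D →* F).comp r)
  have he : Function.Injective e := by
    intro k l hkl
    have h1 : ψ (r k) = ψ (r l) := congrArg Units.val hkl
    have h2 := congrArg ev (ψ.injective h1)
    exact hginj (Subtype.ext h2)
  have heb : Function.Bijective e := by
    refine Function.Injective.bijective_of_nat_card_le he ?_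
    rw [hΓ, Nat.card_units, card_F]
    norm_num
  refine ⟨E.symm.trans ψ.toAddEquiv, MulEquiv.ofBijective e heb, ?_, ?_⟩
  · have : E.symm α = 1 := by rw [AddEquiv.symm_apply_eq]; rfl
    change ψ (E.symm α) = 1
    rw [this, map_one]
  · intro k v
    have : E.symm (a k v) = r k * E.symm v := by
      rw [AddEquiv.symm_apply_eq]
      change _ = a k (E (E.symm v))
      rw [E.apply_symm_apply]
    change ψ (E.symm (a k v)) = ψ (r k) * ψ (E.symm v)
    rw [this, map_mul]

end Field

section Coordinates
variable {G : Type*} [Group G] [Finite G] {p o : Sylow 37 G} {X Y : Subgroup G}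

/-- `φ` identifies `p / X` with the additive group of `F`, and `e` the two-point stabilizer with
the multiplicative group. -/
structure Coord (p o : Sylow 37 G) (X : Subgroup G) (φ : G → F) (e : twoPt p o ≃* Fˣ) : Prop where
  map_mul : ∀ u ∈ p, ∀ v ∈ p, φ (u * v) = φ u + φ v
  eq_zero_iff : ∀ u ∈ p, φ u = 0 ↔ u ∈ X
  surj : ∀ a, ∃ u ∈ p, φ u = a
  conj : ∀ k : twoPt p o, ∀ u ∈ p, φ (k * u * (k : G)⁻¹) = e k * φ u

lemma Frame.exists_generator (h : Frame p o X Y) : ∃ y ∈ Y, orderOf y = 19 ∧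
    Subgroup.zpowers y = Y := by
  have hYb : Y ≠ ⊥ := ne_bot_of_card (p := 19) (n := 1) (by norm_num) (by norm_num)
    (by simpa using h.cfg.cardY)
  obtain ⟨y, hy, hy1⟩ := (Subgroup.bot_or_exists_ne_one Y).resolve_left hYb
  have ho : orderOf y = 19 := by
    have h1 : orderOf y ∣ 19 := h.cfg.cardY ▸ Subgroup.orderOf_dvd_natCard Y hy
    exact ((Nat.dvd_prime (by norm_num)).1 h1).resolve_left fun h2 => hy1 (orderOf_eq_one_iff.1 h2)
  refine ⟨y, hy, ho, Subgroup.eq_of_le_of_card_ge ?_ ?_⟩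
  · rwa [Subgroup.zpowers_le]
  · rw [Nat.card_zpowers, ho, h.cfg.cardY]

lemma Frame.exists_coord (hA : Arith G) (h : Frame p o X Y) {α : G} (hα : α ∈ p) (hαX : α ∉ X) :
    ∃ φ e, Coord p o X φ e ∧ φ α = 1 := by
  classical
  let P : Subgroup G := p
  let N : Subgroup P := X.subgroupOf P
  have hN : N.Normal := ⟨fun n hn g => by
    have h1 : (n : G) ∈ X := hn
    change (g : G) * n * (g : G)⁻¹ ∈ X
    rw [← h.commute g.2 h1, mul_inv_cancel_right]
    exact h1⟩
  let I : CommGroup (P ⧸ N) :=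
    { QuotientGroup.Quotient.group N with
      mul_comm := by
        rintro ⟨a⟩ ⟨b⟩
        refine QuotientGroup.eq.2 ?_
        change ((a : G) * b)⁻¹ * (b * a) ∈ X
        have := h.commutator_mem hA (p.inv_mem b.2) (p.inv_mem a.2)
        simpa [mul_assoc] using this }
  let c : twoPt p o → P →* P := fun k =>
    { toFun := fun u => ⟨k * u * (k : G)⁻¹, conj_mem_of_mem_twoPt k.2 u.2⟩
      map_one' := by simp
      map_mul' := fun u v => by ext; simp [mul_assoc] }
  have hc : ∀ k, N ≤ N.comap (c k) := fun k n hn => h.conj_mem_X hA k.2 hn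
  let a : twoPt p o →* AddMonoid.End (Additive (P ⧸ N)) :=
    { toFun := fun k => (QuotientGroup.map N N (c k) (hc k)).toAdditive
      map_one' := by
        ext v
        induction v with | ofMul v => ?_
        induction v using QuotientGroup.induction_on with | H u => ?_
        change Additive.ofMul (QuotientGroup.mk (c 1 u)) = _
        congr 2
        ext
        simp [c]
      map_mul' := fun k l => by
        ext v
        induction v with | ofMul v => ?_
        induction v using QuotientGroup.induction_on with | H u => ?_
        change Additive.ofMul (QuotientGroup.mk (c (k * l) u)) =
          Additive.ofMul (QuotientGroup.mk (c k (c l u)))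
        congr 2
        ext
        simp [c, mul_assoc] }
  let q : P → Additive (P ⧸ N) := fun u => Additive.ofMul (QuotientGroup.mk u)
  have hq0 : ∀ u : P, q u = 0 ↔ (u : G) ∈ X := fun u => QuotientGroup.eq_one_iff u
  have hqs : Function.Surjective q := by
    intro v
    induction v with | ofMul v => ?_
    induction v using QuotientGroup.induction_on with | H u => exact ⟨u, rfl⟩
  obtain ⟨y, hy, -, hyz⟩ := h.exists_generator
  have hcard : Nat.card (Additive (P ⧸ N)) = 37 ^ 2 := by
    have h1 := relIndex_mul_card_of_le _ _ h.cfg.XQ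
    rw [h.cfg.cardX, h.cfg.cardQ] at h1
    change N.index = 37 ^ 2
    change N.index * 37 = 37 ^ 3 at h1
    omega
  obtain ⟨φ, e, h1, h2⟩ := exists_field_coord hcard (hA.card_twoPt h.ne) a (y := ⟨y, h.Y_le hy⟩)
    (α := q ⟨α, hα⟩)
    (fun k => Subtype.ext ((Subgroup.mem_centralizer_iff.1
        (h.twoPt_le_centralizer hA k.2)) y hy).symm)
    (by
      intro W hW
      let W' : Subgroup G :=
        { carrier := {u | ∃ hu : u ∈ p, q ⟨u, hu⟩ ∈ W}
          one_mem' := ⟨p.one_mem, W.zero_mem⟩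
          mul_mem' := fun ⟨hu, hu'⟩ ⟨hv, hv'⟩ => ⟨p.mul_mem hu hv, W.add_mem hu' hv'⟩
          inv_mem' := fun ⟨hu, hu'⟩ => ⟨p.inv_mem hu, W.neg_mem hu'⟩ }
      have hYW : Y ≤ N(W') := by
        rw [← hyz, Subgroup.zpowers_le]
        refine Subgroup.mem_normalizer_fintype ?_
        rintro u ⟨hu, hu'⟩
        exact ⟨conj_mem_of_mem_twoPt (h.Y_le hy) hu, hW _ hu'⟩
      rcases h.eq_or_eq hA (W := W') (fun x hx => ⟨h.cfg.XQ hx, by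
        rw [(hq0 ⟨x, h.cfg.XQ hx⟩).2 hx]; exact W.zero_mem⟩) (fun u hu => hu.1) hYW with h3 | h3
      · refine Or.inl ((AddSubgroup.eq_bot_iff_forall W).2 fun v hv => ?_)
        obtain ⟨u, rfl⟩ := hqs v
        exact (hq0 u).2 (h3 ▸ (⟨u.2, hv⟩ : (u : G) ∈ W'))
      · refine Or.inr ((AddSubgroup.eq_top_iff' W).2 fun v => ?_)
        obtain ⟨u, rfl⟩ := hqs v
        have h4 : (u : G) ∈ W' := by rw [h3]; exact u.2
        exact h4.2)
    (by
      intro k v hv hk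
      obtain ⟨u, rfl⟩ := hqs v
      rw [Ne, hq0] at hv
      have h3 : (QuotientGroup.mk u : P ⧸ N) = QuotientGroup.mk (c k u) := hk.symm
      have h4 : u⁻¹ * c k u ∈ N := QuotientGroup.eq.1 h3
      exact Subtype.ext (h.eq_one_of_conj hA k.2 u.2 hv h4))
    ((hq0 _).not.2 hαX)
  refine ⟨fun g => if hg : g ∈ P then φ (q ⟨g, hg⟩) else 0, e, ⟨?_, ?_, ?_, ?_⟩, ?_⟩
  · intro u (hu : u ∈ P) v (hv : v ∈ P)
    rw [dif_pos hu, dif_pos hv, dif_pos (P.mul_mem hu hv), ← map_add]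
    rfl
  · intro u (hu : u ∈ P)
    rw [dif_pos hu, map_eq_zero_iff φ φ.injective, hq0]
  · intro b
    obtain ⟨u, hu⟩ := hqs (φ.symm b)
    exact ⟨u, u.2, by rw [dif_pos u.2]; exact (congrArg φ hu).trans (φ.apply_symm_apply b)⟩
  · intro k u (hu : u ∈ P)
    have hk : k * u * (k : G)⁻¹ ∈ P := conj_mem_of_mem_twoPt k.2 hu
    rw [dif_pos hu, dif_pos hk, ← h2]
    rfl
  · exact (dif_pos hα).trans h1

end Coordinates

section Swap
variable {G : Type*} [Group G] [Finite G] {p o : Sylow 37 G} {X Y : Subgroup G}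

/-- An involution `w` swapping `p` and `o`, and the basic relation it satisfies. -/
structure Frame.Swap (p o : Sylow 37 G) (X Y : Subgroup G) (t w α h : G) : Prop where
  wp : w • p = o
  wo : w • o = p
  sq : w * w = 1
  wY : w ∈ C(Y)
  tw : t * w = w * t
  mem : α ∈ p
  notMem : α ∉ X
  conj : t * α * t = α⁻¹
  hp : h ∈ p
  rel : w * α * w = h * w * (t * h * t)⁻¹

lemma Frame.Invo.exists_notMem {t : G} (hA : Arith G) (h : Frame p o X Y)
    (ht : Frame.Invo p o X t) : ∃ i ∈ p, i ∉ X ∧ t * i * t = i⁻¹ := by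
  by_contra! hcon
  have h1 : (p : Subgroup G) ≤ X := by
    intro u hu
    obtain ⟨i, hi, hti, x, hx, rfl⟩ := ht.exists_mul hA h hu
    refine X.mul_mem ?_ hx
    by_contra hiX
    exact hcon i hi hiX hti
  have h2 := Subgroup.card_le_of_le h1
  rw [h.cfg.cardQ, h.cfg.cardX] at h2
  norm_num at h2

lemma Frame.Invo.exists_Swap {t : G} (hA : Arith G) (h : Frame p o X Y)
    (ht : Frame.Invo p o X t) : ∃ w α g, Frame.Swap p o X Y t w α g := by
  obtain ⟨v, hvp, hvo, hvY, htv⟩ := ht.exists_swap hA h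
  obtain ⟨i, hi, hiX, hti⟩ := ht.exists_notMem hA h
  have hvp' : v⁻¹ • p = o := by rw [inv_smul_eq_iff, hvo]
  have hvo' : v⁻¹ • o = p := by rw [inv_smul_eq_iff, hvp]
  have hip : i • p = p := smul_self_of_mem hi
  have htp := (mem_twoPt.1 ht.mem).1
  have hto := (mem_twoPt.1 ht.mem).2
  set b := v * i * v⁻¹ with hb
  have hbo : b • o = o := by rw [hb, mul_smul, mul_smul, hvo', hip, hvp]
  have hbp : b • p ≠ p := by
    rw [hb, mul_smul, mul_smul, hvp']
    intro h1
    rw [← hvo, smul_left_cancel_iff] at h1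
    exact hiX (hA.eq_one_of_smul_eq h.ne hi h1 ▸ X.one_mem)
  have hvt : v⁻¹ * t = t * v⁻¹ := by
    rw [inv_mul_eq_iff_eq_mul, ← mul_assoc, ← htv, mul_inv_cancel_right]
  have htb : t * b * t = b⁻¹ := by
    calc t * b * t = (t * v) * i * (v⁻¹ * t) := by rw [hb]; group
      _ = v * (t * i * t) * v⁻¹ := by rw [htv, hvt]; group
      _ = b⁻¹ := by rw [hti, hb]; group
  obtain ⟨u, hu, huo⟩ := hA.exists_smul_eq h.ne hbp
  have huo' : (t * u * t) • o = b⁻¹ • p := by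
    have h1 : (t * b * t) • p = t • b • p := by rw [mul_smul, mul_smul, htp]
    rw [← htb, h1, ← huo, mul_smul, mul_smul, hto]
  have hup : u⁻¹ • p = p := smul_self_of_mem (p.inv_mem hu)
  have hup' : (t * u * t) • p = p := smul_self_of_mem (ht.conj_mem hu)
  set g := u⁻¹ * b * (t * u * t) with hg
  have hgp : g • p = o := by rw [hg, mul_smul, mul_smul, hup', inv_smul_eq_iff, huo]
  have hgo : g • o = p := by rw [hg, mul_smul, mul_smul, huo', smul_inv_smul, hup]
  have hk : g * v⁻¹ ∈ twoPt p o :=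
    mem_twoPt.2 ⟨by rw [mul_smul, hvp', hgo], by rw [mul_smul, hvo', hgp]⟩
  have htg : t * g = g * t := by
    have h1 := ht.commute hA h hk
    calc t * g = t * (g * v⁻¹) * v := by group
      _ = g * v⁻¹ * (t * v) := by rw [← h1]; group
      _ = g * t := by rw [htv]; group
  have hgi : t * g * t = g⁻¹ := by
    calc t * g * t = t * u⁻¹ * 1 * b * 1 * (t * u * t) * t := by rw [hg]; group
      _ = (t * u⁻¹ * t) * (t * b * t) * (t * (t * u * t) * t) := by rw [← ht.sq]; group
      _ = (t * u⁻¹ * t) * b⁻¹ * u := by rw [htb, ht.conj_conj]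
      _ = (t⁻¹ * u⁻¹ * t⁻¹) * b⁻¹ * u := by rw [ht.inv]
      _ = g⁻¹ := by rw [hg]; group
  have hgg : g * g = 1 := by
    rw [htg, mul_assoc, ht.sq, mul_one] at hgi
    exact mul_eq_one_iff_eq_inv.2 hgi
  have hgi' : g⁻¹ = g := inv_eq_of_mul_eq_one_right hgg
  have hk' : g * v ∈ twoPt p o :=
    mem_twoPt.2 ⟨by rw [mul_smul, hvp, hgo], by rw [mul_smul, hvo, hgp]⟩
  have htk := ht.commute hA h hk'
  have htk' := ht.commute hA h (Subgroup.inv_mem _ hk')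
  refine ⟨g, g * v * i * (g * v)⁻¹, u, hgp, hgo, hgg, ?_, htg, conj_mem_of_mem_twoPt hk' hi, ?_, ?_,
    hu, ?_⟩
  · have := Subgroup.mul_mem _ (h.twoPt_le_centralizer hA hk) hvY
    simpa using this
  · intro h1
    refine hiX ?_
    have := h.conj_mem_X hA (Subgroup.inv_mem _ hk') h1
    simpa [mul_assoc] using this
  · calc _ = t * (g * v) * i * ((g * v)⁻¹ * t) := by group
      _ = g * v * (t * i * t) * (g * v)⁻¹ := by rw [← htk, htk']; group
      _ = _ := by rw [hti]; group
  · calc _ = g * g * b * (g⁻¹ * g) := by rw [hb]; group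
      _ = u * (u⁻¹ * b * (t * u * t)) * (t * u * t)⁻¹ := by rw [hgg, inv_mul_cancel]; group

end Swap

section NonAbelian
variable {G : Type*} [Group G] {p o : Sylow 37 G} {X Y : Subgroup G} {t w α h : G}

lemma Arith.eq_of_smul_eq [Finite G] (hA : Arith G) (hop : o ≠ p) {u v : G} (hu : u ∈ p)
    (hv : v ∈ p)
    (huv : u • o = v • o) : u = v := by
  have h1 := hA.eq_one_of_smul_eq hop (p.mul_mem (p.inv_mem hv) hu)
    (by rw [mul_smul, huv, inv_smul_smul])
  exact (inv_mul_eq_one.1 h1).symm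

namespace Coord
variable {φ : G → F} {e : twoPt p o ≃* Fˣ}

lemma map_one (hφ : Coord p o X φ e) : φ 1 = 0 :=
  (hφ.eq_zero_iff 1 p.one_mem).2 X.one_mem

lemma map_inv (hφ : Coord p o X φ e) {u : G} (hu : u ∈ p) : φ u⁻¹ = -φ u := by
  have := hφ.map_mul u hu u⁻¹ (p.inv_mem hu)
  rw [mul_inv_cancel, hφ.map_one] at this
  exact eq_neg_of_add_eq_zero_right this.symm

lemma mem_of_eq (hφ : Coord p o X φ e) {u v : G} (hu : u ∈ p) (hv : v ∈ p) (huv : φ u = φ v) :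
    u * v⁻¹ ∈ X := by
  rw [← hφ.eq_zero_iff _ (p.mul_mem hu (p.inv_mem hv)), hφ.map_mul u hu _ (p.inv_mem hv),
    hφ.map_inv hv, huv, add_neg_cancel]

end Coord

namespace Frame.Swap

lemma mul_mul (S : Frame.Swap p o X Y t w α h) (g : G) : w * (w * g) = g := by
  rw [← mul_assoc, S.sq, one_mul]

lemma smul_smul (S : Frame.Swap p o X Y t w α h) (q : Sylow 37 G) : w • w • q = q := by
  rw [← mul_smul, S.sq, one_smul]

/-- Conjugation by `w` on the two-point stabilizer. -/
def twist (S : Frame.Swap p o X Y t w α h) : twoPt p o →* twoPt p o where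
  toFun k := ⟨w * k * w, mem_twoPt.2 ⟨by
    rw [mul_smul, mul_smul, S.wp, (mem_twoPt.1 k.2).2, S.wo], by
    rw [mul_smul, mul_smul, S.wo, (mem_twoPt.1 k.2).1, S.wp]⟩⟩
  map_one' := Subtype.ext (by simp [S.sq])
  map_mul' k l := Subtype.ext (by simp [mul_assoc, S.mul_mul])

lemma coe_twist (S : Frame.Swap p o X Y t w α h) (k : twoPt p o) : (S.twist k : G) = w * k * w :=
    rfl

lemma twist_twist (S : Frame.Swap p o X Y t w α h) (k : twoPt p o) : S.twist (S.twist k) = k :=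
  Subtype.ext (by simp [coe_twist, mul_assoc, S.mul_mul, S.sq])

lemma twist_of_mem (S : Frame.Swap p o X Y t w α h) {k : twoPt p o} (hk : (k : G) ∈ Y) :
    S.twist k = k :=
  Subtype.ext (by rw [coe_twist, ← Subgroup.mem_centralizer_iff.1 S.wY k hk, mul_assoc, S.sq,
      mul_one])

lemma smul_conj (S : Frame.Swap p o X Y t w α h) (k : twoPt p o) {u v : G}
    (huv : w • u • o = v • o) :
    w • (k * u * (k : G)⁻¹) • o = (S.twist k * v * (S.twist k : G)⁻¹) • o := by
  have h1 : ∀ l : twoPt p o, (l : G)⁻¹ • o = o := fun l =>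
    (mem_twoPt.1 (Subgroup.inv_mem _ l.2)).2
  rw [mul_smul, mul_smul, h1, mul_smul, mul_smul, h1, ← huv, coe_twist, mul_smul, mul_smul,
    S.smul_smul]

lemma smul_alpha (S : Frame.Swap p o X Y t w α h) {t' : Sylow 37 G} :
    w • α • w • t' = h • w • (t * h * t)⁻¹ • t' := by
  simp only [← mul_smul]
  congr 1
  simpa only [mul_assoc] using S.rel

lemma smul_alpha_smul (ht : Frame.Invo p o X t) (S : Frame.Swap p o X Y t w α h) :
    w • α • o = h • o := by
  have h1 := S.smul_alpha (t' := p)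
  rwa [S.wp, smul_self_of_mem (p.inv_mem (ht.conj_mem S.hp)), S.wp] at h1

lemma smul_mul (S : Frame.Swap p o X Y t w α h) {u v v' : G} (huv : w • u • o = v • o)
    (hv : w • ((t * h * t)⁻¹ * v) • o = v' • o) : w • (α * u) • o = (h * v') • o := by
  have h1 := S.smul_alpha (t' := w • u • o)
  rw [S.smul_smul, huv] at h1
  rw [mul_smul, h1, mul_smul h, ← hv, mul_smul _ v]

end Frame.Swap

lemma Frame.Invo.eq_one_of_mem (h' : Frame p o X Y) (ht : Frame.Invo p o X t) {x : G} (hx : x ∈ X)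
    (hi : t * x * t = x⁻¹) : x = 1 := by
  refine h'.eq_one_of_mem_X_of_pow hx (n := 2) (by norm_num) ?_
  rw [ht.conj_X hx] at hi
  rw [pow_two]
  nth_rw 1 [hi]
  exact inv_mul_cancel x

lemma Frame.exists_mul_ne [Finite G] (hA : Arith G) (hf : Frame p o X Y) (ht : Frame.Invo p o X t)
    (S : Frame.Swap p o X Y t w α h) : ∃ a ∈ p, ∃ b ∈ p, a * b ≠ b * a := by
  by_contra! hcom
  obtain ⟨φ, e, hφ, hφα⟩ := hf.exists_coord hA S.mem S.notMem
  obtain ⟨y, hy, hyo, -⟩ := hf.exists_generator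
  have hinj : ∀ u ∈ p, ∀ v ∈ p, t * u * t = u⁻¹ → t * v * t = v⁻¹ → φ u = φ v → u = v := by
    intro u hu v hv htu htv huv
    have h1 := hφ.mem_of_eq hu hv huv
    refine mul_inv_eq_one.1 (ht.eq_one_of_mem hf h1 ?_)
    have h2 : t * v⁻¹ * t = v := by
      calc t * v⁻¹ * t = (t⁻¹ * v * t⁻¹)⁻¹ := by group
        _ = v := by rw [ht.inv, htv, inv_inv]
    calc _ = t * u * 1 * v⁻¹ * t := by group
      _ = (t * u * t) * (t * v⁻¹ * t) := by rw [← ht.sq]; group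
      _ = _ := by rw [htu, h2, hcom _ (p.inv_mem hu) _ hv]; group
  have hconj : ∀ k : twoPt p o, ∀ u, t * u * t = u⁻¹ →
      t * (k * u * (k : G)⁻¹) * t = (k * u * (k : G)⁻¹)⁻¹ := by
    intro k u hu
    have h1 := ht.commute hA hf k.2
    have h2 := ht.commute hA hf (Subgroup.inv_mem _ k.2)
    calc _ = t * k * u * ((k : G)⁻¹ * t) := by group
      _ = k * (t * u * t) * (k : G)⁻¹ := by rw [← h1, h2]; group
      _ = _ := by rw [hu]; group
  have hkp : ∀ k : twoPt p o, ∀ u ∈ p, k * u * (k : G)⁻¹ ∈ p := fun k u hu =>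
    conj_mem_of_mem_twoPt k.2 hu
  obtain ⟨i, hi, hti, x, hx, hix⟩ := ht.exists_mul hA hf S.hp
  have hh' : (t * h * t)⁻¹ = x⁻¹ * i := by
    have : t * h * t = i⁻¹ * x := by
      calc t * h * t = t * i * 1 * x * t := by rw [hix]; group
        _ = (t * i * t) * (t * x * t) := by rw [← ht.sq]; group
        _ = _ := by rw [hti, ht.conj_X hx]
    rw [this]; group
  have hφh : φ h = φ i := by
    rw [hix, hφ.map_mul i hi x (hf.cfg.XQ hx), (hφ.eq_zero_iff x (hf.cfg.XQ hx)).2 hx, add_zero]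
  have hm19 : ∀ m : twoPt p o, (m : G) ∈ Y → m ^ 19 = 1 := fun m hm => Subtype.ext <| by
    have h1 : (⟨m, hm⟩ : Y) ^ Nat.card Y = 1 := pow_card_eq_one'
    rw [hf.cfg.cardY] at h1
    simpa using congrArg Subtype.val h1
  have hne : ∀ m : twoPt p o, (m : G) ∈ Y → (1 : F) + e m ≠ 0 := by
    intro m hm h0
    have h1 : (e m : F) = -1 := (neg_eq_of_add_eq_zero_right h0).symm
    have h2 : (e m : F) ^ 19 = 1 := by
      rw [← Units.val_pow_eq_pow_val, ← map_pow, hm19 m hm, map_one, Units.val_one]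
    rw [h1] at h2
    refine (Ring.two_ne_zero (R := F) ?_) ?_
    · rw [ringChar.eq F 37]; norm_num
    · linear_combination (-1 : F) * h2
  have hφm : ∀ m : twoPt p o, φ (α * (m * α * (m : G)⁻¹)) = 1 + e m := fun m => by
    rw [hφ.map_mul α S.mem _ (hkp m α S.mem), hφ.conj m α S.mem, hφα, mul_one]
  have hsm : ∀ m : twoPt p o, (m : G) ∈ Y → (m * h * (m : G)⁻¹) = m * i * (m : G)⁻¹ * x := by
    intro m hm
    have := Subgroup.mem_centralizer_iff.1 (hf.cfg.YX hm) x hx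
    calc _ = m * i * (x * (m : G)⁻¹) := by rw [hix]; group
      _ = m * i * (m : G)⁻¹ * (m * x) * (m : G)⁻¹ := by group
      _ = _ := by rw [← this]; group
  have hw : ∀ m : twoPt p o, (m : G) ∈ Y →
      (t * h * t)⁻¹ * (m * h * (m : G)⁻¹) = i * (m * i * (m : G)⁻¹) := by
    intro m hm
    have h1 := hf.commute (p.mul_mem hi (hkp m i hi)) hx
    calc _ = x⁻¹ * (i * (m * i * (m : G)⁻¹) * x) := by rw [hh', hsm m hm]; group
      _ = _ := by rw [← h1]; group
  have hwm : ∀ m : twoPt p o, (m : G) ∈ Y →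
      w • (m * α * (m : G)⁻¹) • o = (m * h * (m : G)⁻¹) • o := by
    intro m hm
    have h1 := S.smul_conj m (S.smul_alpha_smul ht)
    rwa [S.twist_of_mem hm] at h1
  have hφi : φ i ≠ 0 := by
    intro h0
    have hi1 : i = 1 := ht.eq_one_of_mem hf ((hφ.eq_zero_iff i hi).1 h0) hti
    let m : twoPt p o := ⟨y, hf.Y_le hy⟩
    have h1 := S.smul_alpha (t' := w • (m * α * (m : G)⁻¹) • o)
    rw [S.smul_smul, hwm m hy, ← mul_smul (t * h * t)⁻¹, hw m hy, hi1, mul_one, mul_inv_cancel,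
        mul_one,
      one_smul, S.wo, smul_self_of_mem S.hp] at h1
    have h2 : (α * (m * α * (m : G)⁻¹)) • o = o := by
      rw [mul_smul, ← S.smul_smul (α • _), h1, S.wp]
    have h3 := hA.eq_one_of_smul_eq hf.ne (p.mul_mem S.mem (hkp m α S.mem)) h2
    refine hne m hy ?_
    rw [← hφm m, h3, hφ.map_one]
  have hφh' : φ h ≠ 0 := hφh ▸ hφi
  let κ : twoPt p o := e.symm (Units.mk0 (φ i) hφi)
  have hiκ : κ * α * (κ : G)⁻¹ = i := by
    refine hinj _ (hkp κ α S.mem) _ hi (hconj κ α S.conj) hti ?_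
    rw [hφ.conj κ α S.mem, hφα, mul_one, e.apply_symm_apply, Units.val_mk0]
  have key : ∀ m s : twoPt p o, (m : G) ∈ Y → (e s : F) = 1 + e m →
      (e (S.twist s) : F) * (1 - e (S.twist κ)) = 1 := by
    intro m s hm hs
    have h1 : α * (m * α * (m : G)⁻¹) = s * α * (s : G)⁻¹ := by
      refine hinj _ (p.mul_mem S.mem (hkp m α S.mem)) _ (hkp s α S.mem) ?_ (hconj s α S.conj) ?_
      · calc t * (α * (m * α * (m : G)⁻¹)) * t = t * α * 1 * (m * α * (m : G)⁻¹) * t := by group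
          _ = (t * α * t) * (t * (m * α * (m : G)⁻¹) * t) := by rw [← ht.sq]; group
          _ = _ := by
            rw [S.conj, hconj m α S.conj, ← mul_inv_rev, hcom _ (hkp m α S.mem) _ S.mem]
      · rw [hφm, hφ.conj s α S.mem, hφα, mul_one, hs]
    have h2 : i * (m * i * (m : G)⁻¹) = (κ * s : twoPt p o) * α * ((κ * s : twoPt p o) : G)⁻¹ := by
      have hmκ := Subgroup.mem_centralizer_iff.1 (hf.twoPt_le_centralizer hA κ.2) m hm
      calc _ = κ * α * (κ : G)⁻¹ * (m * κ * α * (m * κ : G)⁻¹) := by rw [← hiκ]; group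
        _ = κ * (α * (m * α * (m : G)⁻¹)) * (κ : G)⁻¹ := by rw [hmκ]; group
        _ = _ := by rw [h1, Subgroup.coe_mul]; group
    have h3 := S.smul_conj (κ * s) (S.smul_alpha_smul ht)
    rw [← h2, ← hw m hm] at h3
    have h4 := S.smul_mul (hwm m hm) h3
    rw [h1, S.smul_conj s (S.smul_alpha_smul ht)] at h4
    have h5 := hA.eq_of_smul_eq hf.ne (hkp _ h S.hp) (p.mul_mem S.hp (hkp _ h S.hp)) h4
    have h6 := congrArg φ h5
    rw [hφ.map_mul h S.hp _ (hkp _ h S.hp), hφ.conj _ h S.hp, hφ.conj _ h S.hp, map_mul, map_mul,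
      Units.val_mul] at h6
    refine mul_right_cancel₀ hφh' ?_
    linear_combination h6
  let m : twoPt p o := ⟨y, hf.Y_le hy⟩
  have hm2 : ((m ^ 2 : twoPt p o) : G) ∈ Y := Y.pow_mem hy 2
  have h1 := key m (e.symm (Units.mk0 _ (hne m hy))) hy (by simp)
  have h2 := key (m ^ 2) (e.symm (Units.mk0 _ (hne _ hm2))) hm2 (by simp)
  have h3 := mul_right_cancel₀ (right_ne_zero_of_mul_eq_one h1) (h1.trans h2.symm)
  have h4 := congrArg S.twist (e.injective (Units.ext h3))
  rw [S.twist_twist, S.twist_twist] at h4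
  have h5 : (1 : F) + e m = 1 + e (m ^ 2) := congrArg Units.val (e.symm.injective h4)
  have h6 := e.injective (Units.ext (add_left_cancel h5))
  rw [pow_two, left_eq_mul] at h6
  have h7 : y = 1 := congrArg Subtype.val h6
  rw [h7, orderOf_one] at hyo
  norm_num at hyo

end NonAbelian

section Conjugation

/-- The involutory automorphism of `F`. -/
noncomputable abbrev bar : F →+* F := frobenius F 37

lemma bar_bar (a : F) : bar (bar a) = a := by
  have := Fintype.ofFinite F
  rw [frobenius_def, frobenius_def, ← pow_mul]
  have h := FiniteField.pow_card a
  rwa [← Nat.card_eq_fintype_card, card_F] at h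

lemma bar_eq_self_iff {a : F} : bar a = a ↔ ∃ s : ZMod 37, algebraMap (ZMod 37) F s = a := by
  have h := ZMod.fieldRange_castHom_eq_bot 37 (K := F)
  rw [frobenius_def, ← Subfield.mem_bot_iff_pow_eq_self, ← h]
  exact exists_congr fun s => by rw [Subsingleton.elim (ZMod.castHom (dvd_refl 37) F)]

lemma bar_algebraMap (s : ZMod 37) : bar (algebraMap (ZMod 37) F s) = algebraMap (ZMod 37) F s :=
  bar_eq_self_iff.2 ⟨s, rfl⟩

lemma two_ne_zero_F : (2 : F) ≠ 0 := by
  have h := (CharP.cast_eq_zero_iff F 37 2).not.2 (by norm_num)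
  exact_mod_cast h

lemma exists_generator_units : ∃ g : Fˣ, orderOf g = 1368 ∧ ∀ x, x ∈ Subgroup.zpowers g := by
  obtain ⟨g, hg⟩ := IsCyclic.exists_generator (α := Fˣ)
  refine ⟨g, ?_, hg⟩
  rw [orderOf_eq_card_of_forall_mem_zpowers hg, Nat.card_units, card_F]
  norm_num

lemma exists_bar_eq_neg : ∃ z : F, z ≠ 0 ∧ bar z = -z := by
  obtain ⟨g, hg, -⟩ := exists_generator_units
  have h1 : (g ^ 684) ^ 2 = 1 := by rw [← pow_mul, show 684 * 2 = orderOf g from hg.symm,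
      pow_orderOf_eq_one]
  have h2 : g ^ 684 ≠ 1 := fun h => by
    have := Nat.le_of_dvd (by norm_num) (orderOf_dvd_of_pow_eq_one h)
    omega
  refine ⟨((g ^ 19 : Fˣ) : F), Units.ne_zero _, ?_⟩
  have h3 : (((g ^ 684 : Fˣ) : F)) = -1 := by
    have h4 := congrArg Units.val h1
    rw [Units.val_pow_eq_pow_val, Units.val_one, pow_two, mul_self_eq_one_iff] at h4
    exact h4.resolve_left fun h => h2 (Units.ext h)
  have h5 : g ^ 684 * g ^ 19 = (g ^ 19) ^ 37 := by rw [← pow_mul, ← pow_add]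
  rw [frobenius_def, ← Units.val_pow_eq_pow_val, ← h5, Units.val_mul, h3, neg_one_mul]

lemma exists_algebraMap_add {ε : F} (hε0 : ε ≠ 0) (hε : bar ε = -ε) (a : F) :
    ∃ s r : ZMod 37, a = algebraMap (ZMod 37) F s + algebraMap (ZMod 37) F r * ε := by
  have h2 := two_ne_zero_F
  have hb2 : bar 2 = 2 := map_ofNat bar 2
  obtain ⟨s, hs⟩ := bar_eq_self_iff.1 (show bar ((a + bar a) / 2) = (a + bar a) / 2 by
    rw [map_div₀, map_add, bar_bar, hb2, add_comm])
  obtain ⟨r, hr⟩ := bar_eq_self_iff.1 (show bar ((a - bar a) / (2 * ε)) = (a - bar a) / (2 * ε) by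
    rw [map_div₀, map_sub, bar_bar, map_mul, hb2, hε]; field_simp; ring)
  refine ⟨s, r, ?_⟩
  rw [hs, hr]
  field_simp
  ring

end Conjugation

section Commutator
variable {G : Type*} [Group G] [Finite G] {p o : Sylow 37 G} {X Y : Subgroup G} {t w α h : G}
  {φ : G → F} {e : twoPt p o ≃* Fˣ}

/-- A coordinate on `X` in which the commutator map of `p` takes its standard form. -/
structure Coord.Center (p o : Sylow 37 G) (X : Subgroup G) (φ : G → F) (e : twoPt p o ≃* Fˣ)
    (θ : G → F) : Prop where
  map_mul : ∀ x ∈ X, ∀ y ∈ X, θ (x * y) = θ x + θ y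
  eq_one : ∀ x ∈ X, θ x = 0 → x = 1
  bar : ∀ x ∈ X, bar (θ x) = -θ x
  surj : ∀ z, _root_.bar z = -z → ∃ x ∈ X, θ x = z
  comm : ∀ u ∈ p, ∀ v ∈ p, θ (u * v * u⁻¹ * v⁻¹) = φ u * _root_.bar (φ v) - _root_.bar (φ u) * φ v
  conj : ∀ k : twoPt p o, ∀ x ∈ X, θ (k * x * (k : G)⁻¹) = e k * _root_.bar (e k) * θ x

omit [Finite G] in
lemma Frame.exists_linear (hf : Frame p o X Y) : ∃ θ : G → ZMod 37,
    (∀ x ∈ X, ∀ y ∈ X, θ (x * y) = θ x + θ y) ∧ (∀ x ∈ X, θ x = 0 → x = 1) ∧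
    ∀ s, ∃ x ∈ X, θ x = s := by
  classical
  let θ : X ≃* Multiplicative (ZMod 37) := mulEquivOfPrimeCardEq hf.cfg.cardX (by simp)
  refine ⟨fun g => if hg : g ∈ X then (θ ⟨g, hg⟩).toAdd else 0, ?_, ?_, ?_⟩
  · intro x hx y hy
    beta_reduce
    rw [dif_pos hx, dif_pos hy, dif_pos (X.mul_mem hx hy), ← toAdd_mul, ← map_mul]
    rfl
  · intro x hx h0
    beta_reduce at h0
    rw [dif_pos hx, toAdd_eq_zero, map_eq_one_iff θ θ.injective] at h0
    exact congrArg Subtype.val h0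
  · intro s
    refine ⟨θ.symm (Multiplicative.ofAdd s), SetLike.coe_mem _, ?_⟩
    beta_reduce
    rw [dif_pos (SetLike.coe_mem _)]
    simp

omit [Finite G] in
lemma Coord.map_pow (hφ : Coord p o X φ e) {u : G} (hu : u ∈ p) (n : ℕ) : φ (u ^ n) = n * φ u := by
  induction n with
  | zero => simp [hφ.map_one]
  | succ n ih =>
    rw [pow_succ, hφ.map_mul _ ((p : Subgroup G).pow_mem hu n) _ hu, ih]
    push_cast
    ring

lemma Frame.exists_bilinear (hA : Arith G) (hf : Frame p o X Y) (hφ : Coord p o X φ e)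
    (hne : ∃ a ∈ p, ∃ b ∈ p, a * b ≠ b * a) {ε : F} {θ : G → ZMod 37}
    (hθ : ∀ x ∈ X, ∀ y ∈ X, θ (x * y) = θ x + θ y) (hθ0 : ∀ x ∈ X, θ x = 0 → x = 1)
    (hdec : ∀ a : F, ∃ s r : ZMod 37, a = algebraMap (ZMod 37) F s + algebraMap (ZMod 37) F r * ε) :
    ∃ d : ZMod 37, d ≠ 0 ∧ ∀ u ∈ p, ∀ v ∈ p, ∀ s r s' r' : ZMod 37,
      φ u = algebraMap (ZMod 37) F s + algebraMap (ZMod 37) F r * ε →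
      φ v = algebraMap (ZMod 37) F s' + algebraMap (ZMod 37) F r' * ε →
      θ (u * v * u⁻¹ * v⁻¹) = (s * r' - r * s') * d := by
  have hθ1 : θ 1 = 0 := by simpa using hθ 1 X.one_mem 1 X.one_mem
  have hcX : ∀ u ∈ p, ∀ v ∈ p, u * v * u⁻¹ * v⁻¹ ∈ X := fun u hu v hv => hf.commutator_mem hA hu hv
  have hadd : ∀ u ∈ p, ∀ u' ∈ p, ∀ v ∈ p, θ (u * u' * v * (u * u')⁻¹ * v⁻¹) =
      θ (u * v * u⁻¹ * v⁻¹) + θ (u' * v * u'⁻¹ * v⁻¹) := by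
    intro u hu u' hu' v hv
    have h1 := hf.commute hu (hcX u' hu' v hv)
    rw [add_comm, ← hθ _ (hcX u' hu' v hv) _ (hcX u hu v hv)]
    congr 1
    calc _ = u * (u' * v * u'⁻¹ * v⁻¹) * (v * u⁻¹ * v⁻¹) := by group
      _ = _ := by rw [← h1]; group
  have hsymm : ∀ u ∈ p, ∀ v ∈ p, θ (v * u * v⁻¹ * u⁻¹) = -θ (u * v * u⁻¹ * v⁻¹) := by
    intro u hu v hv
    have h1 := hθ _ (hcX v hv u hu) _ (hcX u hu v hv)
    rw [show v * u * v⁻¹ * u⁻¹ * (u * v * u⁻¹ * v⁻¹) = 1 by group, hθ1] at h1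
    exact eq_neg_of_add_eq_zero_left h1.symm
  have hself : ∀ u : G, θ (u * u * u⁻¹ * u⁻¹) = 0 := fun u => by simp [hθ1]
  have hpow : ∀ u ∈ p, ∀ v ∈ p, ∀ n : ℕ, θ (u ^ n * v * (u ^ n)⁻¹ * v⁻¹) =
      n * θ (u * v * u⁻¹ * v⁻¹) := by
    intro u hu v hv n
    induction n with
    | zero => simp [hθ1]
    | succ n ih =>
      rw [pow_succ, hadd _ ((p : Subgroup G).pow_mem hu n) _ hu _ hv, ih]
      push_cast
      ring
  have hcongr : ∀ u ∈ p, ∀ u' ∈ p, ∀ v ∈ p, φ u = φ u' →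
      θ (u * v * u⁻¹ * v⁻¹) = θ (u' * v * u'⁻¹ * v⁻¹) := by
    intro u hu u' hu' v hv huu
    have h1 := hφ.mem_of_eq hu hu' huu
    have h2 := hadd (u * u'⁻¹) (hf.cfg.XQ h1) u' hu' v hv
    rw [inv_mul_cancel_right] at h2
    rw [h2, hf.commute hv h1, mul_inv_cancel_right, mul_inv_cancel, hθ1, zero_add]
  obtain ⟨a, ha, hφa⟩ := hφ.surj 1
  obtain ⟨b, hb, hφb⟩ := hφ.surj ε
  have hlin : ∀ u ∈ p, ∀ v ∈ p, ∀ s r : ZMod 37,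
      φ u = algebraMap (ZMod 37) F s + algebraMap (ZMod 37) F r * ε →
      θ (u * v * u⁻¹ * v⁻¹) = s * θ (a * v * a⁻¹ * v⁻¹) + r * θ (b * v * b⁻¹ * v⁻¹) := by
    intro u hu v hv s r hsr
    have h1 := (p : Subgroup G).pow_mem ha s.val
    have h2 := (p : Subgroup G).pow_mem hb r.val
    have hval : ∀ s : ZMod 37, ((s.val : ℕ) : F) = algebraMap (ZMod 37) F s := fun s => by
      rw [← map_natCast (algebraMap (ZMod 37) F), ZMod.natCast_zmod_val]
    rw [hcongr u hu (a ^ s.val * b ^ r.val) (p.mul_mem h1 h2) v hv, hadd _ h1 _ h2 v hv,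
      hpow a ha v hv, hpow b hb v hv, ZMod.natCast_zmod_val, ZMod.natCast_zmod_val]
    rw [hφ.map_mul _ h1 _ h2, hφ.map_pow ha, hφ.map_pow hb, hφa, hφb, hsr, hval, hval, mul_one]
  have hbil : ∀ u ∈ p, ∀ v ∈ p, ∀ s r s' r' : ZMod 37,
      φ u = algebraMap (ZMod 37) F s + algebraMap (ZMod 37) F r * ε →
      φ v = algebraMap (ZMod 37) F s' + algebraMap (ZMod 37) F r' * ε →
      θ (u * v * u⁻¹ * v⁻¹) = (s * r' - r * s') * θ (a * b * a⁻¹ * b⁻¹) := by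
    intro u hu v hv s r s' r' h1 h2
    rw [hlin u hu v hv s r h1, hsymm v hv a ha, hsymm v hv b hb, hlin v hv a ha s' r' h2,
      hlin v hv b hb s' r' h2, hself, hself, hsymm a ha b hb]
    ring
  refine ⟨_, fun h0 => ?_, hbil⟩
  obtain ⟨u, hu, v, hv, huv⟩ := hne
  obtain ⟨s, r, h1⟩ := hdec (φ u)
  obtain ⟨s', r', h2⟩ := hdec (φ v)
  have h3 := hbil u hu v hv s r s' r' h1 h2
  rw [h0, mul_zero] at h3
  have h4 := hθ0 _ (hcX u hu v hv) h3
  exact huv (mul_inv_eq_iff_eq_mul.1 (mul_inv_eq_one.1 h4))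

lemma Coord.exists_center (hA : Arith G) (hf : Frame p o X Y) (hφ : Coord p o X φ e)
    (hne : ∃ a ∈ p, ∃ b ∈ p, a * b ≠ b * a) : ∃ θ, Coord.Center p o X φ e θ := by
  obtain ⟨ε, hε0, hε⟩ := exists_bar_eq_neg
  have hdec := exists_algebraMap_add hε0 hε
  obtain ⟨η, hη, hη0, hηs⟩ := hf.exists_linear
  obtain ⟨d, hd, hbil⟩ := hf.exists_bilinear hA hφ hne hη hη0 hdec
  have hinj := (algebraMap (ZMod 37) F).injective
  have h2 := two_ne_zero_F
  let θ : G → F := fun x => algebraMap (ZMod 37) F (η x * d⁻¹) * (-2 * ε)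
  have hmul : ∀ x ∈ X, ∀ y ∈ X, θ (x * y) = θ x + θ y := by
    intro x hx y hy
    simp only [θ, hη x hx y hy, add_mul, map_add]
  have hθ0 : ∀ x ∈ X, θ x = 0 → x = 1 := by
    intro x hx h0
    simp only [θ, mul_eq_zero, neg_eq_zero, h2, hε0, or_false] at h0
    rw [map_eq_zero, mul_eq_zero, inv_eq_zero] at h0
    exact hη0 x hx (h0.resolve_right hd)
  have hθb : ∀ s : ZMod 37, bar (algebraMap (ZMod 37) F s * (-2 * ε)) =
      -(algebraMap (ZMod 37) F s * (-2 * ε)) := by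
    intro s
    rw [_root_.map_mul, _root_.map_mul, bar_algebraMap, hε, map_neg, map_ofNat]
    ring
  have hθs : ∀ z, bar z = -z → ∃ x ∈ X, θ x = z := by
    intro z hz
    obtain ⟨s, hs⟩ := bar_eq_self_iff.1 (show bar (z / (-2 * ε)) = z / (-2 * ε) by
      rw [map_div₀, hz, _root_.map_mul, hε, map_neg, map_ofNat]; field_simp)
    obtain ⟨x, hx, hxs⟩ := hηs (s * d)
    refine ⟨x, hx, ?_⟩
    change algebraMap (ZMod 37) F (η x * d⁻¹) * (-2 * ε) = z
    rw [hxs, mul_inv_cancel_right₀ hd, hs]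
    field_simp
  have hcomm : ∀ u ∈ p, ∀ v ∈ p,
      θ (u * v * u⁻¹ * v⁻¹) = φ u * bar (φ v) - bar (φ u) * φ v := by
    intro u hu v hv
    obtain ⟨s, r, h1⟩ := hdec (φ u)
    obtain ⟨s', r', h2⟩ := hdec (φ v)
    simp only [θ]
    rw [hbil u hu v hv s r s' r' h1 h2, mul_inv_cancel_right₀ hd, h1, h2]
    simp only [_root_.map_mul, map_add, map_sub, bar_algebraMap, hε]
    ring
  refine ⟨θ, hmul, hθ0, fun x _ => hθb _, hθs, hcomm, ?_⟩
  intro k x hx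
  have hεk : bar (θ x / (-2 * ε)) = θ x / (-2 * ε) := by
    have : bar (θ x) = -θ x := hθb _
    rw [map_div₀, this, _root_.map_mul, hε, map_neg, map_ofNat]; field_simp
  obtain ⟨u, hu, hφu⟩ := hφ.surj (θ x / (-2 * ε))
  obtain ⟨v, hv, hφv⟩ := hφ.surj ε
  have hX : u * v * u⁻¹ * v⁻¹ ∈ X := hf.commutator_mem hA hu hv
  have h3 : θ (u * v * u⁻¹ * v⁻¹) = θ x := by
    rw [hcomm u hu v hv, hφu, hφv, hε, hεk]
    field_simp
    ring
  have h4 : u * v * u⁻¹ * v⁻¹ = x := by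
    have h5 := hmul (u * v * u⁻¹ * v⁻¹ * x⁻¹) (X.mul_mem hX (X.inv_mem hx)) x hx
    rw [inv_mul_cancel_right, h3, right_eq_add] at h5
    exact mul_inv_eq_one.1 (hθ0 _ (X.mul_mem hX (X.inv_mem hx)) h5)
  have hku := conj_mem_of_mem_twoPt k.2 hu
  have hkv := conj_mem_of_mem_twoPt k.2 hv
  have h6 : k * x * (k : G)⁻¹ = (k * u * (k : G)⁻¹) * (k * v * (k : G)⁻¹) * (k * u * (k : G)⁻¹)⁻¹ *
      (k * v * (k : G)⁻¹)⁻¹ := by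
    rw [← h4]; group
  rw [h6, hcomm _ hku _ hkv, hφ.conj k u hu, hφ.conj k v hv, ← h3, hcomm u hu v hv,
    _root_.map_mul, _root_.map_mul]
  ring

end Commutator

section Heisenberg

/-- The Sylow `37`-subgroup of the unitary group, in coordinates. -/
structure Heis where
  a : F
  z : F
  bar_z : bar z = -z

namespace Heis

@[ext]
lemma ext {u v : Heis} (ha : u.a = v.a) (hz : u.z = v.z) : u = v := by
  obtain ⟨a, z, h⟩ := u
  obtain ⟨b, y, h'⟩ := v
  change a = b at ha
  change z = y at hz
  subst ha hz
  rfl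

noncomputable instance : Mul Heis := ⟨fun u v =>
  ⟨u.a + v.a, u.z + v.z + (u.a * bar v.a - bar u.a * v.a) / 2, by
    have h2 := two_ne_zero_F
    rw [map_add, map_add, map_div₀, map_sub, map_mul, map_mul, bar_bar, bar_bar, u.bar_z, v.bar_z,
      map_ofNat]
    field_simp
    ring⟩⟩

noncomputable instance : One Heis := ⟨⟨0, 0, by rw [map_zero, neg_zero]⟩⟩

noncomputable instance : Inv Heis := ⟨fun u => ⟨-u.a, -u.z, by rw [map_neg, u.bar_z]⟩⟩

lemma mul_a (u v : Heis) : (u * v).a = u.a + v.a := rfl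
lemma mul_z (u v : Heis) : (u * v).z = u.z + v.z + (u.a * bar v.a - bar u.a * v.a) / 2 := rfl
lemma one_a : (1 : Heis).a = 0 := rfl
lemma one_z : (1 : Heis).z = 0 := rfl
lemma inv_a (u : Heis) : u⁻¹.a = -u.a := rfl
lemma inv_z (u : Heis) : u⁻¹.z = -u.z := rfl

noncomputable instance : Group Heis := Group.ofLeftAxioms
  (fun u v w => by
    ext
    · simp only [mul_a]; ring
    · simp only [mul_a, mul_z, map_add]; ring)
  (fun u => by
    ext
    · simp only [mul_a, one_a, zero_add]
    · simp only [mul_z, one_a, one_z, map_zero]; ring)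
  (fun u => by
    ext
    · simp only [mul_a, one_a, inv_a, neg_add_cancel]
    · simp only [mul_z, one_z, inv_z, inv_a, map_neg]; ring)

noncomputable instance : MulAction Fˣ Heis where
  smul τ u := ⟨τ * u.a, τ * bar τ * u.z, by
    rw [map_mul, map_mul, bar_bar, u.bar_z]; ring⟩
  one_smul u := by
    ext
    · exact (congrArg (· * u.a) Units.val_one).trans (one_mul _)
    · change ((1 : Fˣ) : F) * bar ((1 : Fˣ) : F) * u.z = u.z
      rw [Units.val_one, map_one, one_mul, one_mul]
  mul_smul τ σ u := by
    ext
    · change ((τ * σ : Fˣ) : F) * u.a = τ * (σ * u.a)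
      rw [Units.val_mul, mul_assoc]
    · change ((τ * σ : Fˣ) : F) * bar ((τ * σ : Fˣ) : F) * u.z = τ * bar τ * (σ * bar σ * u.z)
      rw [Units.val_mul, map_mul]
      ring

lemma smul_a (τ : Fˣ) (u : Heis) : (τ • u).a = τ * u.a := rfl
lemma smul_z (τ : Fˣ) (u : Heis) : (τ • u).z = τ * bar τ * u.z := rfl

/-- The image of `u⁻¹` under the involution in the two-point stabilizer. -/
noncomputable def flip (u : Heis) : Heis := ⟨u.a, -u.z, by rw [map_neg, u.bar_z]⟩

lemma flip_a (u : Heis) : u.flip.a = u.a := rfl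
lemma flip_z (u : Heis) : u.flip.z = -u.z := rfl

/-- The element `(1, 0)`. -/
noncomputable def base : Heis := ⟨1, 0, by rw [map_zero, neg_zero]⟩

lemma base_a : base.a = 1 := rfl
lemma base_z : base.z = 0 := rfl

end Heis

end Heisenberg

section Model
variable {G : Type*} [Group G] [Finite G] {p o : Sylow 37 G} {X Y : Subgroup G} {t w α h : G}
  {φ θ : G → F} {e : twoPt p o ≃* Fˣ}

lemma Frame.Invo.exists_heis (hA : Arith G) (hf : Frame p o X Y) (ht : Frame.Invo p o X t)
    (hφ : Coord p o X φ e) (hθ : Coord.Center p o X φ e θ) :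
    ∃ Φ : (p : Subgroup G) ≃* Heis, ∀ u, (Φ u).a = φ u ∧ (Φ u).z = θ (u * (t * u * t)) / 2 := by
  have h2 := two_ne_zero_F
  have hs : ∀ u ∈ p, u * (t * u * t) ∈ X := fun u hu => ht.mul_conj_mem hA hf hu
  have hφt : ∀ u ∈ p, φ (t * u * t) = -φ u := by
    intro u hu
    have h1 := (hφ.eq_zero_iff _ (p.mul_mem hu (ht.conj_mem hu))).2 (hs u hu)
    rw [hφ.map_mul u hu _ (ht.conj_mem hu)] at h1
    exact eq_neg_of_add_eq_zero_right h1
  let f : (p : Subgroup G) →* Heis :=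
    MonoidHom.mk' (fun u => ⟨φ u, θ (u * (t * u * t)) / 2, by
      rw [map_div₀, hθ.bar _ (hs u u.2), map_ofNat, neg_div]⟩) (by
      rintro ⟨u, hu⟩ ⟨v, hv⟩
      ext
      · exact hφ.map_mul u hu v hv
      · change θ (u * v * (t * (u * v) * t)) / 2 = θ (u * (t * u * t)) / 2 + θ
          (v * (t * v * t)) / 2 +
          (φ u * bar (φ v) - bar (φ u) * φ v) / 2
        have htu := ht.conj_mem hu
        have hc : v * (t * u * t) * v⁻¹ * (t * u * t)⁻¹ ∈ X := hf.commutator_mem hA hv htu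
        have h3 : u * v * (t * (u * v) * t) = v * (t * u * t) * v⁻¹ * (t * u * t)⁻¹ *
            (u * (t * u * t) * (v * (t * v * t))) := by
          calc _ = u * v * (t * u * 1 * v * t) := by group
            _ = u * (v * (t * u * t) * v⁻¹ * (t * u * t)⁻¹) * ((t * u * t) * (v * (t * v * t))) := by
              rw [← ht.sq]; group
            _ = _ := by rw [← hf.commute hu hc]; group
        rw [h3, hθ.map_mul _ hc _ (X.mul_mem (hs u hu) (hs v hv)), hθ.map_mul _ (hs u hu) _
            (hs v hv),
          hθ.comm v hv _ htu, hφt u hu, map_neg]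
        ring)
  have hfX : ∀ x ∈ X, θ (x * (t * x * t)) / 2 = θ x := by
    intro x hx
    rw [ht.conj_X hx, hθ.map_mul x hx x hx]
    field_simp
    ring
  have hinj : Function.Injective f := by
    rw [injective_iff_map_eq_one]
    rintro ⟨u, hu⟩ h1
    have hux : u ∈ X := (hφ.eq_zero_iff u hu).1 (congrArg Heis.a h1)
    have h3 : θ (u * (t * u * t)) / 2 = 0 := congrArg Heis.z h1
    rw [hfX u hux] at h3
    exact Subtype.ext (hθ.eq_one u hux h3)
  have hsurj : Function.Surjective f := by
    intro v
    obtain ⟨u, hu, hua⟩ := hφ.surj v.a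
    obtain ⟨x, hx, hxz⟩ := hθ.surj (v.z - (f ⟨u, hu⟩).z) (by
      rw [map_sub, v.bar_z, (f ⟨u, hu⟩).bar_z]; ring)
    have hφx : φ x = 0 := (hφ.eq_zero_iff x (hf.cfg.XQ hx)).2 hx
    refine ⟨⟨x, hf.cfg.XQ hx⟩ * ⟨u, hu⟩, ?_⟩
    rw [map_mul]
    ext
    · change φ x + φ u = v.a
      rw [hφx, hua, zero_add]
    · change θ (x * (t * x * t)) / 2 + (f ⟨u, hu⟩).z + (φ x * bar (φ u) - bar (φ x) * φ u) / 2 = v.z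
      rw [hfX x hx, hxz, hφx, map_zero]
      ring
  exact ⟨MulEquiv.ofBijective f ⟨hinj, hsurj⟩, fun u => ⟨rfl, rfl⟩⟩

/-- A description of `G` in coordinates. -/
structure Model (p o : Sylow 37 G) (Φ : (p : Subgroup G) ≃* Heis) (e : twoPt p o ≃* Fˣ) (w : G)
    (ε : Fˣ →* Fˣ) (l : Heis) : Prop where
  ne : o ≠ p
  wp : w • p = o
  wo : w • o = p
  sq : w * w = 1
  conj : ∀ (k : twoPt p o) (u : (p : Subgroup G)), ∃ h, Φ ⟨k * u * (k : G)⁻¹, h⟩ = e k • Φ u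
  twist : ∀ τ, w * e.symm τ * w = e.symm (ε τ)
  fix : ∀ τ, τ ^ 38 = 1 → ε τ = τ
  rel : w * Φ.symm Heis.base * w = Φ.symm l * w * Φ.symm l.flip

lemma Arith.exists_model (hA : Arith G) :
    ∃ (p o : Sylow 37 G) (Φ : (p : Subgroup G) ≃* Heis) (e : twoPt p o ≃* Fˣ) (w : G)
      (ε : Fˣ →* Fˣ) (l : Heis), Model p o Φ e w ε l := by
  obtain ⟨p, o, X, Y, hf⟩ := hA.exists_frame
  obtain ⟨t, ht⟩ := hf.exists_invo hA
  obtain ⟨w, α, h, S⟩ := ht.exists_Swap hA hf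
  obtain ⟨φ, e, hφ, hφα⟩ := hf.exists_coord hA S.mem S.notMem
  obtain ⟨θ, hθ⟩ := hφ.exists_center hA hf (hf.exists_mul_ne hA ht S)
  obtain ⟨Φ, hΦ⟩ := ht.exists_heis hA hf hφ hθ
  have hs : ∀ u ∈ p, u * (t * u * t) ∈ X := fun u hu => ht.mul_conj_mem hA hf hu
  have hbase : Φ.symm Heis.base = ⟨α, S.mem⟩ := by
    rw [MulEquiv.symm_apply_eq]
    ext
    · rw [(hΦ _).1]; exact hφα.symm
    · rw [(hΦ _).2]
      change 0 = θ (α * (t * α * t)) / 2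
      rw [S.conj, mul_inv_cancel, ← mul_inv_cancel (1 : G)]
      have := hθ.map_mul 1 X.one_mem 1 X.one_mem
      simp only [mul_one, left_eq_add] at this
      simp [this]
  have hflip : Φ.symm (Φ ⟨h, S.hp⟩).flip = ⟨(t * h * t)⁻¹, p.inv_mem (ht.conj_mem S.hp)⟩ := by
    rw [MulEquiv.symm_apply_eq]
    have h1 : (⟨(t * h * t)⁻¹, p.inv_mem (ht.conj_mem S.hp)⟩ : (p : Subgroup G)) =
      ⟨t * h * t, ht.conj_mem S.hp⟩⁻¹ := rfl
    rw [h1, map_inv]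
    have h3 := hs h S.hp
    ext
    · rw [Heis.inv_a, Heis.flip_a, (hΦ _).1, (hΦ _).1]
      have h2 := (hφ.eq_zero_iff _ (p.mul_mem S.hp (ht.conj_mem S.hp))).2 h3
      rw [hφ.map_mul h S.hp _ (ht.conj_mem S.hp)] at h2
      exact eq_neg_of_add_eq_zero_left h2
    · rw [Heis.inv_z, Heis.flip_z, (hΦ _).2, (hΦ _).2, ht.conj_conj]
      have h2 : t * h * t * h = h * (t * h * t) := by
        calc _ = h⁻¹ * (h * (t * h * t)) * h := by group
          _ = _ := by rw [mul_assoc, hf.commute S.hp h3]; group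
      rw [h2]
  have htt : S.twist ⟨t, ht.mem⟩ = ⟨t, ht.mem⟩ :=
    Subtype.ext (by rw [S.coe_twist, ← S.tw, mul_assoc, S.sq, mul_one])
  obtain ⟨y, hy, hyo, -⟩ := hf.exists_generator
  let c : twoPt p o := ⟨t, ht.mem⟩ * ⟨y, hf.Y_le hy⟩
  have hc : S.twist c = c := by
    rw [map_mul, htt, S.twist_of_mem (k := ⟨y, hf.Y_le hy⟩) hy]
  have hco : orderOf c = 38 := by
    have h1 : orderOf (⟨t, ht.mem⟩ : twoPt p o) = 2 := by
      rw [Subgroup.orderOf_mk]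
      exact orderOf_eq_prime (by rw [pow_two, ht.sq]) ht.ne
    have h2 : orderOf (⟨y, hf.Y_le hy⟩ : twoPt p o) = 19 := by rwa [Subgroup.orderOf_mk]
    have h3 : Commute (⟨t, ht.mem⟩ : twoPt p o) ⟨y, hf.Y_le hy⟩ :=
      Subtype.ext (ht.commute hA hf (hf.Y_le hy)).symm
    rw [h3.orderOf_mul_eq_mul_orderOf_of_coprime (by rw [h1, h2]; norm_num), h1, h2]
  have hprim : IsPrimitiveRoot (e c) 38 := by
    rw [← hco, ← MulEquiv.orderOf_eq e c]
    exact IsPrimitiveRoot.orderOf _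
  refine ⟨p, o, Φ, e, w, (e : twoPt p o →* Fˣ).comp (S.twist.comp (e.symm : Fˣ →* twoPt p o)),
    Φ ⟨h, S.hp⟩, hf.ne, S.wp, S.wo, S.sq, ?_, ?_, ?_, ?_⟩
  · intro k u
    have hk := conj_mem_of_mem_twoPt k.2 u.2
    refine ⟨hk, ?_⟩
    ext
    · rw [(hΦ _).1, Heis.smul_a, (hΦ _).1, ← hφ.conj k u u.2]
    · rw [(hΦ _).2, Heis.smul_z, (hΦ _).2, ← mul_div_assoc, ← hθ.conj k _ (hs u u.2)]
      congr 2
      have h1 := ht.commute hA hf k.2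
      have h2 := ht.commute hA hf (Subgroup.inv_mem _ k.2)
      calc _ = (k : G) * u * (k : G)⁻¹ * (t * k * u * ((k : G)⁻¹ * t)) := by simp only [mul_assoc]
        _ = (k : G) * u * (k : G)⁻¹ * (k * t * u * (t * (k : G)⁻¹)) := by rw [h1, h2]
        _ = _ := by group
  · intro τ
    simp [S.coe_twist]
  · intro τ hτ
    obtain ⟨i, -, hi⟩ := (hprim.map_of_injective Units.coeHom_injective).eq_pow_of_pow_eq_one
      (ξ := (τ : F)) (by rw [← Units.val_pow_eq_pow_val, hτ, Units.val_one])
    obtain rfl : (e c) ^ i = τ := Units.ext (by rw [Units.val_pow_eq_pow_val]; exact hi)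
    simp [hc]
  · rw [hbase, hflip, MulEquiv.symm_apply_apply]
    exact S.rel

end Model

namespace Heis

/-- An involutory map on the nontrivial elements of `Heis` satisfying the relations of an involution
of the unitary group swapping two isotropic points. -/
structure Inversion (f : Heis → Heis) (ε : Fˣ →* Fˣ) (l : Heis) : Prop where
  ne_one : ∀ u, u ≠ 1 → f u ≠ 1
  invol : ∀ u, u ≠ 1 → f (f u) = u
  smul : ∀ (τ : Fˣ) u, u ≠ 1 → f (τ • u) = ε τ • f u
  fix : ∀ τ : Fˣ, (τ : F) * bar τ = 1 → ε τ = τ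
  map_base : f base = l
  rel : ∀ u, u ≠ 1 → base * u ≠ 1 → l.flip * f u ≠ 1 ∧ f (base * u) = l * f (l.flip * f u)

lemma ne_one_of_a {u : Heis} (h : u.a ≠ 0) : u ≠ 1 := by
  rintro rfl
  exact h rfl

lemma base_ne_one : base ≠ 1 := ne_one_of_a one_ne_zero

/-- The element `(1, x)`. -/
noncomputable def unip (x : F) (hx : bar x = -x) : Heis := ⟨1, x, hx⟩

lemma unip_a (x : F) (hx : bar x = -x) : (unip x hx).a = 1 := rfl
lemma unip_z (x : F) (hx : bar x = -x) : (unip x hx).z = x := rfl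

lemma unip_ne_one (x : F) (hx : bar x = -x) : unip x hx ≠ 1 := ne_one_of_a one_ne_zero

lemma bar_div_norm {z a : F} (hz : bar z = -z) : bar (z / (a * bar a)) = -(z / (a * bar a)) := by
  rw [map_div₀, map_mul, bar_bar, hz, neg_div, mul_comm]

lemma eq_smul_unip {u : Heis} (h : u.a ≠ 0) :
    u = Units.mk0 u.a h • unip (u.z / (u.a * bar u.a)) (bar_div_norm u.bar_z) := by
  have h2 : bar u.a ≠ 0 := (map_ne_zero bar).2 h
  ext
  · rw [smul_a, Units.val_mk0, unip_a, mul_one]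
  · rw [smul_z, Units.val_mk0, unip_z]
    field_simp

lemma one_add_ne_zero {y : F} (hy : bar y = -y) : 1 + y ≠ 0 := by
  intro h
  have h1 : y = -1 := eq_neg_of_add_eq_zero_right h
  rw [h1, map_neg, map_one, neg_neg] at hy
  exact two_ne_zero_F (by linear_combination -hy)

lemma one_add_two_mul_ne_zero {x : F} (hx : bar x = -x) : 1 + 2 * x ≠ 0 :=
  one_add_ne_zero (by rw [map_mul, hx, map_ofNat, mul_neg])

lemma one_sub_two_mul_ne_zero {x : F} (hx : bar x = -x) : 1 - 2 * x ≠ 0 := by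
  rw [sub_eq_add_neg]
  exact one_add_ne_zero (by rw [map_neg, map_mul, hx, map_ofNat, mul_neg])

/-- The scalar `2 / (1 + 2x)`. -/
noncomputable def scal (x : F) (hx : bar x = -x) : Fˣ :=
  Units.mk0 (2 / (1 + 2 * x)) (div_ne_zero two_ne_zero_F (one_add_two_mul_ne_zero hx))

lemma coe_scal (x : F) (hx : bar x = -x) : (scal x hx : F) = 2 / (1 + 2 * x) := rfl

/-- The scalar `(1 - 2x) / (1 + 2x)`, of norm one. -/
noncomputable def cayley (x : F) (hx : bar x = -x) : Fˣ :=
  Units.mk0 ((1 - 2 * x) / (1 + 2 * x))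
    (div_ne_zero (one_sub_two_mul_ne_zero hx) (one_add_two_mul_ne_zero hx))

lemma coe_cayley (x : F) (hx : bar x = -x) : (cayley x hx : F) = (1 - 2 * x) / (1 + 2 * x) := rfl

lemma bar_scal (x : F) (hx : bar x = -x) : bar (scal x hx) = 2 / (1 - 2 * x) := by
  rw [coe_scal, map_div₀, map_add, map_mul, map_one, map_ofNat, hx, mul_neg, sub_eq_add_neg]

lemma bar_cayley (x : F) (hx : bar x = -x) :
    bar (cayley x hx) = (1 + 2 * x) / (1 - 2 * x) := by
  rw [coe_cayley, map_div₀, map_add, map_sub, map_mul, map_one, map_ofNat, hx, mul_neg,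
    sub_eq_add_neg, sub_eq_add_neg, neg_neg]

lemma cayley_norm (x : F) (hx : bar x = -x) : (cayley x hx : F) * bar (cayley x hx) = 1 := by
  have h1 := one_add_two_mul_ne_zero hx
  have h2 := one_sub_two_mul_ne_zero hx
  rw [bar_cayley, coe_cayley]
  field_simp

lemma base_mul_cayley (x : F) (hx : bar x = -x) :
    base * cayley x hx • base = scal x hx • unip x hx := by
  have h1 := one_add_two_mul_ne_zero hx
  have h2 := one_sub_two_mul_ne_zero hx
  have h3 := two_ne_zero_F
  ext
  · rw [mul_a, smul_a, smul_a, base_a, unip_a, coe_cayley, coe_scal]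
    field_simp
    ring
  · rw [mul_z, smul_z, smul_z, smul_a, base_a, base_z, unip_z, mul_one, map_one, bar_cayley,
      bar_scal, coe_cayley, coe_scal]
    field_simp
    ring

lemma exists_cayley {m : Fˣ} (hm : (m : F) * bar m = 1) (hm1 : (m : F) ≠ -1) :
    ∃ x, ∃ hx : bar x = -x, cayley x hx = m := by
  have h2 := two_ne_zero_F
  have hm0 : (m : F) ≠ 0 := m.ne_zero
  have h1 : 1 + (m : F) ≠ 0 := fun h => hm1 (eq_neg_of_add_eq_zero_right h)
  have hb : bar (m : F) = 1 / m := by rw [eq_div_iff hm0, mul_comm, hm]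
  have hx : bar ((1 - (m : F)) / (2 * (1 + m))) = -((1 - (m : F)) / (2 * (1 + m))) := by
    rw [map_div₀, map_mul, map_sub, map_add, map_one, hb, map_ofNat]
    have h4 : (m : F) + 1 ≠ 0 := by rwa [add_comm]
    have h5 : 1 + 1 / (m : F) ≠ 0 := by
      rw [show 1 + 1 / (m : F) = (m + 1) / m by field_simp]
      exact div_ne_zero h4 hm0
    field_simp
    ring
  refine ⟨_, hx, Units.ext ?_⟩
  have h5 := one_add_two_mul_ne_zero hx
  rw [coe_cayley, div_eq_iff h5]
  field_simp
  ring

namespace Inversion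
variable {f : Heis → Heis} {ε : Fˣ →* Fˣ} {l : Heis}

lemma inj (hf : Inversion f ε l) {u v : Heis} (hu : u ≠ 1) (hv : v ≠ 1) (h : f u = f v) : u = v := by
  rw [← hf.invol u hu, h, hf.invol v hv]

lemma smul_ne_one {u : Heis} (hu : u ≠ 1) (τ : Fˣ) : τ • u ≠ 1 := by
  intro h
  refine hu ?_
  have h1 : τ⁻¹ • (1 : Heis) = 1 := by
    ext
    · rw [smul_a, one_a, mul_zero]
    · rw [smul_z, one_z, mul_zero]
  rw [← inv_smul_smul τ u, h, h1]

lemma neg_one_norm : ((-1 : Fˣ) : F) * bar ((-1 : Fˣ) : F) = 1 := by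
  rw [Units.val_neg, Units.val_one, map_neg, map_one, neg_mul_neg, mul_one]

lemma l_a_ne_zero (hf : Inversion f ε l) : l.a ≠ 0 := by
  intro h
  have h1 := hf.smul (-1) base base_ne_one
  have h2 : (-1 : Fˣ) • l = l := by
    ext
    · rw [smul_a, h, mul_zero]
    · rw [smul_z, neg_one_norm, one_mul]
  rw [hf.fix _ neg_one_norm, hf.map_base, h2, ← hf.map_base] at h1
  have h3 := congrArg a (hf.inj (smul_ne_one base_ne_one _) base_ne_one h1)
  rw [smul_a, base_a, Units.val_neg, Units.val_one, mul_one] at h3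
  exact two_ne_zero_F (by linear_combination -h3)

lemma eps_eps (hf : Inversion f ε l) (τ : Fˣ) : ε (ε τ) = τ := by
  have h1 := hf.invol _ (smul_ne_one base_ne_one τ)
  rw [hf.smul _ _ base_ne_one, hf.smul _ _ (hf.ne_one _ base_ne_one), hf.invol _ base_ne_one] at h1
  have h2 := congrArg a h1
  rw [smul_a, smul_a, base_a, mul_one, mul_one] at h2
  exact Units.ext h2

lemma rel_scal (hf : Inversion f ε l) (x : F) (hx : bar x = -x) :
    f (scal x hx • unip x hx) =
      l * ε (Units.mk0 l.a hf.l_a_ne_zero) • f (scal x hx • unip x hx) := by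
  have hu := smul_ne_one (unip_ne_one x hx) (scal x hx)
  have h1 := (hf.rel (cayley x hx • base) (smul_ne_one base_ne_one _)
    (by rwa [base_mul_cayley])).2
  rw [base_mul_cayley, hf.smul _ _ base_ne_one, hf.fix _ (cayley_norm x hx), hf.map_base] at h1
  have h2 : l.flip * cayley x hx • l = Units.mk0 l.a hf.l_a_ne_zero • (scal x hx • unip x hx) := by
    rw [← base_mul_cayley]
    have h3 := cayley_norm x hx
    ext
    · simp only [mul_a, smul_a, flip_a, base_a, Units.val_mk0]
      ring
    · simp only [mul_z, smul_z, flip_z, flip_a, smul_a, base_z, base_a, Units.val_mk0, map_mul,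
        map_one, h3]
      ring
  rwa [h2, hf.smul _ _ hu] at h1

lemma norm_eps (hf : Inversion f ε l) :
    (ε (Units.mk0 l.a hf.l_a_ne_zero) : F) * bar (ε (Units.mk0 l.a hf.l_a_ne_zero)) = 1 := by
  by_contra hn
  obtain ⟨x, hx0, hx⟩ := exists_bar_eq_neg
  set e := ε (Units.mk0 l.a hf.l_a_ne_zero) with he
  have h1 := hf.rel_scal x hx
  have h0 : bar (0 : F) = -0 := by rw [map_zero, neg_zero]
  have h2 := hf.rel_scal 0 h0
  rw [← he] at h1 h2
  have ha1 := congrArg a h1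
  have ha2 := congrArg a h2
  have hz1 := congrArg z h1
  have hz2 := congrArg z h2
  rw [mul_a, smul_a] at ha1 ha2
  rw [mul_z, smul_z, smul_a] at hz1 hz2
  have he1 : (1 : F) - e ≠ 0 := fun h => hf.l_a_ne_zero (by
    linear_combination -ha1 + (f (scal x hx • unip x hx)).a * h)
  have hn' : (1 : F) - e * bar e ≠ 0 := fun h => hn (by linear_combination -h)
  have haa : (f (scal x hx • unip x hx)).a = (f (scal 0 h0 • unip 0 h0)).a :=
    mul_left_cancel₀ he1 (by linear_combination ha1 - ha2)
  rw [haa] at hz1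
  have hzz : (f (scal x hx • unip x hx)).z = (f (scal 0 h0 • unip 0 h0)).z :=
    mul_left_cancel₀ hn' (by linear_combination hz1 - hz2)
  have h3 := congrArg a (hf.inj (smul_ne_one (unip_ne_one _ _) _) (smul_ne_one (unip_ne_one _ _) _)
    (Heis.ext haa hzz))
  rw [smul_a, smul_a, unip_a, unip_a, coe_scal, coe_scal, mul_one, mul_one, mul_zero, add_zero,
    div_one, div_eq_iff (one_add_two_mul_ne_zero hx)] at h3
  refine hx0 (mul_left_cancel₀ (mul_ne_zero two_ne_zero_F two_ne_zero_F) ?_)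
  linear_combination -h3

lemma eps_l_a (hf : Inversion f ε l) :
    ε (Units.mk0 l.a hf.l_a_ne_zero) = Units.mk0 l.a hf.l_a_ne_zero := by
  rw [← hf.fix _ hf.norm_eps, hf.eps_eps]

lemma l_a_norm (hf : Inversion f ε l) : l.a * bar l.a = 1 := by
  have h := hf.norm_eps
  rwa [hf.eps_l_a, Units.val_mk0] at h

lemma l_a_ne_one (hf : Inversion f ε l) : 1 - l.a ≠ 0 := by
  intro h
  have h0 : bar (0 : F) = -0 := by rw [map_zero, neg_zero]
  have h1 := congrArg a (hf.rel_scal 0 h0)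
  rw [hf.eps_l_a, mul_a, smul_a, Units.val_mk0] at h1
  exact hf.l_a_ne_zero (by linear_combination -h1 + (f (scal 0 h0 • unip 0 h0)).a * h)

lemma scal_a (hf : Inversion f ε l) (x : F) (hx : bar x = -x) :
    (f (scal x hx • unip x hx)).a = l.a / (1 - l.a) := by
  have h1 := congrArg a (hf.rel_scal x hx)
  rw [hf.eps_l_a, mul_a, smul_a, Units.val_mk0] at h1
  rw [eq_div_iff hf.l_a_ne_one]
  linear_combination h1

lemma l_z (hf : Inversion f ε l) : 2 * l.z = l.a / (1 - l.a) - bar (l.a / (1 - l.a)) := by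
  have h0 : bar (0 : F) = -0 := by rw [map_zero, neg_zero]
  have h1 := congrArg z (hf.rel_scal 0 h0)
  have h2 := two_ne_zero_F
  rw [hf.eps_l_a, mul_z, smul_z, smul_a, Units.val_mk0, hf.l_a_norm, hf.scal_a, map_mul] at h1
  have h3 := hf.l_a_norm
  set A := l.a / (1 - l.a)
  field_simp at h1
  linear_combination -h1 + (A - bar A) * h3

end Inversion

end Heis

namespace Heis

lemma bar_val (τ : Fˣ) : bar (τ : F) = ((τ ^ 37 : Fˣ) : F) := by
  rw [frobenius_def, Units.val_pow_eq_pow_val]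

lemma scal_eq (x : F) (hx : bar x = -x) : scal x hx = cayley x hx * scal x hx ^ 37 := by
  have h1 := one_add_two_mul_ne_zero hx
  have h2 := one_sub_two_mul_ne_zero hx
  ext
  rw [Units.val_mul, ← bar_val, bar_scal, coe_cayley, coe_scal]
  field_simp

namespace Inversion
variable {f : Heis → Heis} {ε : Fˣ →* Fˣ} {l : Heis}

/-- The common first coordinate of the images of the elements `scal x • unip x`. -/
noncomputable def slope (hf : Inversion f ε l) : Fˣ :=
  Units.mk0 (l.a / (1 - l.a)) (div_ne_zero hf.l_a_ne_zero hf.l_a_ne_one)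

lemma slope_eq (hf : Inversion f ε l) :
    hf.slope = -Units.mk0 l.a hf.l_a_ne_zero * hf.slope ^ 37 := by
  have h1 := hf.l_a_norm
  have h2 := hf.l_a_ne_one
  have h3 : 1 - bar l.a ≠ 0 := fun h => h2 (by linear_combination -l.a * h - h1)
  ext
  rw [Units.val_mul, ← bar_val, Units.val_neg, Units.val_mk0, slope, Units.val_mk0, map_div₀,
    map_sub, map_one]
  field_simp
  linear_combination -l.a * h1

lemma exists_partner (hf : Inversion f ε l) (x : F) (hx : bar x = -x) :
    ∃ y, ∃ hy : bar y = -y, f (scal x hx • unip x hx) = hf.slope • unip y hy ∧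
      ε (hf.slope * (scal y hy)⁻¹) * hf.slope = scal x hx := by
  have ha := hf.scal_a x hx
  have ha0 : (f (scal x hx • unip x hx)).a ≠ 0 := by
    rw [ha]; exact div_ne_zero hf.l_a_ne_zero hf.l_a_ne_one
  have h1 := eq_smul_unip ha0
  have h2 : Units.mk0 _ ha0 = hf.slope := Units.ext ha
  rw [h2] at h1
  refine ⟨_, bar_div_norm (Heis.bar_z _), h1, ?_⟩
  set y := (f (scal x hx • unip x hx)).z /
    ((f (scal x hx • unip x hx)).a * bar (f (scal x hx • unip x hx)).a)
  have hy : bar y = -y := bar_div_norm (Heis.bar_z _)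
  have h3 := hf.invol _ (smul_ne_one (unip_ne_one x hx) (scal x hx))
  rw [h1, ← inv_mul_cancel_right hf.slope (scal y hy), mul_smul, hf.smul _ _
    (smul_ne_one (unip_ne_one y hy) _)] at h3
  have h4 := congrArg a h3
  rw [smul_a, smul_a, unip_a, mul_one, hf.scal_a y hy] at h4
  exact Units.ext h4

lemma cayley_mul (hf : Inversion f ε l) {x y : F} {hx : bar x = -x} {hy : bar y = -y}
    (h : ε (hf.slope * (scal y hy)⁻¹) * hf.slope = scal x hx) :
    cayley x hx * cayley y hy = Units.mk0 l.a hf.l_a_ne_zero ^ 2 := by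
  set L := Units.mk0 l.a hf.l_a_ne_zero with hL
  have h1 : hf.slope * (scal y hy)⁻¹ = -L * (cayley y hy)⁻¹ * (hf.slope * (scal y hy)⁻¹) ^ 37 := by
    conv_lhs => rw [hf.slope_eq, scal_eq]
    rw [mul_pow, inv_pow, mul_inv]
    exact mul_mul_mul_comm _ _ _ _
  have h2 : ε (-L * (cayley y hy)⁻¹) = -L * (cayley y hy)⁻¹ := by
    refine hf.fix _ ?_
    have h5 := cayley_norm y hy
    have h6 := hf.l_a_norm
    have h7 : (L : F) = l.a := rfl
    rw [Units.val_mul, map_mul, Units.val_neg, map_neg, h7, Units.val_inv_eq_inv_val, map_inv₀,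
      mul_mul_mul_comm, ← mul_inv, h5, neg_mul_neg, h6, inv_one, one_mul]
  have h3 : scal x hx = L ^ 2 * (cayley y hy)⁻¹ * scal x hx ^ 37 := by
    calc _ = -L * (cayley y hy)⁻¹ * ε (hf.slope * (scal y hy)⁻¹) ^ 37 * (-L * hf.slope ^ 37) := by
          rw [← hf.slope_eq, ← map_pow, ← h2, ← map_mul, ← h1, h]
      _ = -L * -L * (cayley y hy)⁻¹ * (ε (hf.slope * (scal y hy)⁻¹) ^ 37 * hf.slope ^ 37) := by
          rw [mul_mul_mul_comm, mul_right_comm (-L)]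
      _ = _ := by rw [← mul_pow, h, neg_mul_neg, pow_two]
  have h4 := (scal_eq x hx).symm.trans h3
  rw [mul_right_cancel h4, inv_mul_cancel_right]

lemma cayley_ne (x : F) (hx : bar x = -x) : (cayley x hx : F) ≠ -1 := by
  rw [coe_cayley, Ne, div_eq_iff (one_add_two_mul_ne_zero hx)]
  intro h
  exact two_ne_zero_F (by linear_combination h)

lemma l_a_eq (hf : Inversion f ε l) : l.a = -1 := by
  by_contra hne
  have h1 : l.a * l.a ≠ 1 := fun h => (mul_self_eq_one_iff.1 h).elim
    (fun h => hf.l_a_ne_one (by rw [h, sub_self])) hne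
  set L := Units.mk0 l.a hf.l_a_ne_zero with hL
  have hLa : (L : F) = l.a := rfl
  have hm : ((-L ^ 2 : Fˣ) : F) = -(l.a * l.a) := by
    rw [Units.val_neg, Units.val_pow_eq_pow_val, hLa, pow_two]
  obtain ⟨x, hx, hxL⟩ := exists_cayley (m := -L ^ 2)
    (by rw [hm, map_neg, neg_mul_neg, map_mul, mul_mul_mul_comm, hf.l_a_norm, one_mul])
    (by rw [hm]; exact fun h => h1 (neg_injective h))
  obtain ⟨y, hy, -, h⟩ := hf.exists_partner x hx
  have h2 := hf.cayley_mul h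
  rw [hxL, neg_mul, ← hL, ← mul_neg, mul_eq_left] at h2
  refine cayley_ne y hy ?_
  rw [neg_eq_iff_eq_neg.1 h2, Units.val_neg, Units.val_one]

lemma slope_val (hf : Inversion f ε l) : (hf.slope : F) = -1 / 2 := by
  have h2 := two_ne_zero_F
  rw [slope, Units.val_mk0, hf.l_a_eq, sub_neg_eq_add, one_add_one_eq_two]

lemma l_z_eq (hf : Inversion f ε l) : l.z = 0 := by
  have h2 := two_ne_zero_F
  have h1 := hf.l_z
  rw [hf.l_a_eq, sub_neg_eq_add, one_add_one_eq_two, map_div₀, map_neg, map_one, map_ofNat,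
    sub_self] at h1
  exact (mul_eq_zero.1 h1).resolve_left h2

lemma partner_eq (hf : Inversion f ε l) {x : F} (hx : bar x = -x) (hx' : bar (-x) = -(-x)) :
    f (scal x hx • unip x hx) = hf.slope • unip (-x) hx' ∧
      ε (hf.slope * (scal (-x) hx')⁻¹) * hf.slope = scal x hx := by
  obtain ⟨y, hy, h1, h2⟩ := hf.exists_partner x hx
  obtain rfl : y = -x := by
    have h3 := congrArg Units.val (hf.cayley_mul h2)
    rw [Units.val_mul, Units.val_pow_eq_pow_val, Units.val_mk0, hf.l_a_eq, coe_cayley, coe_cayley,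
      div_mul_div_comm, div_eq_iff (mul_ne_zero (one_add_two_mul_ne_zero hx)
      (one_add_two_mul_ne_zero hy))] at h3
    refine mul_left_cancel₀ (mul_ne_zero two_ne_zero_F two_ne_zero_F) ?_
    linear_combination -h3
  exact ⟨h1, h2⟩

lemma bar_neg {x : F} (hx : bar x = -x) : bar (-x) = -(-x) := by rw [map_neg, hx]

lemma eps_one_add (hf : Inversion f ε l) {y : F} (hy : bar y = -y) (τ : Fˣ) (hτ : (τ : F) = 1 + y) :
    ε τ * τ ^ 37 = 1 := by
  have h2 := two_ne_zero_F
  have key : ∀ x, ∀ hx : bar x = -x, ε (hf.slope * (scal (-x) (bar_neg hx))⁻¹) *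
      (hf.slope * (scal (-x) (bar_neg hx))⁻¹) ^ 37 = 1 := by
    intro x hx
    have h1 := (hf.partner_eq hx (bar_neg hx)).2
    have h3 := one_add_two_mul_ne_zero hx
    refine mul_right_cancel (b := hf.slope) ?_
    rw [mul_right_comm, h1, one_mul]
    ext
    rw [Units.val_mul, ← bar_val, Units.val_mul, map_mul, Units.val_inv_eq_inv_val, map_inv₀,
      bar_scal, coe_scal, hf.slope_val, map_div₀, map_neg, map_one, map_ofNat, mul_neg,
          sub_neg_eq_add]
    field_simp
  have h0 : bar (0 : F) = -0 := by rw [map_zero, neg_zero]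
  have hy2 : bar (y / 2) = -(y / 2) := by rw [map_div₀, hy, map_ofNat, neg_div]
  have h4 : τ = hf.slope * (scal (-(-(y / 2))) (bar_neg (bar_neg hy2)))⁻¹ *
      (hf.slope * (scal (-0) (bar_neg h0))⁻¹)⁻¹ := by
    ext
    rw [hτ, ← div_eq_mul_inv, mul_div_mul_left_eq_div, Units.val_div_eq_div_val,
      Units.val_inv_eq_inv_val, Units.val_inv_eq_inv_val, coe_scal, coe_scal]
    field_simp
    ring
  rw [h4, map_mul, mul_pow, mul_mul_mul_comm, key _ (bar_neg hy2), map_inv, inv_pow, ← mul_inv,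
    key _ h0, inv_one, one_mul]

lemma eps_mul_pow (hf : Inversion f ε l) (τ : Fˣ) : ε τ * τ ^ 37 = 1 := by
  have hmul : ∀ σ τ : Fˣ, ε σ * σ ^ 37 = 1 → ε τ * τ ^ 37 = 1 →
      ε (σ * τ) * (σ * τ) ^ 37 = 1 := by
    intro σ τ h1 h2
    rw [map_mul, mul_pow, mul_mul_mul_comm, h1, h2, one_mul]
  have hinv : ∀ σ τ : Fˣ, ε (σ * τ) * (σ * τ) ^ 37 = 1 → ε τ * τ ^ 37 = 1 → ε σ * σ ^ 37 = 1 := by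
    intro σ τ h1 h2
    rwa [map_mul, mul_pow, mul_mul_mul_comm, h2, mul_one] at h1
  obtain ⟨ι, hι0, hι⟩ := exists_bar_eq_neg
  have hreal : ∀ τ : Fˣ, bar (τ : F) = τ → ε τ * τ ^ 37 = 1 := by
    intro τ hτ
    have hy : bar (((τ : F) - 1) / ι) = -(((τ : F) - 1) / ι) := by
      rw [map_div₀, map_sub, hτ, map_one, hι, div_neg]
    have hz : bar ((ι + ((τ : F) - 1) / ι) / τ) = -((ι + ((τ : F) - 1) / ι) / τ) := by
      rw [map_div₀, map_add, hy, hι, hτ]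
      ring
    refine hinv τ (Units.mk0 _ (one_add_ne_zero hz)) ?_ (hf.eps_one_add hz _ rfl)
    have h1 : τ * Units.mk0 _ (one_add_ne_zero hz) =
        Units.mk0 _ (one_add_ne_zero hι) * Units.mk0 _ (one_add_ne_zero hy) := by
      ext
      have := τ.ne_zero
      rw [Units.val_mul, Units.val_mul, Units.val_mk0, Units.val_mk0, Units.val_mk0]
      field_simp
      ring
    rw [h1]
    exact hmul _ _ (hf.eps_one_add hι _ rfl) (hf.eps_one_add hy _ rfl)
  have h2 := two_ne_zero_F
  have hgen : ∀ τ : Fˣ, (τ : F) + bar τ ≠ 0 → ε τ * τ ^ 37 = 1 := by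
    intro τ hτ
    have hy : bar (((τ : F) - bar τ) / (τ + bar τ)) = -(((τ : F) - bar τ) / (τ + bar τ)) := by
      rw [map_div₀, map_sub, map_add, bar_bar, add_comm, ← neg_div, neg_sub]
    have hr : bar (((τ : F) + bar τ) / 2) = ((τ : F) + bar τ) / 2 := by
      rw [map_div₀, map_add, bar_bar, map_ofNat, add_comm]
    have h1 : τ = Units.mk0 _ (div_ne_zero hτ h2) * Units.mk0 _ (one_add_ne_zero hy) := by
      ext
      rw [Units.val_mul, Units.val_mk0, Units.val_mk0]
      field_simp
      ring
    rw [h1]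
    exact hmul _ _ (hreal _ hr) (hf.eps_one_add hy _ rfl)
  by_cases hτ : (τ : F) + bar τ = 0
  · have hτ' : bar (τ : F) = -τ := eq_neg_of_add_eq_zero_right hτ
    refine hinv τ (Units.mk0 ι hι0) (hreal _ ?_) ?_
    · rw [Units.val_mul, map_mul, Units.val_mk0, hι, hτ', neg_mul_neg]
    · refine hinv _ (Units.mk0 _ (one_add_ne_zero hι)) (hgen _ ?_) (hf.eps_one_add hι _ rfl)
      rw [Units.val_mul, map_mul, Units.val_mk0, Units.val_mk0, map_add, map_one, hι]
      intro h
      refine mul_ne_zero h2 (mul_ne_zero hι0 hι0) ?_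
      linear_combination h
  · exact hgen τ hτ

lemma eps_val (hf : Inversion f ε l) (τ : Fˣ) : (ε τ : F) = (bar (τ : F))⁻¹ := by
  rw [bar_val, ← Units.val_inv_eq_inv_val, eq_inv_of_mul_eq_one_left (hf.eps_mul_pow τ)]

lemma apply_of_ne (hf : Inversion f ε l) {u : Heis} (hu : u.a ≠ 0) :
    (f u).a = -u.a / (u.a * bar u.a - 2 * u.z) ∧
      (f u).z = -u.z / ((u.a * bar u.a - 2 * u.z) * (u.a * bar u.a + 2 * u.z)) := by
  have h2 := two_ne_zero_F
  have hu' : bar u.a ≠ 0 := (map_ne_zero bar).2 hu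
  set x := u.z / (u.a * bar u.a) with hxdef
  have hx : bar x = -x := bar_div_norm u.bar_z
  have hux : u.z = x * (u.a * bar u.a) := by rw [hxdef, div_mul_cancel₀ _ (mul_ne_zero hu hu')]
  have h3 := (hf.partner_eq hx (bar_neg hx)).1
  have h5 := one_add_two_mul_ne_zero hx
  have h6 := one_sub_two_mul_ne_zero hx
  have hb : bar (2 / (1 - 2 * x)) = 2 / (1 + 2 * x) := by rw [← bar_scal x hx, bar_bar, coe_scal]
  have h7 : u = (Units.mk0 u.a hu * (scal x hx)⁻¹) • scal x hx • unip x hx := by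
    rw [smul_smul, inv_mul_cancel_right]
    exact eq_smul_unip hu
  have h4 : ∀ v, f u = v → v.a = -u.a / (u.a * bar u.a - 2 * u.z) ∧
      v.z = -u.z / ((u.a * bar u.a - 2 * u.z) * (u.a * bar u.a + 2 * u.z)) := by
    rintro v hv
    rw [h7, hf.smul _ _ (smul_ne_one (unip_ne_one x hx) _), h3] at hv
    rw [← hv, smul_a, smul_z, smul_a, smul_z, unip_a, unip_z, hf.eps_val, hf.slope_val, hux,
      Units.val_mul, Units.val_inv_eq_inv_val, Units.val_mk0, map_mul, map_inv₀, bar_scal,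
      map_inv₀, map_mul, map_inv₀, bar_bar, hb, map_div₀, map_neg, map_one, map_ofNat,
      show u.a * bar u.a - 2 * (x * (u.a * bar u.a)) = u.a * bar u.a * (1 - 2 * x) by ring,
      show u.a * bar u.a + 2 * (x * (u.a * bar u.a)) = u.a * bar u.a * (1 + 2 * x) by ring]
    constructor
    · field_simp
    · field_simp
  exact h4 _ rfl

lemma apply (hf : Inversion f ε l) {u : Heis} (hu : u ≠ 1) :
    (f u).a = -u.a / (u.a * bar u.a - 2 * u.z) ∧
      (f u).z = -u.z / ((u.a * bar u.a - 2 * u.z) * (u.a * bar u.a + 2 * u.z)) := by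
  by_cases ha : u.a ≠ 0
  · exact hf.apply_of_ne ha
  rw [not_not] at ha
  have h2 := two_ne_zero_F
  have hz : u.z ≠ 0 := fun hz => hu (Heis.ext ha hz)
  have h5 := one_add_two_mul_ne_zero u.bar_z
  have h6 := one_sub_two_mul_ne_zero u.bar_z
  have h5' : 1 + u.z * 2 ≠ 0 := by rwa [mul_comm]
  have h6' : 1 - u.z * 2 ≠ 0 := by rwa [mul_comm]
  have h4 : (4 : F) ≠ 0 := by
    rw [show (4 : F) = 2 * 2 by norm_num]
    exact mul_ne_zero h2 h2
  let v : Heis := ⟨-1, u.z, u.bar_z⟩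
  have hv : v.a ≠ 0 := neg_ne_zero.2 one_ne_zero
  have hvu : base * v = u := by
    ext
    · rw [mul_a, base_a, ha]
      exact add_neg_cancel 1
    · rw [mul_z, base_a, base_z, map_one, zero_add]
      change u.z + (1 * bar (-1) - 1 * -1) / 2 = u.z
      rw [map_neg, map_one, sub_self, zero_div, add_zero]
  obtain ⟨-, h1⟩ := hf.rel v (ne_one_of_a hv) (hvu ▸ hu)
  rw [hvu] at h1
  obtain ⟨hva, hvz⟩ := hf.apply_of_ne hv
  have hva' : (f v).a = 1 / (1 - 2 * u.z) := by
    rw [hva]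
    change - -1 / (-1 * bar (-1) - 2 * u.z) = _
    rw [map_neg, map_one, neg_neg, neg_mul_neg, one_mul]
  have hvz' : (f v).z = -u.z / ((1 - 2 * u.z) * (1 + 2 * u.z)) := by
    rw [hvz]
    change -u.z / ((-1 * bar (-1) - 2 * u.z) * (-1 * bar (-1) + 2 * u.z)) = _
    rw [map_neg, map_one, neg_mul_neg, one_mul]
  have hb : bar (1 / (1 - 2 * u.z)) = 1 / (1 + 2 * u.z) := by
    rw [map_div₀, map_sub, map_mul, map_one, map_ofNat, u.bar_z, mul_neg, sub_neg_eq_add]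
  have hqa : (l.flip * f v).a = 2 * u.z / (1 - 2 * u.z) := by
    rw [mul_a, flip_a, hf.l_a_eq, hva']
    field_simp
    ring
  have hqz : (l.flip * f v).z = u.z / ((1 - 2 * u.z) * (1 + 2 * u.z)) := by
    rw [mul_z, flip_a, flip_z, hf.l_a_eq, hf.l_z_eq, hva', hvz', hb, map_neg, map_one]
    field_simp
    ring
  have hqb : bar (2 * u.z / (1 - 2 * u.z)) = -(2 * u.z) / (1 + 2 * u.z) := by
    rw [map_div₀, map_sub, map_mul, map_one, map_ofNat, u.bar_z, mul_neg, sub_neg_eq_add]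
  have hq0 : (l.flip * f v).a ≠ 0 := by rw [hqa]; exact div_ne_zero (mul_ne_zero h2 hz) h6
  obtain ⟨hra, hrz⟩ := hf.apply_of_ne hq0
  have e1 : 2 * u.z / (1 - 2 * u.z) * (-(2 * u.z) / (1 + 2 * u.z)) -
      2 * (u.z / ((1 - 2 * u.z) * (1 + 2 * u.z))) = -(2 * u.z) / (1 - 2 * u.z) := by
    field_simp
    ring
  have e2 : 2 * u.z / (1 - 2 * u.z) * (-(2 * u.z) / (1 + 2 * u.z)) +
      2 * (u.z / ((1 - 2 * u.z) * (1 + 2 * u.z))) = 2 * u.z / (1 + 2 * u.z) := by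
    field_simp
    ring
  rw [hqa, hqb, hqz, e1] at hra
  rw [hqa, hqb, hqz, e1, e2] at hrz
  have hra' : (f (l.flip * f v)).a = 1 := by
    rw [hra, ← neg_div, div_self (div_ne_zero (neg_ne_zero.2 (mul_ne_zero h2 hz)) h6)]
  have hrz' : (f (l.flip * f v)).z = 1 / (4 * u.z) := by
    rw [hrz]
    field_simp
    ring
  rw [h1, mul_a, mul_z, hra', hrz', hf.l_a_eq, hf.l_z_eq, ha, map_neg, map_one]
  constructor
  · ring
  · field_simp
    ring

end Inversion

end Heis

namespace Heis

/-- The map induced on the nontrivial elements by the standard involution of the unitary group. -/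
noncomputable def invert (u : Heis) : Heis where
  a := -u.a / (u.a * bar u.a - 2 * u.z)
  z := -u.z / ((u.a * bar u.a - 2 * u.z) * (u.a * bar u.a + 2 * u.z))
  bar_z := by
    rw [map_div₀, map_mul, map_sub, map_add, map_neg, map_mul, map_mul, bar_bar, u.bar_z, map_ofNat,
      mul_neg, sub_neg_eq_add, ← sub_eq_add_neg, mul_comm (bar u.a), mul_comm (_ + _), ← neg_div]

open Classical in
/-- The standard involution of the unitary group, as a map on isotropic points. -/
noncomputable def swap : Option Heis → Option Heis
  | none => some 1
  | some u => if u = 1 then none else some u.invert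

/-- The translations, the homotheties and the standard involution. -/
def generators : Set (Equiv.Perm (Option Heis)) :=
  {σ | (∃ u : Heis, ∀ x, σ x = x.map (u * ·)) ∨ (∃ τ : Fˣ, ∀ x, σ x = x.map (τ • ·)) ∨
    ∀ x, σ x = swap x}

end Heis

namespace Model
variable {G : Type*} [Group G] {p o : Sylow 37 G} {Φ : (p : Subgroup G) ≃* Heis}
  {e : twoPt p o ≃* Fˣ} {w : G} {ε : Fˣ →* Fˣ} {l : Heis}

/-- The Sylow subgroup with the given coordinates. -/
noncomputable def point (o : Sylow 37 G) (Φ : (p : Subgroup G) ≃* Heis) : Option Heis → Sylow 37 G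
  | none => p
  | some u => (Φ.symm u : G) • o

lemma point_some_one : point o Φ (some 1) = o := by
  change (Φ.symm 1 : G) • o = o
  rw [map_one, Subgroup.coe_one, one_smul]

lemma point_some_ne (hM : Model p o Φ e w ε l) (u : Heis) : point o Φ (some u) ≠ p := by
  intro h
  refine hM.ne (smul_left_cancel (Φ.symm u : G) ?_)
  rw [smul_self_of_mem (Φ.symm u).2]
  exact h

lemma symm_smul_point (u : Heis) (x : Option Heis) :
    (Φ.symm u : G) • point o Φ x = point o Φ (x.map (u * ·)) := by
  cases x with
  | none => exact smul_self_of_mem (Φ.symm u).2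
  | some v =>
    change (Φ.symm u : G) • (Φ.symm v : G) • o = (Φ.symm (u * v) : G) • o
    rw [map_mul, Subgroup.coe_mul, mul_smul]

lemma smul_point (hM : Model p o Φ e w ε l) (τ : Fˣ) (x : Option Heis) :
    (e.symm τ : G) • point o Φ x = point o Φ (x.map (τ • ·)) := by
  obtain ⟨hp, ho⟩ := mem_twoPt.1 (e.symm τ).2
  cases x with
  | none => exact hp
  | some v =>
    obtain ⟨hk, h⟩ := hM.conj (e.symm τ) (Φ.symm v)
    rw [MulEquiv.apply_symm_apply, MulEquiv.apply_symm_apply, ← MulEquiv.eq_symm_apply] at h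
    change (e.symm τ : G) • (Φ.symm v : G) • o = (Φ.symm (τ • v) : G) • o
    rw [← h]
    change _ = ((e.symm τ : G) * (Φ.symm v : G) * (e.symm τ : G)⁻¹) • o
    rw [mul_smul, mul_smul, inv_smul_eq_iff.2 ho.symm]

variable [Finite G]

lemma point_bijective (hA : Arith G) (hM : Model p o Φ e w ε l) :
    Function.Bijective (point o Φ) := by
  constructor
  · rintro (_ | u) (_ | v) h
    · rfl
    · exact absurd h.symm (hM.point_some_ne v)
    · exact absurd h (hM.point_some_ne u)
    · exact congrArg some (Φ.symm.injective
        (Subtype.ext (hA.eq_of_smul_eq hM.ne (Φ.symm u).2 (Φ.symm v).2 h)))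
  · intro q
    by_cases hq : q = p
    · exact ⟨none, hq.symm⟩
    · obtain ⟨u, hu, huq⟩ := hA.exists_smul_eq hM.ne hq
      refine ⟨some (Φ ⟨u, hu⟩), ?_⟩
      change (Φ.symm (Φ ⟨u, hu⟩) : G) • o = q
      rw [MulEquiv.symm_apply_apply, ← huq]

lemma exists_inversion (hA : Arith G) (hM : Model p o Φ e w ε l) :
    ∃ f, Heis.Inversion f ε l ∧
      ∀ u, u ≠ 1 → w • point o Φ (some u) = point o Φ (some (f u)) := by
  obtain ⟨hinj, hsurj⟩ := hM.point_bijective hA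
  have hww : ∀ x : Sylow 37 G, w • w • x = x := fun x => by rw [smul_smul, hM.sq, one_smul]
  have hex : ∀ u, ∃ v, u ≠ 1 → v ≠ 1 ∧ w • point o Φ (some u) = point o Φ (some v) := by
    intro u
    obtain ⟨x, hx⟩ := hsurj (w • point o Φ (some u))
    cases x with
    | none =>
      refine ⟨u, fun hu => absurd ?_ hu⟩
      have h1 : point o Φ (some u) = point o Φ (some 1) :=
        (hww _).symm.trans ((congrArg (w • ·) hx.symm).trans (hM.wp.trans point_some_one.symm))
      exact Option.some_injective _ (hinj h1)
    | some v =>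
      refine ⟨v, fun hu => ⟨?_, hx.symm⟩⟩
      rintro rfl
      exact hM.point_some_ne u ((hww _).symm.trans ((congrArg (w • ·) hx.symm).trans
        ((congrArg (w • ·) point_some_one).trans hM.wo)))
  choose f hf1 hf using hex
  have hq : ∀ {u v}, point o Φ (some u) = point o Φ (some v) → u = v :=
    fun h => Option.some_injective _ (hinj h)
  have hrel : ∀ x : Sylow 37 G, w • (Φ.symm Heis.base : G) • w • x =
      (Φ.symm l : G) • w • (Φ.symm l.flip : G) • x := by
    intro x
    rw [smul_smul, smul_smul, smul_smul, smul_smul, hM.rel]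
  have hf' : ∀ u, u ≠ 1 → f u ≠ 1 := fun u hu => hf1 u hu
  refine ⟨f, ⟨hf', ?_, ?_, ?_, ?_, ?_⟩, fun u hu => hf u hu⟩
  · intro u hu
    refine hq ?_
    rw [← hf _ (hf' u hu), ← hf u hu, hww]
  · intro τ u hu
    refine hq ?_
    rw [← hf _ (Heis.Inversion.smul_ne_one hu τ)]
    change w • point o Φ ((some u).map (τ • ·)) = point o Φ ((some (f u)).map (ε τ • ·))
    rw [← hM.smul_point, ← hM.smul_point, ← hf u hu, ← hM.twist, mul_smul, mul_smul, hww]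
  · intro τ hτ
    refine hM.fix τ (Units.ext ?_)
    rw [frobenius_def, ← pow_succ'] at hτ
    rwa [Units.val_pow_eq_pow_val, Units.val_one]
  · have h1 := hrel p
    rw [hM.wp, smul_self_of_mem (Φ.symm l.flip).2, hM.wp] at h1
    exact hq ((hf _ Heis.base_ne_one).symm.trans h1)
  · intro u hu hbu
    have h1 := hrel (w • point o Φ (some u))
    rw [hww, symm_smul_point, Option.map_some, hf _ hbu, hf u hu, symm_smul_point,
      Option.map_some] at h1
    have h2 : l.flip * f u ≠ 1 := by
      intro h
      rw [h, point_some_one, hM.wo, smul_self_of_mem (Φ.symm l).2] at h1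
      exact hM.point_some_ne _ h1
    rw [hf _ h2, symm_smul_point, Option.map_some] at h1
    exact ⟨h2, hq h1⟩

lemma smul_point_eq_swap (hA : Arith G) (hM : Model p o Φ e w ε l) (x : Option Heis) :
    w • point o Φ x = point o Φ (Heis.swap x) := by
  obtain ⟨f, hf, hfw⟩ := hM.exists_inversion hA
  cases x with
  | none => exact hM.wp.trans point_some_one.symm
  | some u =>
    by_cases hu : u = 1
    · rw [hu, point_some_one, hM.wo, Heis.swap, if_pos rfl]
      rfl
    · have h : f u = u.invert := Heis.ext (hf.apply hu).1 (hf.apply hu).2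
      rw [hfw u hu, h, Heis.swap, if_neg hu]

lemma exists_range_eq (hA : Arith G) (hM : Model p o Φ e w ε l) :
    ∃ ρ : G →* Equiv.Perm (Option Heis), Function.Injective ρ ∧
      ρ.range = Subgroup.closure Heis.generators := by
  let ω := Equiv.ofBijective (point o Φ) (hM.point_bijective hA)
  let ρ : G →* Equiv.Perm (Option Heis) :=
    (ω.symm.permCongrHom : _ →* _).comp (MulAction.toPermHom G (Sylow 37 G))
  have hρ : ∀ g x, point o Φ (ρ g x) = g • point o Φ x := fun g x => ω.apply_symm_apply _
  have hρ' : ∀ {g x y}, g • point o Φ x = point o Φ y → ρ g x = y := fun h =>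
    (hM.point_bijective hA).1 ((hρ _ _).trans h)
  have hT : ∀ u x, ρ (Φ.symm u) x = x.map (u * ·) := fun u x => hρ' (symm_smul_point u x)
  have hK : ∀ τ x, ρ (e.symm τ) x = x.map (τ • ·) := fun τ x => hρ' (hM.smul_point τ x)
  have hw : ∀ x, ρ w x = Heis.swap x := fun x => hρ' (hM.smul_point_eq_swap hA x)
  refine ⟨ρ, (injective_iff_map_eq_one ρ).2 fun g hg => hA.eq_one_of_forall_smul fun q => ?_,
    le_antisymm ?_ ((Subgroup.closure_le _).2 ?_)⟩
  · obtain ⟨x, rfl⟩ := (hM.point_bijective hA).2 q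
    rw [← hρ, hg, Equiv.Perm.one_apply]
  · rw [MonoidHom.range_eq_map, Subgroup.map_le_iff_le_comap]
    set L := (Subgroup.closure Heis.generators).comap ρ
    have hpL : ∀ u ∈ p, u ∈ L := fun u hu => Subgroup.subset_closure (Or.inl ⟨Φ ⟨u, hu⟩, fun x => by
      rw [← hT, MulEquiv.symm_apply_apply]⟩)
    have hKL : ∀ k ∈ twoPt p o, k ∈ L := fun k hk =>
      Subgroup.subset_closure (Or.inr (Or.inl ⟨e ⟨k, hk⟩, fun x => by
        rw [← hK, MulEquiv.symm_apply_apply]⟩))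
    have hwL : w ∈ L := Subgroup.subset_closure (Or.inr (Or.inr hw))
    have hB : ∀ g : G, g • p = p → g ∈ L := by
      intro g hg
      obtain ⟨u, hu, k, hk, rfl⟩ := hA.exists_mul_twoPt hM.ne hg
      exact L.mul_mem (hpL u hu) (hKL k hk)
    intro g _
    by_cases hg : g • p = p
    · exact hB g hg
    · obtain ⟨u, hu, huo⟩ := hA.exists_smul_eq hM.ne hg
      have h1 : u * w ∈ L := L.mul_mem (hpL u hu) hwL
      rw [← mul_inv_cancel_left (u * w) g]
      refine L.mul_mem h1 (hB _ ?_)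
      rw [mul_smul, inv_smul_eq_iff, mul_smul, hM.wp, huo]
  · rintro σ (⟨u, h⟩ | ⟨τ, h⟩ | h)
    · exact ⟨Φ.symm u, Equiv.ext fun x => (hT u x).trans (h x).symm⟩
    · exact ⟨e.symm τ, Equiv.ext fun x => (hK τ x).trans (h x).symm⟩
    · exact ⟨w, Equiv.ext fun x => (hw x).trans (h x).symm⟩

end Model

lemma Arith.nonempty_mulEquiv {G : Type*} [Group G] [Finite G] (hA : Arith G) :
    Nonempty (G ≃* Subgroup.closure Heis.generators) := by
  obtain ⟨p, o, Φ, e, w, ε, l, hM⟩ := hA.exists_model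
  obtain ⟨ρ, hρ, h⟩ := hM.exists_range_eq hA
  exact ⟨(ρ.ofInjective hρ).trans (MulEquiv.subgroupCongr h)⟩

/-- Any two finite groups of order `2^4 * 3^2 * 19^2 * 31 * 37^3 * 43` whose prime graphs have
vertex degrees deg 2 = 3, deg 3 = 2, deg 19 = 3, deg 31 = 1, deg 37 = 2, deg 43 = 1 are isomorphic (the
order and degree pattern of the simple unitary group `U_3(37)`). -/
theorem od_characterization_U_3_37
    (G H : Type*) [Group G] [Finite G] [Group H] [Finite H]
    (hG : Nat.card G = 2^4 * 3^2 * 19^2 * 31 * 37^3 * 43)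
    (hH : Nat.card H = 2^4 * 3^2 * 19^2 * 31 * 37^3 * 43)
    (hG2 : gkDegree G 2 = 3)
    (hG3 : gkDegree G 3 = 2)
    (hG19 : gkDegree G 19 = 3)
    (hG31 : gkDegree G 31 = 1)
    (hG37 : gkDegree G 37 = 2)
    (hG43 : gkDegree G 43 = 1)
    (hH2 : gkDegree H 2 = 3)
    (hH3 : gkDegree H 3 = 2)
    (hH19 : gkDegree H 19 = 3)
    (hH31 : gkDegree H 31 = 1)
    (hH37 : gkDegree H 37 = 2)
    (hH43 : gkDegree H 43 = 1) :
    Nonempty (G ≃* H) := by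
  obtain ⟨φ⟩ := (arith_of_gkDegree hG hG2 hG19 hG31 hG37 hG43).nonempty_mulEquiv
  obtain ⟨ψ⟩ := (arith_of_gkDegree hH hH2 hH19 hH31 hH37 hH43).nonempty_mulEquiv
  exact ⟨φ.trans ψ.symm⟩
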